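/- Let $F$ be a non-archimedean local field with algebraic closure $\overline F$, let $E\subset\overline F$ be a finite tamely ramified Galois extension of $F$, and let $\mathrm{val}$ be the valuation of $\overline F$ that extends the normalized valuation of $F$. Let $\mathbb G$ be a connected reductive (linear algebraic) group defined over $F$ and let $\mathbb H$ be a closed connected $F$-subgroup of $\mathbb G$ containing the derived group $[\mathbb G,\mathbb G]$. Let $\mathbb G^0\subseteq\mathbb G^1\subseteq\dots\subseteq\mathbb G^d=\mathbb G$ be a twisted Levi sequence split by $E$, that is, each $\mathbb G^i$ is a closed $F$-subgroup which is a Levi subgroup of $\mathbb G$ over $E$. Let $\mathbb T$ be a maximal torus of $\mathbb G^0$ which is defined over $F$ and split over $E$; write $\Phi(\mathbb G^i,\mathbb T)$ for the set of roots and $\mathbb U_a$ for the root subgroup of $a\in\Phi(\mathbb G,\mathbb T)$. Let $y$ be a point of $\mathcal B(\mathbb G,F)\cap\mathcal A(\mathbb G,\mathbb T,E)$, i.e. a $\mathrm{Gal}(E/F)$-fixed point of the apartment of $\mathbb T$ in the Bruhat–Tits building of $\mathbb G$ over $E$; it gives filtrations $\mathbb U_a(E)_{y,t}$ $(t\in\mathbb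 R)$ of the groups $\mathbb U_a(E)$, and $\mathbb U_a(E)_{y,t^+}=\bigcup_{t'>t}\mathbb U_a(E)_{y,t'}$. Let $r_0,\dots,r_d$ be real numbers with $0<r_0<\dots<r_{d-1}\le r_d$ if $d>0$, and $0\le r_0$ if $d=0$; put $s_i=r_i/2$. (These are the parts $\vec{\mathbb G},y,\vec r$ of a generic cuspidal $G$-datum $(\vec{\mathbb G},y,\vec r,\rho,\vec\phi)$; the representation $\rho$ and the quasicharacters $\vec\phi$ play no role here.) For an $E$-split torus $\mathbb S$ and $t>0$ put $\mathbb S(E)_t=\{x\in\mathbb S(E):\mathrm{val}(\chi(x)-1)\ge t\text{ for all }\chi\in X^*(\mathbb S)\}$. Write $\mathbb T_{\mathbb H}=\mathbb T\cap\mathbb H$, $G^i=\mathbb G^i(F)$, $H^i=(\mathbb G^i\cap\mathbb H)(F)$. For $0\le i\le d-1$ let $J^{i+1}(E)$ be the subgroup of $\mathbb G^{i+1}(E)$ generated by $\mathbb T(E)_{r_i}$, the $\mathbb U_a(E)_{y,r_i}$ for $a\in\Phi(\mathbb G^i,\mathbb T)$ and the $\mathbb U_b(E)_{y,s_i}$ for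 $b\in\Phi(\mathbb G^{i+1},\mathbb T)\setminus\Phi(\mathbb G^i,\mathbb T)$; let $J^{i+1}_+(E)$ be defined in the same way with $\mathbb U_b(E)_{y,s_i^+}$ in place of $\mathbb U_b(E)_{y,s_i}$; and let $J_H^{i+1}(E)$, $J_{H,+}^{i+1}(E)$ be defined in the same way as $J^{i+1}(E)$, $J_+^{i+1}(E)$, respectively, with $\mathbb T_{\mathbb H}(E)_{r_i}$ in place of $\mathbb T(E)_{r_i}$. Put $J^{i+1}=J^{i+1}(E)\cap G^{i+1}$, $J_+^{i+1}=J_+^{i+1}(E)\cap G^{i+1}$, $J_H^{i+1}=J_H^{i+1}(E)\cap H^{i+1}$ and $J_{H,+}^{i+1}=J_{H,+}^{i+1}(E)\cap H^{i+1}$. Then for all $0\le i\le d-1$ one has $J^{i+1}=J_H^{i+1}\cdot J_+^{i+1}$. Moreover $J_+^{i+1}$ is a normal subgroup of $J^{i+1}$, $J_{H,+}^{i+1}$ is a normal subgroup of $J_H^{i+1}$, $J_H^{i+1}\subseteq J^{i+1}$, and the map $\beta:J_H^{i+1}/J_{H,+}^{i+1}\to J^{i+1}/J_+^{i+1}$,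 $j\,J_{H,+}^{i+1}\mapsto j\,J_+^{i+1}$, is a well-defined group isomorphism; and $J^{i+1}=J_+^{i+1}$ if and only if $J_H^{i+1}=J_{H,+}^{i+1}$. -/

import Mathlib

open scoped Pointwise

noncomputable section

namespace YuGroups

/-!
## Linear algebraic groups

`K` is an algebraically closed field.  A linear algebraic group is a Zariski closed subgroup of
`GL n K`, identified with its group of `K`-points; groups defined over a subfield `k` are those
whose full vanishing ideal is generated by polynomials with coefficients in `k`.
-/

section AlgebraicGroups

variable {K : Type*} [Field K] {n : ℕ}

/-- The `n²` matrix coordinates of an element of `GL n K`. -/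
def coords (g : GL (Fin n) K) : Fin n × Fin n → K :=
  fun ij => (g : Matrix (Fin n) (Fin n) K) ij.1 ij.2

/-- The Zariski topology of `GL n K`, generated by the principal open sets `{f ≠ 0}` of
polynomials `f` in the matrix coordinates. -/
abbrev zariskiTopology (K : Type*) [Field K] (n : ℕ) : TopologicalSpace (GL (Fin n) K) :=
  TopologicalSpace.generateFrom
    {U | ∃ f : MvPolynomial (Fin n × Fin n) K, U = {g | MvPolynomial.eval (coords g) f ≠ 0}}

/-- Zariski closed subsets of `GL n K`. -/
def IsZariskiClosed (S : Set (GL (Fin n) K)) : Prop :=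
  @IsClosed _ (zariskiTopology K n) S

/-- Zariski connected subsets of `GL n K`. -/
def IsZariskiConnected (S : Set (GL (Fin n) K)) : Prop :=
  @IsConnected _ (zariskiTopology K n) S

/-- The polynomial `f` in the matrix coordinates vanishes on `S`. -/
def VanishesOn (f : MvPolynomial (Fin n × Fin n) K) (S : Set (GL (Fin n) K)) : Prop :=
  ∀ g ∈ S, MvPolynomial.eval (coords g) f = 0

/-- `S` is defined over `k`: the ideal of all polynomials vanishing on `S` is generated by
polynomials with coefficients in `k`. -/
def IsDefinedOver (k : Type*) [Field k] [Algebra k K] (S : Set (GL (Fin n) K)) : Prop :=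
  ∀ f : MvPolynomial (Fin n × Fin n) K, VanishesOn f S →
    f ∈ Ideal.span {h : MvPolynomial (Fin n × Fin n) K |
      VanishesOn h S ∧
        ∃ h₀ : MvPolynomial (Fin n × Fin n) k, h = MvPolynomial.map (algebraMap k K) h₀}

/-- The subgroup `GL n k` of `GL n K`. -/
def ratPoints (k : Type*) [Field k] [Algebra k K] : Subgroup (GL (Fin n) K) :=
  (Matrix.GeneralLinearGroup.map (algebraMap k K)).range

/-- `G` is a closed connected algebraic subgroup of `GL n` defined over `k`. -/
structure IsConnectedAlgGroup (k : Type*) [Field k] [Algebra k K]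
    (G : Subgroup (GL (Fin n) K)) : Prop where
  closed : IsZariskiClosed (G : Set (GL (Fin n) K))
  connected : IsZariskiConnected (G : Set (GL (Fin n) K))
  definedOver : IsDefinedOver k (G : Set (GL (Fin n) K))

/-- `G` is a connected reductive group defined over `k`: its only closed connected normal
subgroup consisting of unipotent elements is the trivial one. -/
structure IsConnectedReductive (k : Type*) [Field k] [Algebra k K]
    (G : Subgroup (GL (Fin n) K)) : Prop extends IsConnectedAlgGroup k G where
  unipotentRadical_eq_bot : ∀ N : Subgroup (GL (Fin n) K), N ≤ G →
    IsZariskiClosed (N : Set (GL (Fin n) K)) → IsZariskiConnected (N : Set (GL (Fin n) K)) →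
    (∀ g ∈ G, ∀ x ∈ N, g * x * g⁻¹ ∈ N) →
    (∀ x ∈ N, IsNilpotent ((x : Matrix (Fin n) (Fin n) K) - 1)) → N = ⊥

/-- `S` is a torus split over `k`: closed, connected, and diagonalizable by an element of
`GL n k`. -/
structure IsSplitTorus (k : Type*) [Field k] [Algebra k K]
    (S : Subgroup (GL (Fin n) K)) : Prop where
  closed : IsZariskiClosed (S : Set (GL (Fin n) K))
  connected : IsZariskiConnected (S : Set (GL (Fin n) K))
  diagonalizable : ∃ g ∈ ratPoints (K := K) (n := n) k, ∀ s ∈ S,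
    ((g * s * g⁻¹ : GL (Fin n) K) : Matrix (Fin n) (Fin n) K).IsDiag

/-- `T` is a maximal torus of `G` (over the algebraically closed field `K`). -/
def IsMaximalTorus (G T : Subgroup (GL (Fin n) K)) : Prop :=
  Maximal (fun S : Subgroup (GL (Fin n) K) => IsSplitTorus K S ∧ S ≤ G) T

/-- `L` is a Levi `k`-subgroup of `G`, i.e. the centralizer in `G` of a `k`-split torus
of `G`. -/
def IsLevi (k : Type*) [Field k] [Algebra k K] (G L : Subgroup (GL (Fin n) K)) : Prop :=
  ∃ S : Subgroup (GL (Fin n) K), IsSplitTorus k S ∧ S ≤ G ∧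
    L = G ⊓ Subgroup.centralizer (S : Set (GL (Fin n) K))

/-- Rational characters of `S`, i.e. the elements of `X^*(S)`: homomorphisms `S → Kˣ` given by
a regular function `P / det ^ m`. -/
def IsRationalCharacter (S : Subgroup (GL (Fin n) K)) (χ : S →* Kˣ) : Prop :=
  ∃ (P : MvPolynomial (Fin n × Fin n) K) (m : ℕ), ∀ s : S,
    (χ s : K) * ((s : GL (Fin n) K) : Matrix (Fin n) (Fin n) K).det ^ m =
      MvPolynomial.eval (coords (s : GL (Fin n) K)) P

/-- The Lie algebra of `G`, i.e. the tangent space of `G` at `1` inside the space of matrices. -/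
def lieAlg (G : Subgroup (GL (Fin n) K)) : Set (Matrix (Fin n) (Fin n) K) :=
  {X | ∀ f : MvPolynomial (Fin n × Fin n) K, VanishesOn f (G : Set (GL (Fin n) K)) →
    ∑ ij : Fin n × Fin n,
      X ij.1 ij.2 * MvPolynomial.eval (coords (1 : GL (Fin n) K)) (MvPolynomial.pderiv ij f) = 0}

/-- The roots `Φ(G, T)`: the nontrivial characters of `T` occurring in the adjoint action of `T`
on the Lie algebra of `G`.  Characters are written multiplicatively, so the negative of a root
`a` is `a⁻¹`. -/
def roots (G T : Subgroup (GL (Fin n) K)) : Set (T →* Kˣ) :=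
  {a | IsRationalCharacter T a ∧ a ≠ 1 ∧ ∃ X ∈ lieAlg G, X ≠ 0 ∧ ∀ t : T,
    ((t : GL (Fin n) K) : Matrix (Fin n) (Fin n) K) * X *
      (((t : GL (Fin n) K)⁻¹ : GL (Fin n) K) : Matrix (Fin n) (Fin n) K) = (a t : K) • X}

/-- The element `(1, c; 0, 1)` of `SL₂`. -/
def upperSL (c : K) : Matrix.SpecialLinearGroup (Fin 2) K :=
  ⟨!![1, c; 0, 1], by simp [Matrix.det_fin_two]⟩

/-- The element `(1, 0; c, 1)` of `SL₂`. -/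
def lowerSL (c : K) : Matrix.SpecialLinearGroup (Fin 2) K :=
  ⟨!![1, 0; c, 1], by simp [Matrix.det_fin_two]⟩

/-- The element `diag(c, c⁻¹)` of `SL₂`. -/
def diagSL (c : Kˣ) : Matrix.SpecialLinearGroup (Fin 2) K :=
  ⟨!![(c : K), 0; 0, ((c⁻¹ : Kˣ) : K)], by simp [Matrix.det_fin_two]⟩

/-- A realization over `k` of the root system `Φ(G, T)` in `G`: for each root `a` an isomorphism
`u a`, defined over `k`, of the additive group onto the root subgroup `U_a` of `G`, such that
`u a` and `u a⁻¹` are the images of the standard unipotents under a homomorphism from `SL₂`,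
whose restriction to the diagonal is the coroot of `a`. (Values of `u` outside `Φ(G, T)` play
no role.) -/
structure IsRealization (k : Type*) [Field k] [Algebra k K]
    (G T : Subgroup (GL (Fin n) K)) (u : (T →* Kˣ) → K → GL (Fin n) K) : Prop where
  mem : ∀ a ∈ roots G T, ∀ c, u a c ∈ G
  map_add : ∀ a ∈ roots G T, ∀ c d, u a (c + d) = u a c * u a d
  /-- `u a` is a morphism of varieties over `k`. -/
  regular : ∀ a ∈ roots G T, ∀ i j : Fin n, ∃ P : Polynomial k, ∀ c : K,
    (u a c : Matrix (Fin n) (Fin n) K) i j = Polynomial.aeval c P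
  /-- `u a` is an isomorphism of varieties over `k` onto its image. -/
  regular_inv : ∀ a ∈ roots G T, ∃ f : MvPolynomial (Fin n × Fin n) k, ∀ c : K,
    MvPolynomial.aeval (coords (u a c)) f = c
  torus_conj : ∀ a ∈ roots G T, ∀ (t : T) (c : K),
    (t : GL (Fin n) K) * u a c * (t : GL (Fin n) K)⁻¹ = u a ((a t : K) * c)
  sl₂ : ∀ a ∈ roots G T, ∃ ζ : Matrix.SpecialLinearGroup (Fin 2) K →* GL (Fin n) K,
    (∀ c, ζ (upperSL c) = u a c) ∧ (∀ c, ζ (lowerSL c) = u a⁻¹ c) ∧ ∀ c, ζ (diagSL c) ∈ T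

/-- The group `U_a(k)` of `k`-points of the root subgroup `U_a`. -/
def rootGroup (k : Type*) [Field k] [Algebra k K] {T : Subgroup (GL (Fin n) K)}
    (u : (T →* Kˣ) → K → GL (Fin n) K) (a : T →* Kˣ) : Set (GL (Fin n) K) :=
  Set.range (u a) ∩ (ratPoints (K := K) (n := n) k : Set (GL (Fin n) K))

/-- The coset `M_a = T(k) n_a`, where `n_a = u_a(1) u_{-a}(-1) u_a(1)` represents the reflection
in the root `a`. -/
def reflectionCoset (k : Type*) [Field k] [Algebra k K] {T : Subgroup (GL (Fin n) K)}
    (u : (T →* Kˣ) → K → GL (Fin n) K) (a : T →* Kˣ) : Set (GL (Fin n) K) :=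
  {m | ∃ t ∈ T ⊓ ratPoints (K := K) (n := n) k, m = t * (u a 1 * u a⁻¹ (-1) * u a 1)}

/-- A twisted Levi sequence `G⁰ ⊆ G¹ ⊆ … ⊆ G^d = G` which is split by `E`: every `G^i` is
a closed subgroup of `G` defined over `F`, and is a Levi subgroup of `G` over `E`. -/
structure IsTwistedLeviSequence (F E : Type*) [Field F] [Algebra F K] [Field E] [Algebra E K]
    (G : Subgroup (GL (Fin n) K)) {d : ℕ} (Gs : Fin (d + 1) → Subgroup (GL (Fin n) K)) :
    Prop where
  mono : Monotone Gs
  last : Gs (Fin.last d) = G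
  definedOver : ∀ i, IsDefinedOver F (Gs i : Set (GL (Fin n) K))
  levi : ∀ i, IsLevi E G (Gs i)

end AlgebraicGroups

/-!
## The valuation of a local field and of its algebraic closure
-/

section Valuation

variable {F : Type*} [Field F] [ValuativeRel F] [TopologicalSpace F] [IsNonarchimedeanLocalField F]
  {K : Type*} [Field K] [Algebra F K]

/-- The normalized valuation `Fˣ → ℤ` of a non-archimedean local field (with junk value at `0`). -/
def valInt (x : F) : ℤ :=
  -WithZero.log
    (IsNonarchimedeanLocalField.valueGroupWithZeroIsoInt F (ValuativeRel.valuation F x))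

variable (F) in
/-- The unique extension to an algebraic extension `K` of `F` of the normalized valuation of `F`:
`val x = val (N_{F(x)/F} x) / [F(x) : F]`, and `val 0 = ∞`. -/
def val (x : K) : WithTop ℝ :=
  open Classical in
  if x = 0 then ⊤
  else (((valInt ((minpoly F x).coeff 0) : ℝ) / ((minpoly F x).natDegree : ℝ) : ℝ) : WithTop ℝ)

/-- The value group `val(Lˣ) ⊆ ℝ` of an intermediate field. -/
def valueGroup (L : IntermediateField F K) : AddSubgroup ℝ :=
  AddSubgroup.closure {ρ : ℝ | ∃ x ∈ L, val F x = (ρ : WithTop ℝ)}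

/-- `E / F` is tamely ramified: its ramification index `[val(Eˣ) : val(Fˣ)]` is prime to the
residual characteristic. (The residue field extension is separable since residue fields are
finite.) -/
def IsTamelyRamified (E : IntermediateField F K) : Prop :=
  ((valueGroup (⊥ : IntermediateField F K)).relIndex (valueGroup E)).Coprime
    (ringChar (IsLocalRing.ResidueField (ValuativeRel.valuation F).integer))

end Valuation

/-!
## Points of the apartment
-/

section Apartment

variable {F : Type*} [Field F] [ValuativeRel F] [TopologicalSpace F] [IsNonarchimedeanLocalField F]
  {K : Type*} [Field K] [Algebra F K] {n : ℕ}

/-- Points of the apartment of `T` in the Bruhat–Tits building of `G` over `E`, for an `E`-split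
maximal torus `T`: valuations `y = (y_a)` of the root datum `(T(E), U_a(E))`, in the sense
of Bruhat and Tits, which are compatible with the valuation of `E`. The function `y a` is only
relevant on `U_a(E)`. (The axiom about pairs `a, 2a` of roots is void as `Φ(G, T)` is reduced, and
for the same reason `b ∉ -ℝ₊ a` amounts to `b ≠ -a`. The coordinate of a point in the
central directions of the extended apartment does not enter the filtrations.) -/
structure IsApartmentPoint (E : IntermediateField F K) (G T : Subgroup (GL (Fin n) K))
    (u : (T →* Kˣ) → K → GL (Fin n) K) (y : (T →* Kˣ) → GL (Fin n) K → WithTop ℝ) : Prop where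
  /-- (V0) -/
  three_values : ∀ a ∈ roots G T, 3 ≤ (y a '' rootGroup E u a).encard
  /-- (V1) -/
  subgroup : ∀ a ∈ roots G T, ∀ k : WithTop ℝ, ∃ S : Subgroup (GL (Fin n) K),
    (S : Set (GL (Fin n) K)) = {g ∈ rootGroup E u a | k ≤ y a g}
  eq_top_iff : ∀ a ∈ roots G T, ∀ g ∈ rootGroup E u a, y a g = ⊤ ↔ g = 1
  /-- (V2) -/
  reflection : ∀ a ∈ roots G T, ∀ m ∈ reflectionCoset E u a, ∃ k : ℝ,
    ∀ g ∈ rootGroup E u a⁻¹, g ≠ 1 → y a⁻¹ g = y a (m * g * m⁻¹) + (k : WithTop ℝ)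
  /-- (V3) -/
  commutator : ∀ a ∈ roots G T, ∀ b ∈ roots G T, b ≠ a⁻¹ → ∀ k l : ℝ,
    ∀ g ∈ rootGroup E u a, (k : WithTop ℝ) ≤ y a g →
    ∀ h ∈ rootGroup E u b, (l : WithTop ℝ) ≤ y b h →
    g * h * g⁻¹ * h⁻¹ ∈ Subgroup.closure {x : GL (Fin n) K | ∃ p q : ℕ, 0 < p ∧ 0 < q ∧
      a ^ p * b ^ q ∈ roots G T ∧ x ∈ rootGroup E u (a ^ p * b ^ q) ∧
      ((p * k + q * l : ℝ) : WithTop ℝ) ≤ y (a ^ p * b ^ q) x}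
  /-- (V5) -/
  opposite : ∀ a ∈ roots G T, ∀ g ∈ rootGroup E u a,
    ∀ g' ∈ rootGroup E u a⁻¹, ∀ g'' ∈ rootGroup E u a⁻¹,
    g' * g * g'' ∈ reflectionCoset E u a → y a⁻¹ g' + y a g = 0
  /-- Compatibility with the valuation of `E`. -/
  torus_conj : ∀ a ∈ roots G T, ∀ t : T,
    (t : GL (Fin n) K) ∈ ratPoints (K := K) (n := n) E → ∀ g ∈ rootGroup E u a,
    y a ((t : GL (Fin n) K) * g * (t : GL (Fin n) K)⁻¹) = y a g + val F (a t : K)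

/-- The point `y` of the apartment of `T` over `E` is fixed by the Galois group, i.e. it belongs
to the building of `G` over `F`: every automorphism `σ` sends each `U_a(E)` to some `U_b(E)`
(so that `b = σ a`), carrying `y_a` to `y_b`. -/
def IsGaloisFixed (E : IntermediateField F K) (G T : Subgroup (GL (Fin n) K))
    (u : (T →* Kˣ) → K → GL (Fin n) K) (y : (T →* Kˣ) → GL (Fin n) K → WithTop ℝ) : Prop :=
  ∀ σ : K ≃ₐ[F] K, ∀ a ∈ roots G T, ∃ b ∈ roots G T, ∀ g ∈ rootGroup E u a,
    Matrix.GeneralLinearGroup.map (σ : K →+* K) g ∈ rootGroup E u b ∧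
      y b (Matrix.GeneralLinearGroup.map (σ : K →+* K) g) = y a g

/-!
## The groups `J` and `J₊`
-/

/-- The filtration subgroup `S(E)_ρ`, `ρ > 0`, of an `E`-split torus `S`: the elements `s` of
`S(E)` with `val (χ(s) - 1) ≥ ρ` for all characters `χ` of `S`. -/
def torusFiltration (E : IntermediateField F K) (S : Subgroup (GL (Fin n) K)) (ρ : ℝ) :
    Set (GL (Fin n) K) :=
  {g | g ∈ ratPoints (K := K) (n := n) E ∧ ∃ h : g ∈ S, ∀ χ : S →* Kˣ, IsRationalCharacter S χ →
    (ρ : WithTop ℝ) ≤ val F ((χ ⟨g, h⟩ : K) - 1)}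

/-- The filtration subgroup `U_a(E)_{y,ρ}`. -/
def rootFiltration (E : IntermediateField F K) {T : Subgroup (GL (Fin n) K)}
    (u : (T →* Kˣ) → K → GL (Fin n) K) (y : (T →* Kˣ) → GL (Fin n) K → WithTop ℝ)
    (a : T →* Kˣ) (ρ : ℝ) : Set (GL (Fin n) K) :=
  {g ∈ rootGroup E u a | (ρ : WithTop ℝ) ≤ y a g}

/-- The filtration subgroup `U_a(E)_{y,ρ⁺}`, the union of the `U_a(E)_{y,t}` for `t > ρ`. -/
def rootFiltrationPlus (E : IntermediateField F K) {T : Subgroup (GL (Fin n) K)}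
    (u : (T →* Kˣ) → K → GL (Fin n) K) (y : (T →* Kˣ) → GL (Fin n) K → WithTop ℝ)
    (a : T →* Kˣ) (ρ : ℝ) : Set (GL (Fin n) K) :=
  ⋃ t : {t : ℝ // ρ < t}, rootFiltration E u y a t

/-- The subgroup generated by `S(E)_r`, the `U_a(E)_{y,r}` for `a ∈ Φ(G', T)` and
the `U_b(E)_{y,r/2}` for `b ∈ Φ(G'', T) ∖ Φ(G', T)`. With `G' = G^i`, `G'' = G^{i+1}`,
`r = r_i` it is `J^{i+1}(E)` for `S = T`, and `J_H^{i+1}(E)` for `S = T ∩ H`. -/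
def JE (E : IntermediateField F K) (G' G'' S : Subgroup (GL (Fin n) K))
    {T : Subgroup (GL (Fin n) K)} (u : (T →* Kˣ) → K → GL (Fin n) K)
    (y : (T →* Kˣ) → GL (Fin n) K → WithTop ℝ) (r : ℝ) : Subgroup (GL (Fin n) K) :=
  Subgroup.closure (torusFiltration E S r ∪
    (⋃ a ∈ roots G' T, rootFiltration E u y a r) ∪
    ⋃ b ∈ roots G'' T \ roots G' T, rootFiltration E u y b (r / 2))

/-- The subgroup generated by `S(E)_r`, the `U_a(E)_{y,r}` for `a ∈ Φ(G', T)` and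
the `U_b(E)_{y,(r/2)⁺}` for `b ∈ Φ(G'', T) ∖ Φ(G', T)`. With `G' = G^i`, `G'' = G^{i+1}`,
`r = r_i` it is `J₊^{i+1}(E)` for `S = T`, and `J_{H,+}^{i+1}(E)` for `S = T ∩ H`. -/
def JEplus (E : IntermediateField F K) (G' G'' S : Subgroup (GL (Fin n) K))
    {T : Subgroup (GL (Fin n) K)} (u : (T →* Kˣ) → K → GL (Fin n) K)
    (y : (T →* Kˣ) → GL (Fin n) K → WithTop ℝ) (r : ℝ) : Subgroup (GL (Fin n) K) :=
  Subgroup.closure (torusFiltration E S r ∪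
    (⋃ a ∈ roots G' T, rootFiltration E u y a r) ∪
    ⋃ b ∈ roots G'' T \ roots G' T, rootFiltrationPlus E u y b (r / 2))

variable {d : ℕ} (E : IntermediateField F K) (Gs : Fin (d + 1) → Subgroup (GL (Fin n) K))
  (H : Subgroup (GL (Fin n) K)) {T : Subgroup (GL (Fin n) K)}
  (u : (T →* Kˣ) → K → GL (Fin n) K) (y : (T →* Kˣ) → GL (Fin n) K → WithTop ℝ)
  (r : Fin (d + 1) → ℝ) (i : Fin d)

/-- `J^{i+1} = J^{i+1}(E) ∩ G^{i+1}(F)`. -/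
def J : Subgroup (GL (Fin n) K) :=
  JE E (Gs i.castSucc) (Gs i.succ) T u y (r i.castSucc) ⊓
    (Gs i.succ ⊓ ratPoints (K := K) (n := n) F)

/-- `J₊^{i+1} = J₊^{i+1}(E) ∩ G^{i+1}(F)`. -/
def Jplus : Subgroup (GL (Fin n) K) :=
  JEplus E (Gs i.castSucc) (Gs i.succ) T u y (r i.castSucc) ⊓
    (Gs i.succ ⊓ ratPoints (K := K) (n := n) F)

/-- `J_H^{i+1} = J_H^{i+1}(E) ∩ H^{i+1}(F)`, where `H^{i+1} = G^{i+1} ∩ H`. -/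
def JH : Subgroup (GL (Fin n) K) :=
  JE E (Gs i.castSucc) (Gs i.succ) (T ⊓ H) u y (r i.castSucc) ⊓
    (Gs i.succ ⊓ H ⊓ ratPoints (K := K) (n := n) F)

/-- `J_{H,+}^{i+1} = J_{H,+}^{i+1}(E) ∩ H^{i+1}(F)`, where `H^{i+1} = G^{i+1} ∩ H`. -/
def JHplus : Subgroup (GL (Fin n) K) :=
  JEplus E (Gs i.castSucc) (Gs i.succ) (T ⊓ H) u y (r i.castSucc) ⊓
    (Gs i.succ ⊓ H ⊓ ratPoints (K := K) (n := n) F)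

end Apartment

/-- The depth condition on a datum: `0 < r_0 < ⋯ < r_{d-1} ≤ r_d` if `d > 0`, and `0 ≤ r_0` if
`d = 0`. -/
structure IsDepthSequence {d : ℕ} (r : Fin (d + 1) → ℝ) : Prop where
  pos : ∀ i : Fin d, 0 < r i.castSucc
  strictMono : StrictMono fun i : Fin d => r i.castSucc
  le_last : ∀ i : Fin d, r i.castSucc ≤ r (Fin.last d)
  last_nonneg : 0 ≤ r (Fin.last d)

end YuGroups

end

open scoped Pointwise

noncomputable section

namespace YuGroups

section LocalField

open ValuativeRel in
/-- The norm `2 ^ (-val x)` of a non-archimedean local field. -/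
theorem exists_nontriviallyNormedField (F : Type*) [Field F] [ValuativeRel F] [TopologicalSpace F]
    [IsNonarchimedeanLocalField F] :
    ∃ N : NontriviallyNormedField F, N.toField = ‹Field F› ∧
      @IsUltrametricDist F N.toDist ∧ @ProperSpace F N.toPseudoMetricSpace ∧
      ∀ x : F, x ≠ 0 → N.toNorm.norm x = (2 : ℝ) ^ (-(valInt x : ℝ)) := by
  let _ := IsTopologicalAddGroup.rightUniformSpace F
  have := isUniformAddGroup_of_addCommGroup (G := F)
  let R : (Valued.v (R := F)).RankOne :=
  { hom' := ((WithZeroMulInt.toNNReal (e := 2) (by norm_num)).comp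
      { toFun := IsNonarchimedeanLocalField.valueGroupWithZeroIsoInt F
        map_zero' := map_zero _
        map_one' := map_one _
        map_mul' := map_mul _ }).comp
      MonoidWithZeroHom.ValueGroup₀.embedding
    strictMono' := (WithZeroMulInt.toNNReal_strictMono (by norm_num)).comp
      ((IsNonarchimedeanLocalField.valueGroupWithZeroIsoInt F).strictMono.comp
        MonoidWithZeroHom.ValueGroup₀.embedding_strictMono)}
  let N : NontriviallyNormedField F :=
    Valued.toNontriviallyNormedField F (ValueGroupWithZero F)
  refine ⟨N, rfl, ?_, ?_, ?_⟩
  · exact inferInstanceAs (@IsUltrametricDist F (Valued.toNormedField F _).toDist)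
  · have : @WeaklyLocallyCompactSpace F N.toUniformSpace.toTopologicalSpace :=
      inferInstanceAs (WeaklyLocallyCompactSpace F)
    exact @ProperSpace.of_nontriviallyNormedField_of_weaklyLocallyCompactSpace F N this
  · intro x hx
    have h1 : N.toNorm.norm x = ((WithZeroMulInt.toNNReal (e := 2) (by norm_num)
        (IsNonarchimedeanLocalField.valueGroupWithZeroIsoInt F (valuation F x)) : NNReal) : ℝ) := by
      change ((R.hom _ (Valued.v.restrict x) : NNReal) : ℝ) = _
      simp only [Valuation.RankOne.hom, Valuation.RankLeOne.hom', R]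
      simp
      rfl
    have h2 : IsNonarchimedeanLocalField.valueGroupWithZeroIsoInt F (valuation F x) ≠ 0 := by
      simp [hx]
    rw [h1, WithZeroMulInt.toNNReal_neg_apply _ h2, WithZero.toAdd_unzero_eq_log, valInt]
    push_cast
    rw [neg_neg, Real.rpow_intCast]

/-- The extension of the absolute value of a local field to an algebraic extension. -/
theorem exists_mulNorm (F K : Type*) [Field F] [ValuativeRel F] [TopologicalSpace F]
    [IsNonarchimedeanLocalField F] [Field K] [Algebra F K] [Algebra.IsAlgebraic F K] :
    ∃ ν : K → ℝ, (∀ x, 0 ≤ ν x) ∧ (∀ x, ν x = 0 ↔ x = 0) ∧ (∀ x y, ν (x * y) = ν x * ν y) ∧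
      (∀ x y, ν (x + y) ≤ max (ν x) (ν y)) ∧
      (∀ x, x ≠ 0 → val F x = ((-Real.logb 2 (ν x) : ℝ) : WithTop ℝ)) ∧
      (FiniteDimensional F K → ∀ x : ℕ → K, ∀ ρ : ℕ → ℝ, Antitone ρ →
        Filter.Tendsto ρ Filter.atTop (nhds 0) → (∀ k, ν (x (k + 1) - x k) ≤ ρ k) →
        ∃ z, ∀ k, ν (z - x k) ≤ ρ k) ∧
      (FiniteDimensional F K → ∀ x : ℕ → K, (∀ k, ν (x k) ≤ 1) →
        ∃ i j, i < j ∧ ν (x j - x i) < 1) := by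
  obtain ⟨N, hN, hu, hc, hv⟩ := exists_nontriviallyNormedField F
  subst hN
  refine ⟨spectralNorm F K, spectralNorm_nonneg, ?_, ?_, ?_, ?_, ?_, ?_⟩
  · intro x
    exact ⟨fun h => eq_zero_of_map_spectralNorm_eq_zero h (Algebra.IsAlgebraic.isAlgebraic x),
      fun h => by rw [h, spectralNorm_zero]⟩
  · intro x y
    simp [← spectralMulAlgNorm_def, map_mul]
  · exact isNonarchimedean_spectralNorm
  · intro x hx
    have hi : IsIntegral F x := Algebra.IsIntegral.isIntegral x
    rw [val, if_neg hx, spectralNorm.spectralNorm_eq_norm_coeff_zero_rpow,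
      hv _ (minpoly.coeff_zero_ne_zero hi hx), ← Real.rpow_mul (by norm_num),
      Real.logb_rpow (by norm_num) (by norm_num)]
    congr 1
    ring
  · intro hfd x ρ hρ hρ0 hx
    let _ := spectralNorm.normedField F K
    have hcK : CompleteSpace K := spectralNorm.completeSpace (K := F) (L := K)
    have hK : IsUltrametricDist K := IsUltrametricDist.isUltrametricDist_of_isNonarchimedean_norm
      isNonarchimedean_spectralNorm
    have key : ∀ k m, k ≤ m → ‖x m - x k‖ ≤ ρ k := by
      intro k m hkm
      induction m, hkm using Nat.le_induction with
      | base => simpa using (norm_nonneg (x (k + 1) - x k)).trans (hx k)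
      | succ m hm ih =>
        have : x (m + 1) - x k = (x (m + 1) - x m) + (x m - x k) := by ring
        rw [this]
        exact (IsUltrametricDist.norm_add_le_max _ _).trans
          (max_le ((hx m).trans (hρ hm)) ih)
    have hcau : CauchySeq x := cauchySeq_of_le_tendsto_0' ρ (fun k m hkm => by
      rw [dist_comm, dist_eq_norm]; exact key k m hkm) hρ0
    obtain ⟨z, hz⟩ := cauchySeq_tendsto_of_complete hcau
    refine ⟨z, fun k => ?_⟩
    have : Filter.Tendsto (fun m => ‖x m - x k‖) Filter.atTop (nhds ‖z - x k‖) :=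
      (hz.sub_const _).norm
    exact le_of_tendsto this (Filter.eventually_atTop.2 ⟨k, fun m hm => key k m hm⟩)
  · intro hfd x hx
    let _ := spectralNorm.normedField F K
    let _ := spectralNorm.normedSpace F K
    have hcK : ProperSpace K := FiniteDimensional.proper F K
    obtain ⟨z, -, φ, hφ, hz⟩ := (isCompact_closedBall (0 : K) 1).tendsto_subseq
      (x := x) fun k => mem_closedBall_zero_iff.2 (hx k)
    obtain ⟨m, hm⟩ := Metric.cauchySeq_iff.1 hz.cauchySeq 1 one_pos
    refine ⟨φ m, φ (m + 1), hφ (Nat.lt_succ_self m), ?_⟩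
    have := hm (m + 1) (Nat.le_succ m) m le_rfl
    rwa [dist_eq_norm] at this

end LocalField

section Val

variable {F : Type*} [Field F] [ValuativeRel F] [TopologicalSpace F] [IsNonarchimedeanLocalField F]
  {K : Type*} [Field K] [Algebra F K]

@[simp] theorem val_zero : val F (0 : K) = ⊤ := by simp [val]

theorem exists_val_eq {x : K} (hx : x ≠ 0) : ∃ c : ℝ, val F x = c := by
  simp [val, hx]

theorem val_map (σ : K ≃ₐ[F] K) (x : K) : val F (σ x) = val F x := by
  by_cases h : x = 0
  · simp [h]
  · simp [val, h, minpoly.algEquiv_eq]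

theorem val_coe {E : IntermediateField F K} (x : E) : val F (x : K) = val F x := by
  by_cases h : x = 0
  · simp [h]
  · have : minpoly F (x : K) = minpoly F x := minpoly.algebraMap_eq (algebraMap E K).injective x
    simp [val, h, this]

variable [Algebra.IsAlgebraic F K]

theorem val_mul (x y : K) : val F (x * y) = val F x + val F y := by
  obtain ⟨ν, h0, hz, hm, ha, hv, -, -⟩ := exists_mulNorm F K
  by_cases hx : x = 0
  · simp [hx]
  by_cases hy : y = 0
  · simp [hy]
  have hx' : ν x ≠ 0 := fun h => hx ((hz x).1 h)
  have hy' : ν y ≠ 0 := fun h => hy ((hz y).1 h)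
  rw [hv x hx, hv y hy, hv _ (mul_ne_zero hx hy), hm, Real.logb_mul hx' hy', ← WithTop.coe_add]
  congr 1
  ring

theorem le_val_add {x y : K} {c : WithTop ℝ} (hx : c ≤ val F x) (hy : c ≤ val F y) :
    c ≤ val F (x + y) := by
  obtain ⟨ν, h0, hz, hm, ha, hv, -, -⟩ := exists_mulNorm F K
  by_cases hx0 : x = 0
  · simpa [hx0] using hy
  by_cases hy0 : y = 0
  · simpa [hy0] using hx
  by_cases hxy : x + y = 0
  · simp [hxy]
  have hpos : ∀ z : K, z ≠ 0 → 0 < ν z := fun z h =>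
    lt_of_le_of_ne (h0 z) fun h' => h ((hz z).1 h'.symm)
  rcases le_max_iff.1 (ha x y) with h | h
  · refine hx.trans ?_
    rw [hv x hx0, hv _ hxy, WithTop.coe_le_coe]
    exact neg_le_neg (Real.logb_le_logb_of_le (by norm_num) (hpos _ hxy) h)
  · refine hy.trans ?_
    rw [hv y hy0, hv _ hxy, WithTop.coe_le_coe]
    exact neg_le_neg (Real.logb_le_logb_of_le (by norm_num) (hpos _ hxy) h)

@[simp] theorem val_one : val F (1 : K) = 0 := by
  obtain ⟨c, hc⟩ := exists_val_eq (F := F) (one_ne_zero (α := K))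
  have := val_mul (F := F) (1 : K) 1
  rw [mul_one, hc, ← WithTop.coe_add, WithTop.coe_inj] at this
  rw [hc]
  norm_cast
  linarith

theorem val_pow (x : K) (k : ℕ) : val F (x ^ k) = k • val F x := by
  induction k with
  | zero => simp
  | succ k ih => rw [pow_succ, val_mul, ih, succ_nsmul]

@[simp] theorem val_neg_one : val F (-1 : K) = 0 := by
  obtain ⟨c, hc⟩ := exists_val_eq (F := F) (neg_ne_zero.2 (one_ne_zero (α := K)))
  have := val_mul (F := F) (-1 : K) (-1)
  rw [neg_mul_neg, mul_one, val_one, hc, ← WithTop.coe_add, ← WithTop.coe_zero,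
    WithTop.coe_inj] at this
  rw [hc]
  norm_cast
  linarith

@[simp] theorem val_neg (x : K) : val F (-x) = val F x := by
  rw [← neg_one_mul, val_mul, val_neg_one, zero_add]

theorem val_sub_comm (x y : K) : val F (x - y) = val F (y - x) := by
  rw [← val_neg, neg_sub]

theorem le_val_sub {x y : K} {c : WithTop ℝ} (hx : c ≤ val F x) (hy : c ≤ val F y) :
    c ≤ val F (x - y) := by
  rw [sub_eq_add_neg]
  exact le_val_add hx (by rwa [val_neg])

theorem le_val_sum {ι : Type*} (s : Finset ι) (f : ι → K) {c : WithTop ℝ}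
    (h : ∀ i ∈ s, c ≤ val F (f i)) : c ≤ val F (∑ i ∈ s, f i) := by
  classical
  induction s using Finset.induction_on with
  | empty => simp
  | insert i s hi ih =>
    rw [Finset.sum_insert hi]
    exact le_val_add (h i (Finset.mem_insert_self i s))
      (ih fun j hj => h j (Finset.mem_insert_of_mem hj))

theorem le_val_mul {x y : K} {a b : ℝ} (hx : (a : WithTop ℝ) ≤ val F x)
    (hy : (b : WithTop ℝ) ≤ val F y) : ((a + b : ℝ) : WithTop ℝ) ≤ val F (x * y) := by
  rw [val_mul, WithTop.coe_add]
  exact add_le_add hx hy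

theorem val_add_val_inv {x : K} (hx : x ≠ 0) : val F x + val F x⁻¹ = 0 := by
  rw [← val_mul, mul_inv_cancel₀ hx, val_one]

theorem val_inv_eq {x : K} {c : ℝ} (hx : val F x = c) : val F x⁻¹ = ((-c : ℝ) : WithTop ℝ) := by
  have hx0 : x ≠ 0 := fun h => by simp [h] at hx
  obtain ⟨d, hd⟩ := exists_val_eq (F := F) (inv_ne_zero hx0)
  have := val_add_val_inv (F := F) hx0
  rw [hx, hd, ← WithTop.coe_add, ← WithTop.coe_zero, WithTop.coe_inj] at this
  rw [hd, WithTop.coe_inj]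
  linarith

theorem val_inv_eq_zero {x : K} (hx : val F x = 0) : val F x⁻¹ = 0 := by
  have := val_inv_eq (F := F) (x := x) (c := 0) (by simpa using hx)
  simpa using this

theorem val_natCast_nonneg (m : ℕ) : 0 ≤ val F (m : K) := by
  induction m with
  | zero => simp
  | succ m ih => push_cast; exact le_val_add ih (by simp)

theorem val_intCast_nonneg (m : ℤ) : 0 ≤ val F (m : K) := by
  rcases Int.eq_nat_or_neg m with ⟨k, rfl | rfl⟩
  · simpa using val_natCast_nonneg k
  · simpa using val_natCast_nonneg k

/-- Elements close to `1` are units. -/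
theorem val_eq_zero_of_sub_one {x : K} {c : ℝ} (hc : 0 < c)
    (hx : (c : WithTop ℝ) ≤ val F (x - 1)) : val F x = 0 := by
  have h0 : (0 : WithTop ℝ) ≤ val F (x - 1) := le_trans (by exact_mod_cast hc.le) hx
  have h1 : 0 ≤ val F x := by
    have := le_val_add (F := F) h0 (val_one (F := F) (K := K)).ge
    simpa using this
  refine le_antisymm ?_ h1
  by_contra hlt
  rw [not_le] at hlt
  by_cases hx0 : x = 0
  · rw [hx0, zero_sub, val_neg_one] at hx
    exact absurd hx (not_le.2 (by exact_mod_cast hc))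
  obtain ⟨d, hd⟩ := exists_val_eq (F := F) hx0
  have hd0 : 0 < d := by rw [hd] at hlt; exact_mod_cast hlt
  have h2 : ((min c d : ℝ) : WithTop ℝ) ≤ val F (x - (x - 1)) :=
    le_val_sub (by rw [hd]; exact_mod_cast min_le_right c d)
      (le_trans (by exact_mod_cast min_le_left c d) hx)
  rw [sub_sub_cancel, val_one] at h2
  exact absurd h2 (not_le.2 (by exact_mod_cast lt_min hc hd0))

theorem le_val_mul_sub_one {x y : K} {c : ℝ} (hc : 0 < c)
    (hx : (c : WithTop ℝ) ≤ val F (x - 1)) (hy : (c : WithTop ℝ) ≤ val F (y - 1)) :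
    (c : WithTop ℝ) ≤ val F (x * y - 1) := by
  have : x * y - 1 = x * (y - 1) + (x - 1) := by ring
  rw [this]
  refine le_val_add ?_ hx
  rw [val_mul, val_eq_zero_of_sub_one hc hx, zero_add]
  exact hy

theorem le_val_inv_sub_one {x : K} {c : ℝ} (hc : 0 < c)
    (hx : (c : WithTop ℝ) ≤ val F (x - 1)) : (c : WithTop ℝ) ≤ val F (x⁻¹ - 1) := by
  have hv := val_eq_zero_of_sub_one hc hx
  have hx0 : x ≠ 0 := fun h => by simp [h] at hv
  have : x⁻¹ - 1 = x⁻¹ * -(x - 1) := by field_simp; ring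
  rw [this, val_mul, val_neg, val_inv_eq_zero hv, zero_add]
  exact hx

/-- The filtration subgroup `1 + 𝔭_c` of the units. -/
def unitFiltration (F : Type*) [Field F] [ValuativeRel F] [TopologicalSpace F]
    [IsNonarchimedeanLocalField F] {K : Type*} [Field K] [Algebra F K] [Algebra.IsAlgebraic F K]
    {c : ℝ} (hc : 0 < c) : Subgroup Kˣ where
  carrier := {x | (c : WithTop ℝ) ≤ val F ((x : K) - 1)}
  one_mem' := by simp
  mul_mem' hx hy := by
    simp only [Set.mem_ofPred_eq, Units.val_mul] at *
    exact le_val_mul_sub_one hc hx hy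
  inv_mem' hx := by
    simp only [Set.mem_ofPred_eq, Units.val_inv_eq_inv_val] at *
    exact le_val_inv_sub_one hc hx

theorem mem_unitFiltration {c : ℝ} (hc : 0 < c) {x : Kˣ} :
    x ∈ unitFiltration F hc ↔ (c : WithTop ℝ) ≤ val F ((x : K) - 1) := Iff.rfl

/-- The valuation of a finite extension is discrete. -/
theorem exists_val_eq_div (E : IntermediateField F K) [FiniteDimensional F E] {x : K}
    (hxE : x ∈ E) (hx : x ≠ 0) :
    ∃ z : ℤ, val F x = ((z / Module.finrank F E : ℝ) : WithTop ℝ) := by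
  have h1 : minpoly F x = minpoly F (⟨x, hxE⟩ : E) :=
    minpoly.algebraMap_eq (algebraMap E K).injective (⟨x, hxE⟩ : E)
  obtain ⟨k, hk⟩ := minpoly.degree_dvd
    (Algebra.IsIntegral.isIntegral (R := F) (⟨x, hxE⟩ : E))
  have hpos : 0 < Module.finrank F E := Module.finrank_pos
  rw [← h1] at hk
  have hk0 : (k : ℝ) ≠ 0 := by
    rintro h
    have : k = 0 := by exact_mod_cast h
    simp [this] at hk
    omega
  have hd0 : ((minpoly F x).natDegree : ℝ) ≠ 0 := by
    intro h
    have : (minpoly F x).natDegree = 0 := by exact_mod_cast h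
    simp [this] at hk
    omega
  refine ⟨valInt ((minpoly F x).coeff 0) * k, ?_⟩
  rw [val, if_neg hx, hk]
  push_cast
  congr 1
  field_simp

/-- A finite extension is complete. -/
theorem exists_limit (E : IntermediateField F K) [FiniteDimensional F E] (x : ℕ → K)
    (hxE : ∀ k, x k ∈ E) (ρ : ℕ → ℝ) (hρ : Monotone ρ)
    (hρt : Filter.Tendsto ρ Filter.atTop Filter.atTop)
    (hx : ∀ k, (ρ k : WithTop ℝ) ≤ val F (x (k + 1) - x k)) :
    ∃ z ∈ E, ∀ k, (ρ k : WithTop ℝ) ≤ val F (z - x k) := by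
  obtain ⟨ν, h0, hz, hm, ha, hv, hlim, -⟩ := exists_mulNorm F E
  have key : ∀ (w : E) (c : ℝ), (c : WithTop ℝ) ≤ val F w ↔ ν w ≤ (2 : ℝ) ^ (-c) := by
    intro w c
    by_cases hw : w = 0
    · rw [hw, val_zero, (hz 0).2 rfl]
      simp only [le_top, true_iff]
      positivity
    · have hpos : 0 < ν w := lt_of_le_of_ne (h0 w) fun h' => hw ((hz w).1 h'.symm)
      rw [hv w hw, WithTop.coe_le_coe, le_neg, Real.logb_le_iff_le_rpow (by norm_num) hpos]
  obtain ⟨z, hz'⟩ := hlim inferInstance (fun k => ⟨x k, hxE k⟩) (fun k => (2 : ℝ) ^ (-ρ k))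
    (fun k m hkm => Real.rpow_le_rpow_of_exponent_le (by norm_num) (neg_le_neg (hρ hkm)))
    (by
      have h2 : ∀ k, (2 : ℝ) ^ (-ρ k) = Real.exp (-(Real.log 2 * ρ k)) := by
        intro k
        rw [Real.rpow_def_of_pos (by norm_num)]
        ring_nf
      simp_rw [h2]
      exact Real.tendsto_exp_neg_atTop_nhds_zero.comp
        (hρt.const_mul_atTop (Real.log_pos (by norm_num))))
    (fun k => by
      rw [← key, ← val_coe]
      exact hx k)
  refine ⟨z, z.2, fun k => ?_⟩
  have := (key _ _).2 (hz' k)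
  rw [← val_coe] at this
  exact this

/-- Two members of a sequence of integers of a finite extension are congruent modulo the maximal
ideal. -/
theorem exists_lt_val_sub_pos [FiniteDimensional F K] (x : ℕ → K) (hx : ∀ k, 0 ≤ val F (x k)) :
    ∃ i j, i < j ∧ 0 < val F (x j - x i) := by
  obtain ⟨ν, h0, hz, hm, ha, hv, -, hp⟩ := exists_mulNorm F K
  have hpos : ∀ z : K, z ≠ 0 → 0 < ν z := fun z h =>
    lt_of_le_of_ne (h0 z) fun h' => h ((hz z).1 h'.symm)
  obtain ⟨i, j, hij, h⟩ := hp inferInstance x fun k => by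
    by_cases hk : x k = 0
    · rw [(hz _).2 hk]; exact zero_le_one
    · have := hx k
      rw [hv _ hk, ← WithTop.coe_zero, WithTop.coe_le_coe, Left.nonneg_neg_iff] at this
      rwa [Real.logb_nonpos_iff (by norm_num) (hpos _ hk)] at this
  refine ⟨i, j, hij, ?_⟩
  by_cases hk : x j - x i = 0
  · simp [hk]
  · rw [hv _ hk, ← WithTop.coe_zero, WithTop.coe_lt_coe, Left.neg_pos_iff]
    exact Real.logb_neg (by norm_num) (hpos _ hk) h

end Val

section Trace

variable {F : Type*} [Field F] [ValuativeRel F] [TopologicalSpace F] [IsNonarchimedeanLocalField F]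

theorem valInt_neg (x : F) : valInt (-x) = valInt x := by
  simp [valInt, Valuation.map_neg]

theorem val_algebraMap {L : Type*} [Field L] [Algebra F L] {f : F} (hf : f ≠ 0) :
    val F (algebraMap F L f) = ((valInt f : ℝ) : WithTop ℝ) := by
  rw [val, if_neg (by simpa using hf), minpoly.eq_X_sub_C]
  simp [valInt_neg]

theorem valInt_pos {x : F} (hx : x ≠ 0) (h : ValuativeRel.valuation F x < 1) : 0 < valInt x := by
  rw [valInt, Left.neg_pos_iff]
  rw [← (IsNonarchimedeanLocalField.valueGroupWithZeroIsoInt F).strictMono.lt_iff_lt, map_one] at h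
  have h0 : IsNonarchimedeanLocalField.valueGroupWithZeroIsoInt F (ValuativeRel.valuation F x) ≠ 0 := by
    simpa using hx
  rwa [← WithZero.log_lt_log h0 one_ne_zero, WithZero.log_one] at h

variable (F) in
/-- The residual characteristic. -/
abbrev residueChar : ℕ := ringChar (IsLocalRing.ResidueField (ValuativeRel.valuation F).integer)

theorem residueChar_prime : (residueChar F).Prime := by
  have : Finite (IsLocalRing.ResidueField (ValuativeRel.valuation F).integer) := inferInstance
  exact CharP.char_is_prime (IsLocalRing.ResidueField (ValuativeRel.valuation F).integer) _

theorem val_residueChar_pos {L : Type*} [Field L] [Algebra F L] :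
    0 < val F ((residueChar F : ℕ) : L) := by
  by_cases h0 : ((residueChar F : ℕ) : F) = 0
  · have : ((residueChar F : ℕ) : L) = 0 := by
      rw [← map_natCast (algebraMap F L), h0, map_zero]
    simp [this]
  · rw [← map_natCast (algebraMap F L), val_algebraMap h0]
    have h1 : ((residueChar F : ℕ) : IsLocalRing.ResidueField (ValuativeRel.valuation F).integer)
      = 0 := ringChar.Nat.cast_ringChar
    rw [← map_natCast (IsLocalRing.residue (ValuativeRel.valuation F).integer),
      IsLocalRing.residue_eq_zero_iff] at h1
    have h2 : ValuativeRel.valuation F ((residueChar F : ℕ) : F) < 1 := by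
      refine lt_of_le_of_ne (Subtype.prop
        ((residueChar F : ℕ) : (ValuativeRel.valuation F).integer)) fun h => ?_
      exact (IsLocalRing.mem_maximalIdeal _).1 h1
        ((Valuation.integer.integers _).isUnit_iff_valuation_eq_one.2 h)
    exact_mod_cast valInt_pos h0 h2


variable {L : Type*} [Field L] [Algebra F L]

section

variable [Algebra.IsAlgebraic F L]

variable (F L) in
/-- The ring of integers of an algebraic extension. -/
def integers : ValuationSubring L where
  carrier := {x | 0 ≤ val F x}
  mul_mem' {x y} hx hy := by
    simp only [Set.mem_ofPred_eq, val_mul] at *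
    exact add_nonneg hx hy
  one_mem' := by simp
  add_mem' hx hy := le_val_add hx hy
  zero_mem' := by simp
  neg_mem' {x} hx := by simpa using hx
  mem_or_inv_mem' x := by
    by_cases hx : x = 0
    · simp [hx]
    obtain ⟨c, hc⟩ := exists_val_eq (F := F) hx
    simp only [Set.mem_ofPred_eq, hc, val_inv_eq hc]
    rcases le_total 0 c with h | h
    · left; exact_mod_cast h
    · right; exact_mod_cast neg_nonneg.2 h

theorem mem_integers {x : L} : x ∈ integers F L ↔ 0 ≤ val F x := Iff.rfl

theorem residue_eq_zero_iff (x : integers F L) :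
    IsLocalRing.residue (integers F L) x = 0 ↔ 0 < val F (x : L) := by
  rw [IsLocalRing.residue_eq_zero_iff, IsLocalRing.mem_maximalIdeal, mem_nonunits_iff]
  have hx : 0 ≤ val F (x : L) := x.2
  constructor
  · intro h
    refine lt_of_le_of_ne hx fun h0 => h ?_
    refine (isUnit_iff_exists_inv).2 ⟨⟨(x : L)⁻¹, ?_⟩, ?_⟩
    · rw [mem_integers, val_inv_eq_zero h0.symm]
    · ext
      simp only [MulMemClass.coe_mul, OneMemClass.coe_one]
      refine mul_inv_cancel₀ fun hx0 => ?_
      rw [hx0] at h0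
      simp at h0
  · rintro h hu
    obtain ⟨z, hz⟩ := isUnit_iff_exists_inv.1 hu
    have h1 : val F ((x : L) * z) = 0 := by
      rw [← MulMemClass.coe_mul, hz, OneMemClass.coe_one, val_one]
    rw [val_mul] at h1
    have h2 : 0 ≤ val F (z : L) := z.2
    exact absurd h1 (add_pos_of_pos_of_nonneg h h2).ne'

instance charP_residueField :
    CharP (IsLocalRing.ResidueField (integers F L)) (residueChar F) := by
  have h : ((residueChar F : ℕ) : IsLocalRing.ResidueField (integers F L)) = 0 := by
    rw [← map_natCast (IsLocalRing.residue (integers F L)), residue_eq_zero_iff]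
    simpa using val_residueChar_pos
  rcases (Nat.dvd_prime residueChar_prime).1 (ringChar.dvd h) with h1 | h1
  · exact absurd h1 CharP.ringChar_ne_one
  · rw [← h1]
    exact ringChar.charP _

theorem val_natCast_eq_zero {m : ℕ} (hm : m.Coprime (residueChar F)) : val F (m : L) = 0 := by
  refine le_antisymm ?_ (val_natCast_nonneg m)
  by_contra h
  rw [not_le] at h
  have h1 : ((m : ℕ) : IsLocalRing.ResidueField (integers F L)) = 0 := by
    rw [← map_natCast (IsLocalRing.residue (integers F L)), residue_eq_zero_iff]
    simpa using h
  rw [CharP.cast_eq_zero_iff _ (residueChar F)] at h1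
  exact residueChar_prime.one_lt.ne' (Nat.eq_one_of_dvd_coprimes hm h1 dvd_rfl)

/-- If `x ^ p ^ a` is congruent to `1`, so is `x`. -/
theorem val_sub_one_pos_of_pow {x : L} (hx : 0 ≤ val F x) (a : ℕ)
    (h : 0 < val F (x ^ residueChar F ^ a - 1)) : 0 < val F (x - 1) := by
  have : Fact (residueChar F).Prime := ⟨residueChar_prime⟩
  have h1 : IsLocalRing.residue (integers F L) ((⟨x, hx⟩ - 1) ^ residueChar F ^ a) = 0 := by
    rw [map_pow, map_sub, sub_pow_char_pow, ← map_pow, map_one, one_pow,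
      ← map_one (IsLocalRing.residue (integers F L)), ← map_sub, residue_eq_zero_iff]
    simpa using h
  rw [map_pow] at h1
  have h2 := (pow_eq_zero_iff (pow_pos residueChar_prime.pos a).ne').1 h1
  rw [residue_eq_zero_iff] at h2
  simpa using h2

/-- Units of a finite extension have finite order prime to `p` modulo the principal units. -/
theorem exists_pow_sub_one_pos [FiniteDimensional F L] {x : L} (hx : val F x = 0) :
    ∃ m : ℕ, m.Coprime (residueChar F) ∧ 0 < val F (x ^ m - 1) := by
  obtain ⟨i, j, hij, h⟩ := exists_lt_val_sub_pos (F := F) (fun k => x ^ k)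
    fun k => by simp [val_pow, hx]
  have h1 : 0 < val F (x ^ (j - i) - 1) := by
    have : x ^ j - x ^ i = x ^ i * (x ^ (j - i) - 1) := by
      rw [mul_sub, ← pow_add, Nat.add_sub_cancel' hij.le, mul_one]
    simpa [this, val_mul, val_pow, hx] using h
  obtain ⟨a, m, hm, hjm⟩ := Nat.exists_eq_pow_mul_and_not_dvd (n := j - i) (by omega)
    (residueChar F) residueChar_prime.ne_one
  refine ⟨m, ((Nat.Prime.coprime_iff_not_dvd residueChar_prime).2 hm).symm, ?_⟩
  refine val_sub_one_pos_of_pow (by simp [val_pow, hx]) a ?_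
  rwa [← pow_mul, mul_comm, ← hjm]

/-- `(1 + d) ^ k = 1 + k d` up to second order. -/
theorem le_val_one_add_pow {d : L} {δ : ℝ} (hδ : 0 ≤ δ) (hd : (δ : WithTop ℝ) ≤ val F d) (k : ℕ) :
    ((2 * δ : ℝ) : WithTop ℝ) ≤ val F ((1 + d) ^ k - 1 - k * d) := by
  have h0 : (0 : WithTop ℝ) ≤ val F d := le_trans (by exact_mod_cast hδ) hd
  induction k with
  | zero => simp
  | succ k ih =>
    have : (1 + d) ^ (k + 1) - 1 - ((k + 1 : ℕ) : L) * d =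
        ((1 + d) ^ k - 1 - k * d) * (1 + d) + k * (d * d) := by push_cast; ring
    rw [this]
    refine le_val_add ?_ ?_
    · rw [val_mul]
      exact le_add_of_le_of_nonneg ih (le_val_add (by simp) h0)
    · rw [val_mul]
      refine le_add_of_nonneg_of_le (val_natCast_nonneg k) ?_
      rw [two_mul]
      exact le_val_mul hd hd

/-- If the ramification index of `L / F` is prime to `p`, there is no automorphism of order `p`
acting trivially on the residue field. -/
theorem not_orderOf_eq_residueChar [FiniteDimensional F L] {e : ℕ}
    (he : e.Coprime (residueChar F))
    (hram : ∀ x : L, x ≠ 0 → ∃ f : F, f ≠ 0 ∧ val F (x ^ e) = val F (algebraMap F L f))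
    (σ : L ≃ₐ[F] L) (hσ : ∀ x : L, 0 ≤ val F x → 0 < val F (σ x - x))
    (hord : orderOf σ = residueChar F) : False := by
  have hσ0 : ∀ x : L, x ≠ 0 → σ x ≠ 0 := fun x hx => by simpa using hx
  -- `σ x / x` is a principal unit
  have hpos : ∀ x : L, x ≠ 0 → 0 < val F (σ x / x - 1) := by
    intro x hx
    have hv : val F (σ x / x) = 0 := by
      rw [div_eq_mul_inv, val_mul, val_map, val_add_val_inv hx]
    have hp : ∀ i : ℕ, 0 < val F ((σ x / x) ^ i - (σ ^ i) x / x) := by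
      intro i
      induction i with
      | zero => simp [hx]
      | succ i ih =>
        have h1 : (σ x / x) ^ (i + 1) - (σ ^ (i + 1)) x / x =
            (σ x / x) * ((σ x / x) ^ i - σ ((σ ^ i) x / x)) := by
          rw [pow_succ', pow_succ', map_div₀, AlgEquiv.mul_apply]
          field_simp [hσ0 x hx]
        have h2 : (σ x / x) ^ i - σ ((σ ^ i) x / x) =
            ((σ x / x) ^ i - (σ ^ i) x / x) - (σ ((σ ^ i) x / x) - (σ ^ i) x / x) := by ring
        have hi : ∀ j : ℕ, val F ((σ ^ j) x) = val F x := fun j => val_map _ _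
        have h3 := hσ ((σ ^ i) x / x) (by
          rw [div_eq_mul_inv, val_mul, hi, val_add_val_inv hx])
        rw [h1, val_mul, hv, zero_add, h2]
        have h4 := le_val_sub (F := F) (min_le_left _ _) (min_le_right (val F
          ((σ x / x) ^ i - (σ ^ i) x / x)) (val F (σ ((σ ^ i) x / x) - (σ ^ i) x / x)))
        exact (lt_min ih h3).trans_le h4
    have h5 := hp (residueChar F)
    rw [← hord, pow_orderOf_eq_one, AlgEquiv.one_apply, div_self hx, hord] at h5
    exact val_sub_one_pos_of_pow hv.ge 1 (by simpa using h5)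
  -- choose `x₀` for which this principal unit has minimal depth
  have hN : 0 < Module.finrank F L := Module.finrank_pos
  have hdisc : ∀ x : L, x ≠ 0 →
      ∃ z : ℤ, val F x = ((z / Module.finrank F L : ℝ) : WithTop ℝ) := by
    intro x hx
    have := exists_val_eq_div (F := F) (⊤ : IntermediateField F L) (x := x) trivial hx
    simpa using this
  have hex : ∃ k : ℕ, ∃ x : L, x ≠ 0 ∧
      val F (σ x / x - 1) = ((k / Module.finrank F L : ℝ) : WithTop ℝ) := by
    have hne : σ ≠ 1 := fun h => by
      rw [h, orderOf_one] at hord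
      exact residueChar_prime.ne_one hord.symm
    obtain ⟨x, hx⟩ : ∃ x, σ x ≠ x := by
      by_contra hcon
      push Not at hcon
      exact hne (AlgEquiv.ext hcon)
    have hx0 : x ≠ 0 := fun h => by simp [h] at hx
    obtain ⟨z, hz⟩ := hdisc (σ x / x - 1) (by
      rw [sub_ne_zero]
      intro h
      rw [div_eq_one_iff_eq hx0] at h
      exact hx h)
    have hz0 : 0 ≤ z := by
      have := hpos x hx0
      rw [hz] at this
      have h1 : (0 : ℝ) < z / Module.finrank F L := by exact_mod_cast this
      have h2 : (0 : ℝ) < z := (div_pos_iff_of_pos_right (by exact_mod_cast hN)).1 h1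
      exact_mod_cast h2.le
    lift z to ℕ using hz0
    exact ⟨z, x, hx0, by simpa using hz⟩
  classical
  obtain ⟨x₀, hx₀, hvx₀⟩ := Nat.find_spec hex
  set δ : ℝ := (Nat.find hex / Module.finrank F L : ℝ) with hδ
  have hδpos : 0 < δ := by
    have := hpos x₀ hx₀
    rw [hvx₀] at this
    exact_mod_cast this
  have hmin : ∀ x : L, x ≠ 0 → (δ : WithTop ℝ) ≤ val F (σ x / x - 1) := by
    intro x hx
    by_cases h0 : σ x / x - 1 = 0
    · simp [h0]
    obtain ⟨z, hz⟩ := hdisc _ h0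
    have hz0 : 0 ≤ z := by
      have := hpos x hx
      rw [hz] at this
      have h1 : (0 : ℝ) < z / Module.finrank F L := by exact_mod_cast this
      have h2 : (0 : ℝ) < z := (div_pos_iff_of_pos_right (by exact_mod_cast hN)).1 h1
      exact_mod_cast h2.le
    lift z to ℕ using hz0
    rw [hz, WithTop.coe_le_coe, hδ]
    have h1 : Nat.find hex ≤ z := Nat.find_min' hex ⟨x, hx, by simpa using hz⟩
    gcongr
    exact_mod_cast h1
  have hpow : ∀ (x : L) (k : ℕ), x ≠ 0 → k.Coprime (residueChar F) →
      val F (σ x / x - 1) = δ → val F (σ (x ^ k) / x ^ k - 1) = δ := by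
    intro x k hx hk h
    have h1 := le_val_one_add_pow hδpos.le h.ge k
    rw [add_sub_cancel] at h1
    refine le_antisymm ?_ (hmin _ (pow_ne_zero k hx))
    by_contra hlt
    rw [not_le] at hlt
    have h2 : (δ : WithTop ℝ) < ((2 * δ : ℝ) : WithTop ℝ) := by
      rw [WithTop.coe_lt_coe]; linarith
    have h3 : (δ : WithTop ℝ) < val F ((k : L) * (σ x / x - 1)) := by
      have : (k : L) * (σ x / x - 1) = (σ (x ^ k) / x ^ k - 1) -
          ((σ x / x) ^ k - 1 - k * (σ x / x - 1)) := by
        rw [map_pow, div_pow]; ring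
      rw [this]
      exact (lt_min hlt (h2.trans_le h1)).trans_le (le_val_sub (min_le_left _ _) (min_le_right _ _))
    rw [val_mul, val_natCast_eq_zero hk, zero_add, h] at h3
    exact lt_irrefl _ h3
  obtain ⟨f, hf, hfe⟩ := hram x₀ hx₀
  have hf' : algebraMap F L f ≠ 0 := by simpa using hf
  set w : L := x₀ ^ e / algebraMap F L f with hw
  have hw0 : val F w = 0 := by
    rw [hw, div_eq_mul_inv, val_mul, hfe, val_add_val_inv hf']
  have hw1 : w ≠ 0 := fun h => by simp [h] at hw0
  have hwδ : val F (σ w / w - 1) = δ := by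
    rw [← hpow x₀ e hx₀ he hvx₀]
    congr 2
    rw [hw, map_div₀, AlgEquiv.commutes]
    field_simp
  obtain ⟨m, hm, hwm⟩ := exists_pow_sub_one_pos hw0
  have h6 := hpow w m hw1 hm hwδ
  have hwm0 : val F (w ^ m) = 0 := by simp [val_pow, hw0]
  have h7 : σ (w ^ m) / w ^ m - 1 = (σ (w ^ m - 1) - (w ^ m - 1)) * (w ^ m)⁻¹ := by
    rw [map_sub, map_one]
    field_simp
    ring
  rw [h7, val_mul, val_inv_eq_zero hwm0, add_zero] at h6
  by_cases hz : w ^ m - 1 = 0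
  · simp [hz] at h6
  have h8 : σ (w ^ m - 1) - (w ^ m - 1) =
      (w ^ m - 1) * (σ (w ^ m - 1) / (w ^ m - 1) - 1) := by
    field_simp
  obtain ⟨c, hc⟩ := exists_val_eq (F := F) hz
  rw [h8, val_mul, hc] at h6
  have h9 := add_le_add (le_refl (c : WithTop ℝ)) (hmin _ hz)
  rw [h6, ← WithTop.coe_add, WithTop.coe_le_coe] at h9
  rw [hc] at hwm
  have : 0 < c := by exact_mod_cast hwm
  linarith

theorem exists_sum_eq_one [FiniteDimensional F L] {e : ℕ} (he : e.Coprime (residueChar F))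
    (hram : ∀ x : L, x ≠ 0 → ∃ f : F, f ≠ 0 ∧ val F (x ^ e) = val F (algebraMap F L f)) :
    ∃ θ : L, 0 ≤ val F θ ∧ ∑ τ : L ≃ₐ[F] L, τ θ = 1 := by
  classical
  let ρ := IsLocalRing.residue (integers F L)
  have hmem : ∀ (τ : L ≃ₐ[F] L) (x : integers F L), τ x ∈ integers F L := fun τ x => by
    rw [mem_integers, val_map]; exact x.2
  let φ : (L ≃ₐ[F] L) → (integers F L →* IsLocalRing.ResidueField (integers F L)) := fun τ =>
    { toFun := fun x => ρ ⟨τ x, hmem τ x⟩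
      map_one' := by
        rw [← map_one ρ]
        congr 1
        ext
        simp
      map_mul' := fun x y => by
        rw [← map_mul]
        congr 1
        ext
        simp }
  have hφ : ∀ τ τ' : L ≃ₐ[F] L, φ τ = φ τ' ↔ ∀ x : L, 0 ≤ val F x → 0 < val F (τ x - τ' x) := by
    intro τ τ'
    constructor
    · intro h x hx
      have := DFunLike.congr_fun h ⟨x, hx⟩
      change ρ _ = ρ _ at this
      rw [← sub_eq_zero, ← map_sub, residue_eq_zero_iff] at this
      exact this
    · intro h
      ext x
      change ρ _ = ρ _
      rw [← sub_eq_zero, ← map_sub, residue_eq_zero_iff]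
      exact h x x.2
  obtain ⟨x, hx⟩ : ∃ x : integers F L, ∑ τ, φ τ x ≠ 0 := by
    by_contra hcon
    push Not at hcon
    have h1 : ∑ τ, (φ τ : integers F L → _) = 0 := by
      ext x
      simpa using hcon x
    rw [Finset.sum_comp (s := Finset.univ) (g := φ)
      (fun f : integers F L →* IsLocalRing.ResidueField (integers F L) =>
        (f : integers F L → IsLocalRing.ResidueField (integers F L)))] at h1
    have h2 := linearIndependent_iff'.1 (linearIndependent_monoidHom (integers F L)
      (IsLocalRing.ResidueField (integers F L))) (Finset.univ.image φ)
      (fun f => ((Finset.univ.filter fun τ => φ τ = f).card : _)) (by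
        rw [← h1]
        refine Finset.sum_congr rfl fun f _ => ?_
        rw [Nat.cast_smul_eq_nsmul]) (φ 1) (Finset.mem_image_of_mem _ (Finset.mem_univ _))
    rw [CharP.cast_eq_zero_iff _ (residueChar F)] at h2
    let I : Subgroup (L ≃ₐ[F] L) :=
      { carrier := {τ | φ τ = φ 1}
        one_mem' := rfl
        mul_mem' := by
          intro τ τ' h h'
          simp only [Set.mem_ofPred_eq, hφ] at h h' ⊢
          intro x hx
          have e1 : (τ * τ') x - (1 : L ≃ₐ[F] L) x =
            (τ (τ' x) - (1 : L ≃ₐ[F] L) (τ' x)) + (τ' x - (1 : L ≃ₐ[F] L) x) := by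
            simp
          rw [e1]
          exact (lt_min (h (τ' x) (by rwa [val_map])) (h' x hx)).trans_le
            (le_val_add (min_le_left _ _) (min_le_right _ _))
        inv_mem' := by
          intro τ h
          simp only [Set.mem_ofPred_eq, hφ] at h ⊢
          intro x hx
          have := h (τ⁻¹ x) (by rwa [val_map])
          rw [val_sub_comm]
          simpa using this }
    have h3 : residueChar F ∣ Nat.card I := by
      convert! h2
      rw [Nat.card_eq_fintype_card, Fintype.card_subtype]
      rfl
    have : Fact (residueChar F).Prime := ⟨residueChar_prime⟩
    obtain ⟨⟨σ, hσ⟩, hord⟩ := exists_prime_orderOf_dvd_card' (residueChar F) h3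
    exact not_orderOf_eq_residueChar he hram σ (fun x hx => (hφ σ 1).1 hσ x hx)
      (by simpa using hord)
  have hs : ρ (∑ τ, ⟨τ x, hmem τ x⟩) ≠ 0 := by
    rw [map_sum]
    exact hx
  set s : L := ∑ τ : L ≃ₐ[F] L, τ x with hsdef
  have hs' : ((∑ τ, ⟨τ x, hmem τ x⟩ : integers F L) : L) = s := by
    simp [hsdef]
  rw [Ne, residue_eq_zero_iff, hs', not_lt] at hs
  have hs0 : val F s = 0 := le_antisymm hs (le_val_sum _ _ fun τ _ => hmem τ x)
  have hsne : s ≠ 0 := fun h => by simp [h] at hs0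
  have hfix : ∀ τ : L ≃ₐ[F] L, τ s = s := by
    intro τ
    rw [hsdef, map_sum]
    exact Fintype.sum_equiv (Equiv.mulLeft τ) _ _ fun τ' => rfl
  refine ⟨x / s, ?_, ?_⟩
  · rw [div_eq_mul_inv, val_mul, val_inv_eq_zero hs0, add_zero]
    exact x.2
  · simp_rw [map_div₀, hfix]
    rw [← Finset.sum_div, ← hsdef, div_self hsne]

end

/-- A tamely ramified Galois extension has an integer of trace `1`. -/
theorem IsTamelyRamified.exists_sum_eq_one {K : Type*} [Field K] [Algebra F K]
    [Algebra.IsAlgebraic F K] {E : IntermediateField F K} [FiniteDimensional F E]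
    (hE : IsTamelyRamified E) :
    ∃ θ : E, 0 ≤ val F (θ : K) ∧ ∑ τ : E ≃ₐ[F] E, τ θ = 1 := by
  have hram : ∀ x : E, x ≠ 0 → ∃ f : F, f ≠ 0 ∧ val F (x ^ ((valueGroup
      (⊥ : IntermediateField F K)).relIndex (valueGroup E))) = val F (algebraMap F E f) := by
    intro x hx
    obtain ⟨c, hc⟩ := exists_val_eq (F := F) hx
    have h1 : c ∈ valueGroup E := AddSubgroup.subset_closure ⟨x, x.2, by rw [val_coe, hc]⟩
    have h2 : ((valueGroup (⊥ : IntermediateField F K)).relIndex (valueGroup E)) • c ∈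
        valueGroup (⊥ : IntermediateField F K) := by
      have := AddSubgroup.nsmul_index_mem
        ((valueGroup (⊥ : IntermediateField F K)).addSubgroupOf (valueGroup E)) ⟨c, h1⟩
      exact this
    have h3 : ∀ c ∈ valueGroup (⊥ : IntermediateField F K), ∃ f : F, f ≠ 0 ∧
        val F (algebraMap F E f) = c := by
      intro c hc
      refine AddSubgroup.closure_induction (fun c hc => ?_) ?_ ?_ ?_ hc
      · obtain ⟨z, hz, hzc⟩ := hc
        obtain ⟨f, rfl⟩ := IntermediateField.mem_bot.1 hz
        have hf : f ≠ 0 := by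
          rintro rfl
          simp at hzc
        exact ⟨f, hf, by rw [val_algebraMap hf, ← val_algebraMap (L := K) hf, hzc]⟩
      · exact ⟨1, one_ne_zero, by simp⟩
      · rintro c d - - ⟨f, hf, hfc⟩ ⟨g, hg, hgd⟩
        exact ⟨f * g, mul_ne_zero hf hg, by rw [map_mul, val_mul, hfc, hgd, WithTop.coe_add]⟩
      · rintro c - ⟨f, hf, hfc⟩
        exact ⟨f⁻¹, inv_ne_zero hf, by rw [map_inv₀, val_inv_eq hfc]⟩
    obtain ⟨f, hf, hfc⟩ := h3 _ h2
    refine ⟨f, hf, ?_⟩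
    rw [hfc, val_pow, hc, WithTop.coe_nsmul]
  obtain ⟨θ, hθ, hs⟩ := YuGroups.exists_sum_eq_one hE hram
  exact ⟨θ, by rwa [val_coe], hs⟩

end Trace

section Diagonal

variable {K : Type*} [Field K] {n : ℕ}

/-- The diagonal matrices with respect to the basis given by `g`. -/
def diagHom (g : GL (Fin n) K) : (Fin n → Kˣ) →* GL (Fin n) K :=
  (MulAut.conj g⁻¹).toMonoidHom.comp
    ((Units.map (Matrix.diagonalRingHom (Fin n) K).toMonoidHom).comp
      (MulEquiv.piUnits (M := fun _ : Fin n => K)).symm.toMonoidHom)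

theorem coe_diagHom (g : GL (Fin n) K) (x : Fin n → Kˣ) :
    (diagHom g x : Matrix (Fin n) (Fin n) K) =
      ((g⁻¹ : GL (Fin n) K) : Matrix (Fin n) (Fin n) K) *
        Matrix.diagonal (fun i => (x i : K)) * (g : Matrix (Fin n) (Fin n) K) := by
  simp only [diagHom, MonoidHom.comp_apply, MulEquiv.toMonoidHom_eq_coe, MonoidHom.coe_coe,
    MulAut.conj_apply, inv_inv, Units.val_mul]
  rfl

theorem coe_conj_diagHom (g : GL (Fin n) K) (x : Fin n → Kˣ) :
    ((g * diagHom g x * g⁻¹ : GL (Fin n) K) : Matrix (Fin n) (Fin n) K) =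
      Matrix.diagonal (fun i => (x i : K)) := by
  simp only [Units.val_mul, coe_diagHom]
  rw [mul_assoc, mul_assoc, ← Units.val_mul g, mul_inv_cancel, Units.val_one, mul_one,
    ← mul_assoc, ← Units.val_mul, mul_inv_cancel, Units.val_one, one_mul]

theorem diagHom_injective (g : GL (Fin n) K) : Function.Injective (diagHom g) := by
  intro x y h
  have := coe_conj_diagHom g x
  rw [h, coe_conj_diagHom, Matrix.diagonal_eq_diagonal_iff] at this
  ext i
  exact (this i).symm

theorem exists_diagHom_eq {g t : GL (Fin n) K}
    (h : ((g * t * g⁻¹ : GL (Fin n) K) : Matrix (Fin n) (Fin n) K).IsDiag) :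
    ∃ x, diagHom g x = t := by
  have hdet : IsUnit ((g * t * g⁻¹ : GL (Fin n) K) : Matrix (Fin n) (Fin n) K).det :=
    (Matrix.isUnit_iff_isUnit_det _).1 (Units.isUnit _)
  rw [← h.diagonal_diag, Matrix.det_diagonal] at hdet
  have hx : ∀ i, ((g * t * g⁻¹ : GL (Fin n) K) : Matrix (Fin n) (Fin n) K).diag i ≠ 0 := by
    intro i hi
    exact hdet.ne_zero (Finset.prod_eq_zero (Finset.mem_univ i) hi)
  refine ⟨fun i => Units.mk0 _ (hx i), ?_⟩
  have : g * diagHom g (fun i => Units.mk0 _ (hx i)) * g⁻¹ = g * t * g⁻¹ := by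
    apply Units.ext
    rw [coe_conj_diagHom]
    exact h.diagonal_diag
  simpa using this

theorem det_diagHom (g : GL (Fin n) K) (x : Fin n → Kˣ) :
    (diagHom g x : Matrix (Fin n) (Fin n) K).det = ∏ i, (x i : K) := by
  have := congrArg Matrix.det (coe_conj_diagHom g x)
  rw [Matrix.det_diagonal] at this
  rw [← this]
  simp only [Units.val_mul, Matrix.det_mul]
  rw [mul_comm, ← mul_assoc, ← Matrix.det_mul, ← Units.val_mul, inv_mul_cancel, Units.val_one,
    Matrix.det_one, one_mul]

/-- The character `x ↦ ∏ xᵢ ^ kᵢ`. -/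
def mono (k : Fin n → ℤ) : (Fin n → Kˣ) →* Kˣ where
  toFun x := ∏ i, x i ^ k i
  map_one' := by simp
  map_mul' x y := by simp [mul_zpow, Finset.prod_mul_distrib]

theorem mono_apply (k : Fin n → ℤ) (x : Fin n → Kˣ) : mono k x = ∏ i, x i ^ k i := rfl

theorem mono_add (k l : Fin n → ℤ) (x : Fin n → Kˣ) :
    mono (k + l) x = mono k x * mono l x := by
  simp [mono_apply, zpow_add, Finset.prod_mul_distrib]

@[simp] theorem mono_zero (x : Fin n → Kˣ) : mono 0 x = 1 := by simp [mono_apply]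

theorem mono_neg (k : Fin n → ℤ) (x : Fin n → Kˣ) : mono (-k) x = (mono k x)⁻¹ := by
  simp [mono_apply]

theorem mono_sub (k l : Fin n → ℤ) (x : Fin n → Kˣ) :
    mono (k - l) x = mono k x / mono l x := by
  rw [sub_eq_add_neg, mono_add, mono_neg, div_eq_mul_inv]

theorem mono_smul (m : ℤ) (k : Fin n → ℤ) (x : Fin n → Kˣ) :
    mono (m • k) x = mono k x ^ m := by
  simp [mono_apply, mul_comm m, zpow_mul, Finset.prod_zpow]

@[simp] theorem mono_single (i : Fin n) (x : Fin n → Kˣ) : mono (Pi.single i 1) x = x i := by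
  rw [mono_apply, Finset.prod_eq_single i]
  · simp
  · intro j _ hj
    simp [hj]
  · simp

/-- The exponents of the monomials which are trivial on `Γ`. -/
def relations (Γ : Subgroup (Fin n → Kˣ)) : Submodule ℤ (Fin n → ℤ) where
  carrier := {k | ∀ x ∈ Γ, mono k x = 1}
  add_mem' hk hl x hx := by rw [mono_add, hk x hx, hl x hx, one_mul]
  zero_mem' x _ := mono_zero x
  smul_mem' m k hk x hx := by rw [mono_smul, hk x hx, one_zpow]

theorem mem_relations {Γ : Subgroup (Fin n → Kˣ)} {k : Fin n → ℤ} :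
    k ∈ relations Γ ↔ ∀ x ∈ Γ, mono k x = 1 := Iff.rfl

/-- Restriction to `Γ` of the monomial with exponent `α`. -/
def natMono (Γ : Subgroup (Fin n → Kˣ)) (α : Fin n →₀ ℕ) : Γ →* K :=
  (Units.coeHom K).comp ((mono fun i => (α i : ℤ)).comp Γ.subtype)

theorem coe_mono_natCast (α : Fin n →₀ ℕ) (x : Fin n → Kˣ) :
    ((mono (fun i => (α i : ℤ)) x : Kˣ) : K) = ∏ i, (x i : K) ^ α i := by
  simp [mono_apply]

theorem natMono_apply (Γ : Subgroup (Fin n → Kˣ)) (α : Fin n →₀ ℕ) (x : Γ) :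
    natMono Γ α x = ((mono (fun i => (α i : ℤ)) (x : Fin n → Kˣ) : Kˣ) : K) := rfl

theorem eval_eq_sum_mono (Q : MvPolynomial (Fin n) K) (x : Fin n → Kˣ) :
    MvPolynomial.eval (fun i => (x i : K)) Q =
      ∑ α ∈ Q.support, Q.coeff α * ((mono (fun i => (α i : ℤ)) x : Kˣ) : K) := by
  simp_rw [coe_mono_natCast]
  rw [MvPolynomial.eval_eq']

/-- A polynomial vanishing on `Γ` vanishes wherever all monomial relations of `Γ` hold. -/
theorem eval_eq_zero_of_relations {Γ : Subgroup (Fin n → Kˣ)} {Q : MvPolynomial (Fin n) K}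
    (hQ : ∀ x ∈ Γ, MvPolynomial.eval (fun i => ((x : Fin n → Kˣ) i : K)) Q = 0)
    {y : Fin n → Kˣ} (hy : ∀ k ∈ relations Γ, mono k y = 1) :
    MvPolynomial.eval (fun i => (y i : K)) Q = 0 := by
  classical
  have key : ∀ f : Γ →* K, f ∈ Q.support.image (natMono Γ) →
      ∑ α ∈ Q.support with natMono Γ α = f, Q.coeff α = 0 := by
    intro f hf
    refine linearIndependent_iff'.1 (linearIndependent_monoidHom Γ K) (Q.support.image (natMono Γ))
      (fun f => ∑ α ∈ Q.support with natMono Γ α = f, Q.coeff α) ?_ f hf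
    ext x
    have h1 := hQ x x.2
    rw [eval_eq_sum_mono, ← Finset.sum_fiberwise_of_maps_to (t := Q.support.image (natMono Γ))
      (g := natMono Γ) (fun α hα => Finset.mem_image_of_mem _ hα)] at h1
    rw [Pi.zero_apply, ← h1]
    rw [Finset.sum_apply]
    refine Finset.sum_congr rfl fun f _ => ?_
    rw [Pi.smul_apply, smul_eq_mul, Finset.sum_mul]
    refine Finset.sum_congr rfl fun α hα => ?_
    rw [← (Finset.mem_filter.1 hα).2, natMono_apply]
  rw [eval_eq_sum_mono, ← Finset.sum_fiberwise_of_maps_to (t := Q.support.image (natMono Γ))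
      (g := natMono Γ) (fun α hα => Finset.mem_image_of_mem _ hα)]
  refine Finset.sum_eq_zero fun f hf => ?_
  obtain ⟨β, -, rfl⟩ := Finset.mem_image.1 hf
  rw [← zero_mul ((mono (fun i => (β i : ℤ)) y : Kˣ) : K), ← key _ hf, Finset.sum_mul]
  refine Finset.sum_congr rfl fun α hα => ?_
  congr 2
  have h2 : (fun i => (α i : ℤ)) - (fun i => (β i : ℤ)) ∈ relations Γ := by
    intro x hx
    have := DFunLike.congr_fun (Finset.mem_filter.1 hα).2 ⟨x, hx⟩
    rw [natMono_apply, natMono_apply] at this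
    rw [mono_sub, div_eq_one]
    exact Units.ext this
  have h3 := hy _ h2
  rwa [mono_sub, div_eq_one] at h3

/-- A character of `Γ` which is a Laurent polynomial is a monomial. -/
theorem exists_mono_eq {Γ : Subgroup (Fin n → Kˣ)} (χ : Γ →* Kˣ) (l : Fin n → ℤ)
    (Q : MvPolynomial (Fin n) K)
    (hQ : ∀ x : Γ, ((χ x * mono l (x : Fin n → Kˣ) : Kˣ) : K) =
      MvPolynomial.eval (fun i => ((x : Fin n → Kˣ) i : K)) Q) :
    ∃ k : Fin n → ℤ, ∀ x : Γ, χ x = mono k (x : Fin n → Kˣ) := by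
  classical
  let f₀ : Γ →* K := (Units.coeHom K).comp (χ * (mono l).comp Γ.subtype)
  by_cases h : ∃ α, natMono Γ α = f₀
  · obtain ⟨α, hα⟩ := h
    refine ⟨(fun i => (α i : ℤ)) - l, fun x => ?_⟩
    have := DFunLike.congr_fun hα x
    rw [natMono_apply] at this
    have h1 : mono (fun i => (α i : ℤ)) (x : Fin n → Kˣ) = χ x * mono l (x : Fin n → Kˣ) :=
      Units.ext this
    rw [mono_sub, h1, mul_div_cancel_right]
  · exfalso
    push Not at h
    have hnot : f₀ ∉ Q.support.image (natMono Γ) := by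
      simp only [Finset.mem_image, not_exists, not_and]
      exact fun α _ => h α
    have := linearIndependent_iff'.1 (linearIndependent_monoidHom Γ K)
      (insert f₀ (Q.support.image (natMono Γ)))
      (fun f => if f = f₀ then -1 else ∑ α ∈ Q.support with natMono Γ α = f, Q.coeff α) ?_ f₀
      (Finset.mem_insert_self _ _)
    · simp at this
    · rw [Finset.sum_insert hnot]
      ext x
      have h1 := hQ x
      rw [eval_eq_sum_mono, ← Finset.sum_fiberwise_of_maps_to (t := Q.support.image (natMono Γ))
        (g := natMono Γ) (fun α hα => Finset.mem_image_of_mem _ hα)] at h1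
      rw [if_pos rfl, Pi.add_apply, Finset.sum_apply, Pi.zero_apply, Pi.smul_apply, smul_eq_mul,
        neg_one_mul, neg_add_eq_zero]
      change ((χ x * mono l (x : Fin n → Kˣ) : Kˣ) : K) = _
      rw [h1]
      refine Finset.sum_congr rfl fun f hf => ?_
      rw [if_neg (fun hf' : f = f₀ => hnot (hf' ▸ hf)), Pi.smul_apply, smul_eq_mul, Finset.sum_mul]
      refine Finset.sum_congr rfl fun α hα => ?_
      rw [← (Finset.mem_filter.1 hα).2, natMono_apply]

end Diagonal

section Zariski

variable {K : Type*} [Field K] {n : ℕ}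

theorem isZariskiClosed_iff {S : Set (GL (Fin n) K)} :
    IsZariskiClosed S ↔ ∀ x ∉ S, ∃ f : MvPolynomial (Fin n × Fin n) K,
      VanishesOn f S ∧ MvPolynomial.eval (coords x) f ≠ 0 := by
  let _ := zariskiTopology K n
  constructor
  · intro h x hx
    have hb := TopologicalSpace.isTopologicalBasis_of_subbasis
      (t := zariskiTopology K n) rfl
    have ho : IsOpen Sᶜ := h.isOpen_compl
    obtain ⟨v, ⟨A, ⟨hfin, hA⟩, rfl⟩, hxv, hv⟩ := hb.exists_subset_of_mem_open (a := x) hx ho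
    have hA' : ∀ U ∈ A, ∃ f : MvPolynomial (Fin n × Fin n) K,
        U = {g | MvPolynomial.eval (coords g) f ≠ 0} := fun U hU => hA hU
    choose! f hf using hA'
    refine ⟨∏ U ∈ hfin.toFinset, f U, fun y hy => ?_, ?_⟩
    · by_contra hne
      rw [map_prod, Finset.prod_eq_zero_iff] at hne
      push Not at hne
      refine hv (a := y) (Set.mem_sInter.2 fun U hU => ?_) hy
      rw [hf U hU]
      exact hne U (hfin.mem_toFinset.2 hU)
    · rw [map_prod, Finset.prod_ne_zero_iff]
      intro U hU
      have := Set.mem_sInter.1 hxv U (hfin.mem_toFinset.1 hU)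
      rw [hf U (hfin.mem_toFinset.1 hU)] at this
      exact this
  · intro h
    refine ⟨isOpen_iff_forall_mem_open.2 fun x hx => ?_⟩
    obtain ⟨f, hf, hfx⟩ := h x hx
    refine ⟨{g | MvPolynomial.eval (coords g) f ≠ 0}, fun y hy hyS => hy (hf y hyS), ?_, hfx⟩
    exact TopologicalSpace.isOpen_generateFrom_of_mem ⟨f, rfl⟩

theorem IsZariskiClosed.inter {S S' : Set (GL (Fin n) K)} (h : IsZariskiClosed S)
    (h' : IsZariskiClosed S') : IsZariskiClosed (S ∩ S') :=
  @IsClosed.inter _ _ _ (zariskiTopology K n) h h'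

/-- Sets cut out by polynomial equations are Zariski closed. -/
theorem isZariskiClosed_of_forall {ι : Type*} (f : ι → MvPolynomial (Fin n × Fin n) K)
    {S : Set (GL (Fin n) K)}
    (h : ∀ x, x ∈ S ↔ ∀ i, MvPolynomial.eval (coords x) (f i) = 0) : IsZariskiClosed S := by
  rw [isZariskiClosed_iff]
  intro x hx
  rw [h] at hx
  push Not at hx
  obtain ⟨i, hi⟩ := hx
  exact ⟨f i, fun y hy => (h y).1 hy i, hi⟩

theorem exists_eval_mul (a b : Matrix (Fin n) (Fin n) K) (f : MvPolynomial (Fin n × Fin n) K) :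
    ∃ f' : MvPolynomial (Fin n × Fin n) K, ∀ M : Matrix (Fin n) (Fin n) K,
      MvPolynomial.eval (fun ij : Fin n × Fin n => M ij.1 ij.2) f' =
        MvPolynomial.eval (fun ij : Fin n × Fin n => (a * M * b) ij.1 ij.2) f := by
  refine ⟨MvPolynomial.bind₁ (fun ij => ∑ k, ∑ l, MvPolynomial.C (a ij.1 l * b k ij.2) *
    MvPolynomial.X (l, k)) f, fun M => ?_⟩
  rw [MvPolynomial.eval, MvPolynomial.eval₂Hom_bind₁]
  congr 2
  ext ij
  simp only [map_sum, map_mul, MvPolynomial.eval₂Hom_C, MvPolynomial.eval₂Hom_X', RingHom.id_apply,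
    Matrix.mul_apply, Finset.sum_mul]
  refine Finset.sum_congr rfl fun k _ => Finset.sum_congr rfl fun l _ => ?_
  ring

theorem exists_eval_diagHom (g : GL (Fin n) K) (f : MvPolynomial (Fin n × Fin n) K) :
    ∃ Q : MvPolynomial (Fin n) K, ∀ x : Fin n → Kˣ,
      MvPolynomial.eval (coords (diagHom g x)) f =
        MvPolynomial.eval (fun i => (x i : K)) Q := by
  refine ⟨MvPolynomial.bind₁ (fun ij => ∑ l, MvPolynomial.C
    (((g⁻¹ : GL (Fin n) K) : Matrix (Fin n) (Fin n) K) ij.1 l *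
      (g : Matrix (Fin n) (Fin n) K) l ij.2) * MvPolynomial.X l) f, fun x => ?_⟩
  rw [MvPolynomial.eval, MvPolynomial.eval, MvPolynomial.eval₂Hom_bind₁]
  congr 2
  ext ij
  simp only [map_sum, map_mul, MvPolynomial.eval₂Hom_C, MvPolynomial.eval₂Hom_X', RingHom.id_apply,
    coords, coe_diagHom]
  rw [Matrix.mul_apply]
  simp only [Matrix.mul_diagonal]
  refine Finset.sum_congr rfl fun k _ => ?_
  ring

/-- Closed diagonalizable groups are defined by monomial equations. -/
theorem diagHom_mem_of_relations {S : Subgroup (GL (Fin n) K)}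
    (hS : IsZariskiClosed (S : Set (GL (Fin n) K))) (g : GL (Fin n) K) {y : Fin n → Kˣ}
    (hy : ∀ k ∈ relations (S.comap (diagHom g)), mono k y = 1) : diagHom g y ∈ S := by
  by_contra hcon
  obtain ⟨f, hf, hfy⟩ := isZariskiClosed_iff.1 hS _ hcon
  obtain ⟨Q, hQ⟩ := exists_eval_diagHom g f
  rw [hQ] at hfy
  refine hfy (eval_eq_zero_of_relations (Γ := S.comap (diagHom g)) (fun x hx => ?_) hy)
  rw [← hQ]
  exact hf _ hx

theorem IsRationalCharacter.exists_mono {S : Subgroup (GL (Fin n) K)} {χ : S →* Kˣ}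
    (hχ : IsRationalCharacter S χ) (g : GL (Fin n) K) :
    ∃ k : Fin n → ℤ, ∀ (x : Fin n → Kˣ) (hx : diagHom g x ∈ S), χ ⟨_, hx⟩ = mono k x := by
  obtain ⟨P, m, hP⟩ := hχ
  obtain ⟨Q, hQ⟩ := exists_eval_diagHom g P
  obtain ⟨k, hk⟩ := exists_mono_eq (Γ := S.comap (diagHom g))
    (χ.comp ((diagHom g).subgroupComap S)) (fun _ => m) Q fun x => by
      rw [← hQ, Units.val_mul]
      have := hP ⟨diagHom g x, x.2⟩
      rw [det_diagHom] at this
      rw [← this]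
      congr 1
      simp [mono_apply, Finset.prod_pow]
  exact ⟨k, fun x hx => hk ⟨x, hx⟩⟩

/-- The diagonal entries, as characters of a diagonalizable group. -/
theorem exists_coordCharacter {S : Subgroup (GL (Fin n) K)} {g : GL (Fin n) K}
    (hS : S ≤ (diagHom g).range) (i : Fin n) :
    ∃ χ : S →* Kˣ, IsRationalCharacter S χ ∧
      ∀ (x : Fin n → Kˣ) (hx : diagHom g x ∈ S), χ ⟨_, hx⟩ = x i := by
  let e := MonoidHom.ofInjective (diagHom_injective g)
  have he : ∀ (x : Fin n → Kˣ) (hx : diagHom g x ∈ S),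
      e.symm (Subgroup.inclusion hS ⟨_, hx⟩) = x := fun x hx => by
    rw [MulEquiv.symm_apply_eq]
    rfl
  refine ⟨(Pi.evalMonoidHom (fun _ : Fin n => Kˣ) i).comp
    (e.symm.toMonoidHom.comp (Subgroup.inclusion hS)), ?_, fun x hx => ?_⟩
  · refine ⟨∑ k, ∑ l, MvPolynomial.C ((g : Matrix (Fin n) (Fin n) K) i l *
      ((g⁻¹ : GL (Fin n) K) : Matrix (Fin n) (Fin n) K) k i) * MvPolynomial.X (l, k), 0, ?_⟩
    rintro ⟨t, ht⟩
    obtain ⟨x, rfl⟩ := hS ht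
    have h1 := congrFun (congrFun (coe_conj_diagHom g x) i) i
    rw [Matrix.diagonal_apply_eq] at h1
    simp only [MonoidHom.comp_apply, MulEquiv.toMonoidHom_eq_coe, MonoidHom.coe_coe, he,
      Pi.evalMonoidHom_apply, pow_zero, mul_one]
    rw [← h1]
    simp only [Units.val_mul, Matrix.mul_apply, map_sum, map_mul, MvPolynomial.eval_C,
      MvPolynomial.eval_X, coords, Finset.sum_mul]
    refine Finset.sum_congr rfl fun k _ => Finset.sum_congr rfl fun l _ => ?_
    ring
  · simp only [MonoidHom.comp_apply, MulEquiv.toMonoidHom_eq_coe, MonoidHom.coe_coe, he,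
      Pi.evalMonoidHom_apply]

end Zariski

section Rational

variable {K : Type*} [Field K] {n : ℕ}

theorem mem_ratPoints_iff {k : Type*} [Field k] [Algebra k K] {t : GL (Fin n) K} :
    t ∈ ratPoints (K := K) (n := n) k ↔
      ∀ i j, (t : Matrix (Fin n) (Fin n) K) i j ∈ (algebraMap k K).range := by
  constructor
  · rintro ⟨t, rfl⟩ i j
    exact ⟨_, rfl⟩
  · intro h
    choose c hc using h
    have hM : (Matrix.of c).map (algebraMap k K) = (t : Matrix (Fin n) (Fin n) K) := by
      ext i j
      exact hc i j
    have hdet : (Matrix.of c).det ≠ 0 := by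
      intro h0
      have h1 := (Matrix.isUnit_iff_isUnit_det _).1 (Units.isUnit t)
      rw [← hM, ← RingHom.mapMatrix_apply, ← RingHom.map_det, h0, map_zero] at h1
      exact not_isUnit_zero h1
    refine ⟨Matrix.GeneralLinearGroup.mkOfDetNeZero _ hdet, ?_⟩
    apply Units.ext
    exact hM

theorem mem_ratPoints_intermediateField {F : Type*} [Field F] [Algebra F K]
    {E : IntermediateField F K} {t : GL (Fin n) K} :
    t ∈ ratPoints (K := K) (n := n) E ↔ ∀ i j, (t : Matrix (Fin n) (Fin n) K) i j ∈ E := by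
  rw [mem_ratPoints_iff]
  refine forall₂_congr fun i j => ⟨?_, fun h => ⟨⟨_, h⟩, rfl⟩⟩
  rintro ⟨c, hc⟩
  rw [← hc]
  exact c.2

theorem diagHom_mem_ratPoints {F : Type*} [Field F] [Algebra F K]
    {E : IntermediateField F K} {g : GL (Fin n) K} (hg : g ∈ ratPoints (K := K) (n := n) E)
    {x : Fin n → Kˣ} :
    diagHom g x ∈ ratPoints (K := K) (n := n) E ↔ ∀ i, (x i : K) ∈ E := by
  constructor
  · intro h i
    have h1 := mem_ratPoints_intermediateField.1 (mul_mem (mul_mem hg h) (inv_mem hg)) i i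
    rwa [coe_conj_diagHom, Matrix.diagonal_apply_eq] at h1
  · intro h
    have : g * diagHom g x * g⁻¹ ∈ ratPoints (K := K) (n := n) E := by
      rw [mem_ratPoints_intermediateField]
      intro i j
      rw [coe_conj_diagHom, Matrix.diagonal_apply]
      split_ifs
      · exact h i
      · exact zero_mem E
    have h2 := mul_mem (mul_mem (inv_mem hg) this) hg
    simpa [mul_assoc] using h2

/-- The action of automorphisms of `K` on `GL n K`. -/
abbrev galMap {F : Type*} [Field F] [Algebra F K] (σ : K ≃ₐ[F] K) : GL (Fin n) K →* GL (Fin n) K :=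
  Matrix.GeneralLinearGroup.map (σ : K →+* K)

variable {F : Type*} [Field F] [Algebra F K]

theorem galMap_apply (σ : K ≃ₐ[F] K) (t : GL (Fin n) K) (i j : Fin n) :
    (galMap σ t : Matrix (Fin n) (Fin n) K) i j = σ ((t : Matrix (Fin n) (Fin n) K) i j) := rfl

theorem eval_coords_galMap (σ : K ≃ₐ[F] K) (t : GL (Fin n) K)
    (h : MvPolynomial (Fin n × Fin n) F) :
    MvPolynomial.eval (coords (galMap σ t)) (MvPolynomial.map (algebraMap F K) h) =
      σ (MvPolynomial.eval (coords t) (MvPolynomial.map (algebraMap F K) h)) := by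
  rw [MvPolynomial.eval_map, MvPolynomial.eval_map]
  have := MvPolynomial.eval₂_comp_left (σ : K →+* K) (algebraMap F K) (coords t) h
  refine Eq.trans ?_ this.symm
  congr 1
  ext c
  simp

/-- Closed sets defined over `F` are stable under automorphisms over `F`. -/
theorem galMap_mem {S : Set (GL (Fin n) K)} (hS : IsZariskiClosed S) (hF : IsDefinedOver F S)
    (σ : K ≃ₐ[F] K) {t : GL (Fin n) K} (ht : t ∈ S) : galMap σ t ∈ S := by
  by_contra hcon
  obtain ⟨f, hf, hft⟩ := isZariskiClosed_iff.1 hS _ hcon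
  refine hft ?_
  have hker : f ∈ RingHom.ker (MvPolynomial.eval (coords (galMap σ t))) := by
    refine (Ideal.span_le.2 ?_) (hF f hf)
    rintro h ⟨hh, h₀, rfl⟩
    rw [SetLike.mem_coe, RingHom.mem_ker, eval_coords_galMap, hh t ht, map_zero]
  exact hker

theorem galMap_mem_ratPoints [IsAlgClosure F K] {E : IntermediateField F K} [Normal F E] (σ : K ≃ₐ[F] K)
    {t : GL (Fin n) K} (ht : t ∈ ratPoints (K := K) (n := n) E) :
    galMap σ t ∈ ratPoints (K := K) (n := n) E := by
  rw [mem_ratPoints_intermediateField] at *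
  intro i j
  rw [galMap_apply]
  have : Normal F K := IsAlgClosure.normal F K
  have := IntermediateField.normal_iff_forall_map_le'.1 ‹Normal F E› σ
  exact this ⟨_, ht i j, rfl⟩

theorem galMap_eq_of_mem_ratPoints (σ : K ≃ₐ[F] K) {t : GL (Fin n) K}
    (ht : t ∈ ratPoints (K := K) (n := n) F) : galMap σ t = t := by
  apply Units.ext
  ext i j
  obtain ⟨c, hc⟩ := mem_ratPoints_iff.1 ht i j
  rw [galMap_apply, ← hc]
  simp

theorem mem_of_forall_algEquiv [IsAlgClosure F K] {E : IntermediateField F K}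
    [FiniteDimensional F E] [IsGalois F E] {x : K} (hx : x ∈ E)
    (h : ∀ σ : K ≃ₐ[F] K, σ x = x) : x ∈ (algebraMap F K).range := by
  have : Normal F K := IsAlgClosure.normal F K
  have h1 : (⟨x, hx⟩ : E) ∈ Set.range (algebraMap F E) := by
    rw [IsGalois.mem_range_algebraMap_iff_fixed]
    intro τ
    have h2 := h (τ.liftNormal K)
    have h3 := AlgEquiv.liftNormal_commutes τ K (⟨x, hx⟩ : E)
    apply Subtype.ext
    exact h3.symm.trans h2
  obtain ⟨c, hc⟩ := h1
  exact ⟨c, congrArg (algebraMap E K) hc⟩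

theorem mem_ratPoints_of_galMap_eq [IsAlgClosure F K] {E : IntermediateField F K}
    [FiniteDimensional F E] [IsGalois F E] {t : GL (Fin n) K}
    (ht : t ∈ ratPoints (K := K) (n := n) E) (h : ∀ σ : K ≃ₐ[F] K, galMap σ t = t) :
    t ∈ ratPoints (K := K) (n := n) F := by
  rw [mem_ratPoints_iff]
  intro i j
  refine mem_of_forall_algEquiv (mem_ratPoints_intermediateField.1 ht i j) fun σ => ?_
  rw [← galMap_apply, h σ]

/-- The action of an automorphism on the diagonal entries is given by monomials. -/
theorem exists_mono_galMap (g : GL (Fin n) K) (σ : K ≃ₐ[F] K) :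
    ∃ A : Fin n → Fin n → ℤ, ∀ x x' : Fin n → Kˣ,
      galMap σ (diagHom g x) = diagHom g x' → ∀ i, (x' i : K) = σ (mono (A i) x : Kˣ) := by
  have key : ∀ i : Fin n, ∃ k : Fin n → ℤ, ∀ x x' : Fin n → Kˣ,
      galMap σ (diagHom g x) = diagHom g x' → (x' i : K) = σ (mono k x : Kˣ) := by
    intro i
    let Γ : Subgroup (Fin n → Kˣ) :=
      (diagHom g).range.comap ((galMap σ).comp (diagHom g))
    let e := MonoidHom.ofInjective (diagHom_injective g)
    let χ' : Γ →* Kˣ := (Pi.evalMonoidHom (fun _ : Fin n => Kˣ) i).comp (e.symm.toMonoidHom.comp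
      (((galMap σ).comp (diagHom g)).subgroupComap (diagHom g).range))
    let χ : Γ →* Kˣ := (Units.map (σ.symm : K →* K)).comp χ'
    have hχ' : ∀ (x x' : Fin n → Kˣ) (h : galMap σ (diagHom g x) = diagHom g x'),
        χ' ⟨x, ⟨x', h.symm⟩⟩ = x' i := by
      intro x x' h
      have : e.symm (((galMap σ).comp (diagHom g)).subgroupComap (diagHom g).range
          ⟨x, ⟨x', h.symm⟩⟩) = x' := by
        rw [MulEquiv.symm_apply_eq]
        apply Subtype.ext
        exact h
      exact congrFun this i
    let w : GL (Fin n) K := g * galMap σ g⁻¹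
    obtain ⟨k, hk⟩ := exists_mono_eq χ 0 (∑ l, MvPolynomial.C
      (σ.symm ((w : Matrix (Fin n) (Fin n) K) i l *
        ((w⁻¹ : GL (Fin n) K) : Matrix (Fin n) (Fin n) K) l i)) * MvPolynomial.X l) (by
      rintro ⟨x, ⟨x', hx'⟩⟩
      have h1 : (χ ⟨x, ⟨x', hx'⟩⟩ : K) = σ.symm (x' i : K) := by
        rw [← hχ' x x' hx'.symm]; rfl
      rw [mono_zero, mul_one, h1, AlgEquiv.symm_apply_eq]
      have h2 : (g * diagHom g x' * g⁻¹ : GL (Fin n) K) =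
          w * galMap σ (g * diagHom g x * g⁻¹) * w⁻¹ := by
        rw [hx']
        simp only [w, MonoidHom.comp_apply, map_mul, map_inv, mul_inv_rev, inv_inv]
        group
      have h3 : ∀ a b, (galMap σ (g * diagHom g x * g⁻¹) : Matrix (Fin n) (Fin n) K) a b =
          σ (Matrix.diagonal (fun i => (x i : K)) a b) := fun a b => by
        rw [galMap_apply, coe_conj_diagHom]
      have h4 := congrArg (fun t : GL (Fin n) K => (t : Matrix (Fin n) (Fin n) K) i i) h2
      simp only [coe_conj_diagHom, Matrix.diagonal_apply_eq] at h4
      rw [h4]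
      generalize galMap σ (g * diagHom g x * g⁻¹) = M at h3
      simp only [Units.val_mul, Matrix.mul_apply, map_sum, map_mul, MvPolynomial.eval_C,
        MvPolynomial.eval_X]
      refine Finset.sum_congr rfl fun l _ => ?_
      rw [Finset.sum_eq_single l]
      · rw [h3, Matrix.diagonal_apply_eq]
        simp only [AlgEquiv.apply_symm_apply]
        ring
      · intro b _ hb
        rw [h3, Matrix.diagonal_apply_ne _ hb, map_zero, mul_zero]
      · simp)
    refine ⟨k, fun x x' h => ?_⟩
    rw [← hk ⟨x, ⟨x', h.symm⟩⟩, ← hχ' x x' h]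
    exact (σ.apply_symm_apply _).symm
  choose A hA using key
  exact ⟨A, fun x x' h i => hA i x x' h⟩

end Rational

section Torus

variable {F : Type*} [Field F] [ValuativeRel F] [TopologicalSpace F] [IsNonarchimedeanLocalField F]
  {K : Type*} [Field K] [Algebra F K] {n : ℕ}

/-- The tuples of units which are congruent to `1` modulo `𝔭_m`. -/
def IsCongrOne (F : Type*) [Field F] [ValuativeRel F] [TopologicalSpace F]
    [IsNonarchimedeanLocalField F] {K : Type*} [Field K] [Algebra F K] {n : ℕ}
    (m : ℝ) (x : Fin n → Kˣ) : Prop :=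
  ∀ i, (m : WithTop ℝ) ≤ val F ((x i : K) - 1)

theorem IsCongrOne.mono_le {m m' : ℝ} {x : Fin n → Kˣ} (hx : IsCongrOne F m x) (h : m' ≤ m) :
    IsCongrOne F m' x :=
  fun i => le_trans (by exact_mod_cast h) (hx i)

variable [Algebra.IsAlgebraic F K]

theorem IsCongrOne.mul {m : ℝ} (hm : 0 < m) {x y : Fin n → Kˣ} (hx : IsCongrOne F m x)
    (hy : IsCongrOne F m y) : IsCongrOne F m (x * y) :=
  fun i => (unitFiltration F hm).mul_mem (hx i) (hy i)

theorem IsCongrOne.inv {m : ℝ} (hm : 0 < m) {x : Fin n → Kˣ} (hx : IsCongrOne F m x) :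
    IsCongrOne F m x⁻¹ :=
  fun i => (unitFiltration F hm).inv_mem (hx i)

theorem IsCongrOne.mono {m : ℝ} (hm : 0 < m) {x : Fin n → Kˣ} (hx : IsCongrOne F m x)
    (k : Fin n → ℤ) : (m : WithTop ℝ) ≤ val F ((mono k x : K) - 1) :=
  (mem_unitFiltration hm).1 <| by
    rw [mono_apply]
    refine Subgroup.prod_mem _ fun i _ => ?_
    exact (unitFiltration F hm).zpow_mem (hx i) (k i)

theorem IsCongrOne.galMap {m : ℝ} (hm : 0 < m) {g : GL (Fin n) K} {σ : K ≃ₐ[F] K}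
    {x x' : Fin n → Kˣ} (hx : IsCongrOne F m x)
    (h : galMap σ (diagHom g x) = diagHom g x') : IsCongrOne F m x' := by
  obtain ⟨A, hA⟩ := exists_mono_galMap g σ
  intro i
  rw [hA x x' h i, ← map_one σ, ← map_sub, val_map]
  exact hx.mono hm _

theorem diagHom_mem_torusFiltration {E : IntermediateField F K} {S : Subgroup (GL (Fin n) K)}
    {g : GL (Fin n) K} (hS : S ≤ (diagHom g).range) {ρ : ℝ} (hρ : 0 < ρ) {x : Fin n → Kˣ} :
    diagHom g x ∈ torusFiltration E S ρ ↔
      diagHom g x ∈ ratPoints (K := K) (n := n) E ∧ diagHom g x ∈ S ∧ IsCongrOne F ρ x := by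
  constructor
  · rintro ⟨h1, h2, h3⟩
    refine ⟨h1, h2, fun i => ?_⟩
    obtain ⟨χ, hχ, hχx⟩ := exists_coordCharacter hS i
    have := h3 χ hχ
    rwa [hχx x h2] at this
  · rintro ⟨h1, h2, h3⟩
    refine ⟨h1, h2, fun χ hχ => ?_⟩
    obtain ⟨k, hk⟩ := hχ.exists_mono g
    rw [hk x h2]
    exact h3.mono hρ k

theorem le_val_one_add_zpow {d : K} {m : ℝ} (hm : 0 < m) (hd : (m : WithTop ℝ) ≤ val F d) (k : ℤ) :
    ((2 * m : ℝ) : WithTop ℝ) ≤ val F ((1 + d) ^ k - 1 - k * d) := by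
  rcases Int.eq_nat_or_neg k with ⟨k, rfl | rfl⟩
  · simpa using le_val_one_add_pow hm.le hd k
  · have h1 : (m : WithTop ℝ) ≤ val F ((1 + d) - 1) := by rwa [add_sub_cancel_left]
    have h0 : val F (1 + d) = 0 := val_eq_zero_of_sub_one hm h1
    have hne : 1 + d ≠ 0 := fun h => by simp [h] at h0
    have h2 : (m : WithTop ℝ) ≤ val F ((1 + d)⁻¹ - 1) := le_val_inv_sub_one hm h1
    have h3 := le_val_one_add_pow hm.le h2 k
    rw [add_sub_cancel] at h3
    have h4 : (1 + d) ^ (-(k : ℤ)) - 1 - ((-(k : ℤ) : ℤ) : K) * d =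
        ((1 + d)⁻¹ ^ k - 1 - k * ((1 + d)⁻¹ - 1)) + k * ((d * d) * (1 + d)⁻¹) := by
      rw [zpow_neg, zpow_natCast, inv_pow]
      have : (1 + d)⁻¹ - 1 = -d * (1 + d)⁻¹ := by field_simp; ring
      rw [this]
      push_cast
      have h5 : d = d * (1 + d) * (1 + d)⁻¹ := by rw [mul_assoc, mul_inv_cancel₀ hne, mul_one]
      linear_combination (k : K) * h5
    rw [h4]
    refine le_val_add h3 ?_
    rw [val_mul, val_mul, val_inv_eq_zero h0, add_zero, two_mul]
    exact le_add_of_nonneg_of_le (val_natCast_nonneg k) (le_val_mul hd hd)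

theorem le_val_prod_sub {ι : Type*} (s : Finset ι) (f d : ι → K) {m : ℝ} (hm : 0 < m)
    (hd : ∀ i ∈ s, (m : WithTop ℝ) ≤ val F (d i))
    (hf : ∀ i ∈ s, ((2 * m : ℝ) : WithTop ℝ) ≤ val F (f i - 1 - d i)) :
    ((2 * m : ℝ) : WithTop ℝ) ≤ val F (∏ i ∈ s, f i - 1 - ∑ i ∈ s, d i) := by
  classical
  induction s using Finset.induction_on with
  | empty => simp
  | insert i s hi ih =>
    have hd' := fun j hj => hd j (Finset.mem_insert_of_mem hj)
    have ih' := ih hd' fun j hj => hf j (Finset.mem_insert_of_mem hj)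
    have h2 : (m : WithTop ℝ) ≤ ((2 * m : ℝ) : WithTop ℝ) := by
      rw [WithTop.coe_le_coe]; linarith
    have h3 : (m : WithTop ℝ) ≤ val F (f i - 1) := by
      have : f i - 1 = (f i - 1 - d i) + d i := by ring
      rw [this]
      exact le_val_add (h2.trans (hf i (Finset.mem_insert_self i s)))
        (hd i (Finset.mem_insert_self i s))
    rw [Finset.prod_insert hi, Finset.sum_insert hi]
    have : f i * ∏ i ∈ s, f i - 1 - (d i + ∑ i ∈ s, d i) =
        f i * (∏ i ∈ s, f i - 1 - ∑ i ∈ s, d i) + (f i - 1 - d i) +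
          (f i - 1) * ∑ i ∈ s, d i := by ring
    rw [this]
    refine le_val_add (le_val_add ?_ (hf i (Finset.mem_insert_self i s))) ?_
    · rw [val_mul, val_eq_zero_of_sub_one hm h3, zero_add]
      exact ih'
    · rw [two_mul]
      exact le_val_mul h3 (le_val_sum s d hd')

/-- Monomials are linear up to second order. -/
theorem IsCongrOne.le_val_mono_sub {m : ℝ} (hm : 0 < m) {x : Fin n → Kˣ} (hx : IsCongrOne F m x)
    (k : Fin n → ℤ) :
    ((2 * m : ℝ) : WithTop ℝ) ≤ val F ((YuGroups.mono k x : K) - 1 - ∑ i, k i * ((x i : K) - 1)) := by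
  have : (YuGroups.mono k x : K) = ∏ i, (x i : K) ^ k i := by simp [mono_apply]
  rw [this]
  refine le_val_prod_sub _ _ _ hm (fun i _ => ?_) fun i _ => ?_
  · rw [val_mul]
    exact le_add_of_nonneg_of_le (val_intCast_nonneg _) (hx i)
  · have := le_val_one_add_zpow hm (hx i) (k i)
    rwa [add_sub_cancel] at this

end Torus

section Saturation

variable {K : Type*} [Field K] {n : ℕ}

/-- The exponents of characters of finite order on `Γ`. -/
def satRelations (Γ : Subgroup (Fin n → Kˣ)) : Submodule ℤ (Fin n → ℤ) where
  carrier := {k | ∃ m : ℤ, m ≠ 0 ∧ m • k ∈ relations Γ}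
  add_mem' := by
    rintro k l ⟨m, hm, hk⟩ ⟨m', hm', hl⟩
    refine ⟨m * m', mul_ne_zero hm hm', ?_⟩
    rw [smul_add, mul_comm m m', mul_smul, mul_comm m' m, mul_smul]
    exact add_mem (Submodule.smul_mem _ _ hk) (Submodule.smul_mem _ _ hl)
  zero_mem' := ⟨1, one_ne_zero, by simp⟩
  smul_mem' := by
    rintro c k ⟨m, hm, hk⟩
    refine ⟨m, hm, ?_⟩
    rw [smul_comm]
    exact Submodule.smul_mem _ _ hk

theorem relations_le_satRelations (Γ : Subgroup (Fin n → Kˣ)) :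
    relations Γ ≤ satRelations Γ := fun k hk => ⟨1, one_ne_zero, by rwa [one_smul]⟩

/-- The points at which all characters of finite order on `Γ` are trivial. -/
def satSubgroup (Γ : Subgroup (Fin n → Kˣ)) : Subgroup (Fin n → Kˣ) where
  carrier := {x | ∀ k ∈ satRelations Γ, mono k x = 1}
  one_mem' k _ := map_one _
  mul_mem' hx hy k hk := by rw [map_mul, hx k hk, hy k hk, one_mul]
  inv_mem' hx k hk := by rw [map_inv, hx k hk, inv_one]

theorem mono_mono (k : Fin n → ℤ) (B : Fin n → Fin n → ℤ) (x : Fin n → Kˣ) :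
    mono k (fun i => mono (B i) x) = mono (∑ i, k i • B i) x := by
  rw [mono_apply]
  simp_rw [← mono_smul]
  have : ∀ s : Finset (Fin n), ∏ i ∈ s, mono (k i • B i) x = mono (∑ i ∈ s, k i • B i) x := by
    intro s
    induction s using Finset.induction_on with
    | empty => simp
    | insert i s hi ih => rw [Finset.prod_insert hi, Finset.sum_insert hi, mono_add, ih]
  exact this _

/-- A projection of the diagonal group onto `satSubgroup Γ`. -/
theorem exists_projection (Γ : Subgroup (Fin n → Kˣ)) :
    ∃ P : Fin n → Fin n → ℤ, (∀ x : Fin n → Kˣ, (fun i => mono (P i) x) ∈ satSubgroup Γ) ∧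
      ∀ x ∈ satSubgroup Γ, (fun i => mono (P i) x) = x := by
  have htf : Module.IsTorsionFree ℤ ((Fin n → ℤ) ⧸ satRelations Γ) := by
    rw [Module.isTorsionFree_int_iff_isAddTorsionFree, isAddTorsionFree_iff_not_isOfFinAddOrder]
    intro a ha hfin
    obtain ⟨k, rfl⟩ := Submodule.Quotient.mk_surjective _ a
    obtain ⟨m, hm, hma⟩ := isOfFinAddOrder_iff_nsmul_eq_zero.1 hfin
    refine ha ?_
    rw [← Submodule.Quotient.mk_smul, Submodule.Quotient.mk_eq_zero] at hma
    obtain ⟨m', hm', h⟩ := hma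
    rw [Submodule.Quotient.mk_eq_zero]
    refine ⟨m' * m, mul_ne_zero hm' (by exact_mod_cast hm.ne'), ?_⟩
    rw [mul_smul, natCast_zsmul]
    exact h
  have hfree : Module.Free ℤ ((Fin n → ℤ) ⧸ satRelations Γ) := inferInstance
  obtain ⟨s, hs⟩ := Module.projective_lifting_property (satRelations Γ).mkQ LinearMap.id
    (Submodule.mkQ_surjective _)
  let p : (Fin n → ℤ) →ₗ[ℤ] (Fin n → ℤ) := s ∘ₗ (satRelations Γ).mkQ
  have hp : ∀ k, ∑ i, k i • p (Pi.single i 1) = p k := by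
    intro k
    conv_rhs => rw [← Finset.univ_sum_single k, map_sum]
    refine Finset.sum_congr rfl fun i _ => ?_
    rw [← map_smul, ← Pi.single_smul, smul_eq_mul, mul_one]
  refine ⟨fun i => p (Pi.single i 1), fun x k hk => ?_, fun x hx => ?_⟩
  · rw [mono_mono, hp]
    have : p k = 0 := by
      simp only [p, LinearMap.comp_apply, Submodule.mkQ_apply,
        (Submodule.Quotient.mk_eq_zero _).2 hk, map_zero]
    rw [this, mono_zero]
  · ext i : 1
    have h1 : Pi.single i 1 - p (Pi.single i 1) ∈ satRelations Γ := by
      rw [← Submodule.Quotient.mk_eq_zero, Submodule.Quotient.mk_sub, sub_eq_zero]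
      exact (LinearMap.congr_fun hs (Submodule.Quotient.mk (Pi.single i 1))).symm
    have h2 := hx _ h1
    rw [mono_sub, mono_single, div_eq_one] at h2
    exact h2.symm

theorem satSubgroup_galMap {F : Type*} [Field F] [Algebra F K] {Γ : Subgroup (Fin n → Kˣ)}
    {g : GL (Fin n) K} {σ : K ≃ₐ[F] K}
    (hΓ : ∀ x ∈ Γ, ∃ x' ∈ Γ, galMap σ (diagHom g x) = diagHom g x') {x x' : Fin n → Kˣ}
    (hx : x ∈ satSubgroup Γ) (h : galMap σ (diagHom g x) = diagHom g x') :
    x' ∈ satSubgroup Γ := by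
  obtain ⟨A, hA⟩ := exists_mono_galMap g σ
  have hA' : ∀ (x x' : Fin n → Kˣ), galMap σ (diagHom g x) = diagHom g x' → ∀ k : Fin n → ℤ,
      mono k x' = Units.map (σ : K →* K) (mono (∑ i, k i • A i) x) := by
    intro x x' h k
    rw [← mono_mono, mono_apply, mono_apply, map_prod]
    refine Finset.prod_congr rfl fun i _ => ?_
    rw [map_zpow]
    congr 1
    exact Units.ext (hA x x' h i)
  intro k hk
  rw [hA' x x' h, hx, map_one]
  obtain ⟨m, hm, hmk⟩ := hk
  refine ⟨m, hm, fun z hz => ?_⟩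
  obtain ⟨z', hz', hzz'⟩ := hΓ z hz
  have h1 := hmk z' hz'
  rw [hA' z z' hzz'] at h1
  have h2 : ∑ i, (m • k) i • A i = m • ∑ i, k i • A i := by
    rw [Finset.smul_sum]
    refine Finset.sum_congr rfl fun i _ => ?_
    rw [Pi.smul_apply, smul_assoc]
  rw [h2] at h1
  exact Units.map_injective (f := (σ : K →* K)) σ.injective (h1.trans (map_one _).symm)

end Saturation

section Descent

variable {F : Type*} [Field F] [ValuativeRel F] [TopologicalSpace F] [IsNonarchimedeanLocalField F]
  {K : Type*} [Field K] [Algebra F K] {n : ℕ}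

theorem eq_of_forall_isCongrOne {r : ℝ} (hr : 0 < r) {x : Fin n → Kˣ}
    (h : ∀ k : ℕ, IsCongrOne F (2 ^ k * r) x) : x = 1 := by
  ext i
  rw [Pi.one_apply, Units.val_one, ← sub_eq_zero]
  by_contra hne
  obtain ⟨c, hc⟩ := exists_val_eq (F := F) hne
  obtain ⟨k, hk⟩ := pow_unbounded_of_one_lt (c / r) (one_lt_two)
  have h1 := h k i
  rw [hc, WithTop.coe_le_coe] at h1
  rw [div_lt_iff₀ hr] at hk
  linarith

variable [IsAlgClosure F K]

/-- `x` is fixed by the automorphisms of `K` up to elements of `Γ` congruent to `1` modulo `𝔭_m`. -/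
def IsAlmostFixed (F : Type*) [Field F] [ValuativeRel F] [TopologicalSpace F]
    [IsNonarchimedeanLocalField F] {K : Type*} [Field K] [Algebra F K] {n : ℕ}
    (g : GL (Fin n) K) (Γ : Subgroup (Fin n → Kˣ)) (m : ℝ) (x : Fin n → Kˣ) : Prop :=
  ∀ σ : K ≃ₐ[F] K, ∃ c ∈ Γ, IsCongrOne F m c ∧
    diagHom g x = diagHom g c * galMap σ (diagHom g x)

/-- A trace construction improves the precision to which an element is fixed. -/
theorem exists_sum_approx {E : IntermediateField F K} [FiniteDimensional F E] [IsGalois F E]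
    (hE : IsTamelyRamified E) {g : GL (Fin n) K} (hg : g ∈ ratPoints (K := K) (n := n) E)
    {Γ : Subgroup (Fin n → Kˣ)} {m : ℝ} (hm : 0 < m) {P : Fin n → Fin n → ℤ}
    (hP : ∀ x ∈ Γ, (fun i => mono (P i) x) = x) {x : Fin n → Kˣ} (hxE : ∀ i, (x i : K) ∈ E)
    (hx : IsAlmostFixed F g Γ m x) :
    ∃ y : Fin n → Kˣ, (∀ i, (y i : K) ∈ E) ∧ IsCongrOne F m y ∧
      (∀ i, ((2 * m : ℝ) : WithTop ℝ) ≤ val F ((mono (P i) y : K) - y i)) ∧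
      (diagHom g x)⁻¹ * diagHom g y ∈ ratPoints (K := K) (n := n) F := by
  have : Algebra.IsAlgebraic F K := IsAlgClosure.isAlgebraic
  have : Normal F K := IsAlgClosure.normal F K
  obtain ⟨θ, hθ, hθ1⟩ := hE.exists_sum_eq_one
  have hθτ : ∀ τ : E ≃ₐ[F] E, 0 ≤ val F ((τ θ : E) : K) := fun τ => by
    rw [val_coe, val_map, ← val_coe]; exact hθ
  choose c hcΓ hcm hc using fun τ : E ≃ₐ[F] E => hx (τ.liftNormal K)
  have hX : diagHom g x ∈ ratPoints (K := K) (n := n) E := (diagHom_mem_ratPoints hg).2 hxE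
  have hcE : ∀ τ i, (c τ i : K) ∈ E := by
    intro τ
    rw [← diagHom_mem_ratPoints hg, ← mul_inv_eq_of_eq_mul (hc τ)]
    exact mul_mem hX (inv_mem (galMap_mem_ratPoints _ hX))
  have hθ1' : ∑ τ : E ≃ₐ[F] E, ((τ θ : E) : K) = 1 := by
    have := congrArg (algebraMap E K) hθ1
    rw [map_sum, map_one] at this
    exact this
  let y₀ : Fin n → K := fun i => ∑ τ : E ≃ₐ[F] E, ((τ θ : E) : K) * (c τ i : K)
  have hy₀ : ∀ i, y₀ i - 1 = ∑ τ : E ≃ₐ[F] E, ((τ θ : E) : K) * ((c τ i : K) - 1) := by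
    intro i
    simp only [y₀, mul_sub, mul_one, Finset.sum_sub_distrib, hθ1']
  have hy₀m : ∀ i, (m : WithTop ℝ) ≤ val F (y₀ i - 1) := by
    intro i
    rw [hy₀]
    refine le_val_sum _ _ fun τ _ => ?_
    rw [val_mul]
    exact le_add_of_nonneg_of_le (hθτ τ) (hcm τ i)
  have hne : ∀ i, y₀ i ≠ 0 := fun i h => by
    have := val_eq_zero_of_sub_one hm (hy₀m i)
    simp [h] at this
  let y : Fin n → Kˣ := fun i => Units.mk0 (y₀ i) (hne i)
  have hym : IsCongrOne F m y := hy₀m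
  refine ⟨y, fun i => ?_, hym, fun i => ?_, ?_⟩
  · exact sum_mem fun τ _ => mul_mem (τ θ).2 (hcE τ i)
  · have h1 := hym.le_val_mono_sub hm (P i)
    have h2 : (mono (P i) y : K) - y i =
        ((mono (P i) y : K) - 1 - ∑ j, P i j * ((y j : K) - 1)) +
          ∑ τ : E ≃ₐ[F] E, ((τ θ : E) : K) *
            (∑ j, P i j * ((c τ j : K) - 1) - ((c τ i : K) - 1)) := by
      have h3 : ∑ τ : E ≃ₐ[F] E, ((τ θ : E) : K) *
            (∑ j, P i j * ((c τ j : K) - 1) - ((c τ i : K) - 1)) =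
          ∑ j, P i j * ((y j : K) - 1) - ((y i : K) - 1) := by
        simp only [mul_sub (((_ : E) : K)), Finset.sum_sub_distrib]
        congr 1
        · simp_rw [Finset.mul_sum]
          rw [Finset.sum_comm]
          refine Finset.sum_congr rfl fun j _ => ?_
          change _ = (P i j : K) * (y₀ j - 1)
          rw [hy₀, Finset.mul_sum]
          refine Finset.sum_congr rfl fun τ _ => ?_
          ring
        · change _ = y₀ i - 1
          rw [hy₀]
          simp only [mul_sub, Finset.sum_sub_distrib]
      rw [h3]
      ring
    rw [h2]
    refine le_val_add h1 (le_val_sum _ _ fun τ _ => ?_)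
    rw [val_mul]
    refine le_add_of_nonneg_of_le (hθτ τ) ?_
    have h4 := (hcm τ).le_val_mono_sub hm (P i)
    have h5 : (mono (P i) (c τ) : K) = c τ i := by
      have := congrFun (hP _ (hcΓ τ)) i
      exact congrArg Units.val this
    rw [h5, val_sub_comm] at h4
    exact h4
  · rw [mem_ratPoints_iff]
    intro i j
    have hentry : (((diagHom g x)⁻¹ * diagHom g y : GL (Fin n) K) : Matrix (Fin n) (Fin n) K) =
        ∑ τ : E ≃ₐ[F] E, ((τ θ : E) : K) •
          ((galMap (τ.liftNormal K) (diagHom g x)⁻¹ : GL (Fin n) K) :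
            Matrix (Fin n) (Fin n) K) := by
      have h6 : (diagHom g y : Matrix (Fin n) (Fin n) K) = ∑ τ : E ≃ₐ[F] E,
          ((τ θ : E) : K) • (diagHom g (c τ) : Matrix (Fin n) (Fin n) K) := by
        have h7 : Matrix.diagonal (fun i => (y i : K)) = ∑ τ : E ≃ₐ[F] E,
            ((τ θ : E) : K) • Matrix.diagonal (fun i => (c τ i : K)) := by
          ext a b
          rw [Matrix.sum_apply]
          simp only [Matrix.smul_apply, smul_eq_mul, Matrix.diagonal_apply]
          split_ifs
          · rfl
          · simp
        simp_rw [coe_diagHom]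
        rw [h7, Finset.mul_sum, Finset.sum_mul]
        refine Finset.sum_congr rfl fun τ _ => ?_
        rw [mul_smul_comm, smul_mul_assoc]
      rw [Units.val_mul, h6, Finset.mul_sum]
      refine Finset.sum_congr rfl fun τ _ => ?_
      rw [mul_smul_comm, ← Units.val_mul]
      congr 2
      rw [map_inv, inv_mul_eq_iff_eq_mul, ← mul_inv_eq_of_eq_mul (hc τ)]
    have hE' : ((diagHom g x)⁻¹ : GL (Fin n) K) ∈ ratPoints (K := K) (n := n) E := inv_mem hX
    let w : E := ⟨((((diagHom g x)⁻¹ : GL (Fin n) K)) : Matrix (Fin n) (Fin n) K) i j,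
      mem_ratPoints_intermediateField.1 hE' i j⟩
    refine ⟨Algebra.trace F E (θ * w), ?_⟩
    rw [hentry, Matrix.sum_apply]
    have h8 := trace_eq_sum_automorphisms (K := F) (L := E) (θ * w)
    have h9 := congrArg (algebraMap E K) h8
    rw [map_sum, ← IsScalarTower.algebraMap_apply] at h9
    rw [h9]
    refine Finset.sum_congr rfl fun τ _ => ?_
    rw [Matrix.smul_apply, smul_eq_mul, galMap_apply, map_mul, map_mul]
    congr 1
    exact (AlgEquiv.liftNormal_commutes τ K w).symm

/-- Elements fixed up to `𝔭_m` can be changed into elements fixed up to `𝔭_{2m}`. -/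
theorem IsAlmostFixed.exists_next {E : IntermediateField F K} [FiniteDimensional F E] [IsGalois F E]
    (hE : IsTamelyRamified E) {g : GL (Fin n) K} (hg : g ∈ ratPoints (K := K) (n := n) E)
    {Γ : Subgroup (Fin n → Kˣ)}
    (hΓ : ∀ σ : K ≃ₐ[F] K, ∀ x ∈ satSubgroup Γ, ∃ x' ∈ satSubgroup Γ,
      YuGroups.galMap σ (diagHom g x) = diagHom g x')
    {m : ℝ} (hm : 0 < m) {x : Fin n → Kˣ} (hxE : ∀ i, (x i : K) ∈ E)
    (hx : IsAlmostFixed F g (satSubgroup Γ) m x) :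
    ∃ h ∈ satSubgroup Γ, (∀ i, (h i : K) ∈ E) ∧ IsCongrOne F m h ∧
      IsAlmostFixed F g (satSubgroup Γ) (2 * m) (h⁻¹ * x) := by
  have : Algebra.IsAlgebraic F K := IsAlgClosure.isAlgebraic
  obtain ⟨P, hP1, hP2⟩ := exists_projection Γ
  obtain ⟨y, hyE, hym, hy, hq⟩ := exists_sum_approx hE hg hm hP2 hxE hx
  let h : Fin n → Kˣ := fun i => mono (P i) y
  have hhm : IsCongrOne F m h := fun i => hym.mono hm (P i)
  refine ⟨h, hP1 y, fun i => ?_, hhm, fun σ => ?_⟩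
  · change ((mono (P i) y : Kˣ) : K) ∈ E
    rw [mono_apply]
    push_cast
    exact prod_mem fun j _ => zpow_mem (hyE j) _
  · obtain ⟨c, hcΓ, hcm, hc⟩ := hx σ
    obtain ⟨h', hh', hhh'⟩ := hΓ σ h (hP1 y)
    refine ⟨h⁻¹ * c * h', mul_mem (mul_mem (inv_mem (hP1 y)) hcΓ) hh', ?_, ?_⟩
    · have hu : IsCongrOne F (2 * m) (h⁻¹ * y) := by
        have h2m : (0 : ℝ) < 2 * m := by linarith
        have : IsCongrOne F (2 * m) (y⁻¹ * h) := by
          intro i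
          have h0 : val F (y i : K) = 0 := val_eq_zero_of_sub_one hm (hym i)
          have h1 : (((y⁻¹ * h) i : Kˣ) : K) - 1 = (y i : K)⁻¹ * ((mono (P i) y : K) - y i) := by
            rw [mul_sub, inv_mul_cancel₀ (y i).ne_zero, Pi.mul_apply, Pi.inv_apply, Units.val_mul,
              Units.val_inv_eq_inv_val]
          rw [h1, val_mul, val_inv_eq_zero h0, zero_add]
          exact hy i
        have h3 := this.inv h2m
        rwa [mul_inv_rev, inv_inv] at h3
      have hgal : YuGroups.galMap σ (diagHom g (h⁻¹ * y)) = diagHom g (h'⁻¹ * (c⁻¹ * y)) := by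
        have h1 := galMap_eq_of_mem_ratPoints σ hq
        rw [map_mul, map_inv, inv_mul_eq_iff_eq_mul] at h1
        rw [map_mul, map_mul, map_inv, map_inv, hhh', h1, map_mul, map_mul, map_inv, map_inv,
          ← mul_assoc (YuGroups.galMap σ _), ← inv_mul_eq_of_eq_mul hc]
        group
      have h2m : (0 : ℝ) < 2 * m := by linarith
      have hu' := hu.galMap h2m hgal
      have h4 := hu.mul h2m (hu'.inv h2m)
      convert! h4 using 1
      simp only [mul_inv_rev, inv_inv]
      rw [mul_assoc h⁻¹ y, ← mul_assoc y, ← mul_assoc y, mul_inv_cancel, one_mul, mul_assoc]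
    · rw [map_mul, map_mul, map_mul, map_mul, map_inv, map_inv, hhh', ← mul_assoc,
        mul_inv_cancel_right, mul_assoc, ← hc]

/-- Vanishing of the first cohomology of a tamely ramified extension with values in the
filtration subgroups of a torus. -/
theorem IsAlmostFixed.exists_fixed {E : IntermediateField F K} [FiniteDimensional F E]
    [IsGalois F E] (hE : IsTamelyRamified E) {g : GL (Fin n) K}
    (hg : g ∈ ratPoints (K := K) (n := n) E) {Γ : Subgroup (Fin n → Kˣ)}
    (hΓ : ∀ σ : K ≃ₐ[F] K, ∀ x ∈ satSubgroup Γ, ∃ x' ∈ satSubgroup Γ,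
      YuGroups.galMap σ (diagHom g x) = diagHom g x')
    {r : ℝ} (hr : 0 < r) {x : Fin n → Kˣ} (hxE : ∀ i, (x i : K) ∈ E)
    (hx : IsAlmostFixed F g (satSubgroup Γ) r x) :
    ∃ h ∈ satSubgroup Γ, (∀ i, (h i : K) ∈ E) ∧ IsCongrOne F r h ∧
      diagHom g (h⁻¹ * x) ∈ ratPoints (K := K) (n := n) F := by
  have : Algebra.IsAlgebraic F K := IsAlgClosure.isAlgebraic
  have hpos : ∀ k : ℕ, (0 : ℝ) < 2 ^ k * r := fun k => by positivity
  let Good : ℕ → (Fin n → Kˣ) → Prop := fun k h => h ∈ satSubgroup Γ ∧ (∀ i, (h i : K) ∈ E) ∧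
    IsCongrOne F r h ∧ IsAlmostFixed F g (satSubgroup Γ) (2 ^ k * r) (h⁻¹ * x)
  have hstep : ∀ k h, Good k h → ∃ h', Good (k + 1) h' ∧ IsCongrOne F (2 ^ k * r) (h' * h⁻¹) := by
    rintro k h ⟨h1, h2, h3, h4⟩
    obtain ⟨w, hw, hwE, hwm, hw'⟩ := h4.exists_next hE hg hΓ (hpos k) (fun i => by
      rw [Pi.mul_apply, Pi.inv_apply, Units.val_mul, Units.val_inv_eq_inv_val]
      exact mul_mem (inv_mem (h2 i)) (hxE i))
    refine ⟨h * w, ⟨mul_mem h1 hw, fun i => ?_, h3.mul hr (hwm.mono_le ?_), ?_⟩, ?_⟩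
    · rw [Pi.mul_apply, Units.val_mul]
      exact mul_mem (h2 i) (hwE i)
    · exact le_mul_of_one_le_left hr.le (one_le_pow₀ one_le_two)
    · rw [pow_succ', mul_assoc, mul_inv_rev, mul_assoc]
      exact hw'
    · rwa [mul_comm h w, mul_inv_cancel_right]
  choose! f hf1 hf2 using hstep
  obtain ⟨hs, hs0, hgood, hcong⟩ : ∃ hs : ℕ → Fin n → Kˣ, hs 0 = 1 ∧ (∀ k, Good k (hs k)) ∧
      ∀ k, IsCongrOne F (2 ^ k * r) (hs (k + 1) * (hs k)⁻¹) := by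
    have hgood : ∀ k : ℕ, Good k (Nat.rec 1 (fun k h => f k h) k) := by
      intro k
      induction k with
      | zero =>
        refine ⟨one_mem _, fun i => by simp, fun i => by simp, ?_⟩
        simpa using hx
      | succ k ih => exact hf1 k _ ih
    exact ⟨fun k => Nat.rec 1 (fun k h => f k h) k, rfl, hgood, fun k => hf2 k _ (hgood k)⟩
  have hval : ∀ (k : ℕ) (i : Fin n), val F ((hs k i : Kˣ) : K) = 0 := by
    intro k i
    have := (hgood k).2.2.1 i
    exact val_eq_zero_of_sub_one hr this
  have hlim : ∀ i, ∃ z ∈ E, ∀ k, ((2 ^ k * r : ℝ) : WithTop ℝ) ≤ val F (z - (hs k i : K)) := by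
    intro i
    refine exists_limit E (fun k => (hs k i : K)) (fun k => (hgood k).2.1 i)
      (fun k => 2 ^ k * r) ?_ ?_ ?_
    · exact monotone_nat_of_le_succ fun k => by
        rw [pow_succ]
        nlinarith [hpos k]
    · exact (tendsto_pow_atTop_atTop_of_one_lt one_lt_two).atTop_mul_const hr
    · intro k
      have h1 := hcong k i
      have h2 : (hs (k + 1) i : K) - hs k i = hs k i * (((hs (k + 1) * (hs k)⁻¹) i : Kˣ) - 1) := by
        rw [Pi.mul_apply, Pi.inv_apply, Units.val_mul, Units.val_inv_eq_inv_val]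
        field_simp
      rw [h2, val_mul, hval, zero_add]
      exact h1
  choose z hzE hz using hlim
  have hz1 : ∀ i, (r : WithTop ℝ) ≤ val F (z i - 1) := by
    intro i
    have := hz i 0
    simpa [hs0] using this
  have hz0 : ∀ i, z i ≠ 0 := fun i h => by
    have := val_eq_zero_of_sub_one hr (hz1 i)
    simp [h] at this
  let h : Fin n → Kˣ := fun i => Units.mk0 (z i) (hz0 i)
  have hh : ∀ k, IsCongrOne F (2 ^ k * r) (h * (hs k)⁻¹) := by
    intro k i
    have h2 : (((h * (hs k)⁻¹) i : Kˣ) : K) - 1 = (hs k i : K)⁻¹ * (z i - hs k i) := by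
      rw [Pi.mul_apply, Pi.inv_apply, Units.val_mul, Units.val_inv_eq_inv_val, mul_sub,
        inv_mul_cancel₀ (hs k i).ne_zero, mul_comm]
      rfl
    rw [h2, val_mul, val_inv_eq_zero (hval k i), zero_add]
    exact hz i k
  have hhΓ : h ∈ satSubgroup Γ := by
    intro j hj
    have h1 : ∀ k, mono j h = mono j (h * (hs k)⁻¹) := by
      intro k
      rw [map_mul, map_inv, (hgood k).1 j hj, inv_one, mul_one]
    have h2 : (fun _ : Fin 1 => mono j h) = 1 := by
      refine eq_of_forall_isCongrOne (F := F) hr fun k i => ?_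
      rw [h1 k]
      exact (hh k).mono (hpos k) j
    exact congrFun h2 0
  have hXE : diagHom g (h⁻¹ * x) ∈ ratPoints (K := K) (n := n) E := by
    rw [diagHom_mem_ratPoints hg]
    intro i
    rw [Pi.mul_apply, Pi.inv_apply, Units.val_mul, Units.val_inv_eq_inv_val]
    exact mul_mem (inv_mem (hzE i)) (hxE i)
  refine ⟨h, hhΓ, hzE, hz1, mem_ratPoints_of_galMap_eq hXE fun σ => ?_⟩
  obtain ⟨c₀, hc₀, -, hxc₀⟩ := hx σ
  obtain ⟨h', hh', hhh'⟩ := hΓ σ h hhΓ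
  have hX' : YuGroups.galMap σ (diagHom g (h⁻¹ * x)) = diagHom g (h'⁻¹ * (c₀⁻¹ * x)) := by
    rw [map_mul, map_mul, map_inv, map_inv, hhh', map_mul, map_mul, map_inv, map_inv,
      ← inv_mul_eq_of_eq_mul hxc₀]
  have hone : (h⁻¹ * x) * (h'⁻¹ * (c₀⁻¹ * x))⁻¹ = 1 := by
    refine eq_of_forall_isCongrOne (F := F) hr fun k => ?_
    obtain ⟨c, -, hc, hxc⟩ := (hgood k).2.2.2 σ
    obtain ⟨h₁, -, hh₁⟩ := hΓ σ _ (hgood k).1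
    have hgal : YuGroups.galMap σ (diagHom g (h * (hs k)⁻¹)) = diagHom g (h' * h₁⁻¹) := by
      simp only [map_mul, map_inv, hhh', hh₁]
    have hu' := (hh k).galMap (hpos k) hgal
    have hcc : c = (hs k)⁻¹ * x * (h₁⁻¹ * (c₀⁻¹ * x))⁻¹ := by
      apply diagHom_injective g
      rw [← mul_inv_eq_of_eq_mul hxc]
      simp only [map_mul, map_inv, hh₁, ← inv_mul_eq_of_eq_mul hxc₀]
    have h5 := (((hh k).inv (hpos k)).mul (hpos k) hu').mul (hpos k) hc
    convert! h5 using 1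
    rw [hcc]
    ext i
    simp only [Pi.mul_apply, Pi.inv_apply, Units.val_mul, Units.val_inv_eq_inv_val]
    field_simp
  rw [hX', mul_inv_eq_one.1 hone]

end Descent

section Levi

variable {K : Type*} [Field K] {n : ℕ}

/-- The `i`-th diagonal entry with respect to the basis given by `g`, as a polynomial. -/
def entryPoly (g : GL (Fin n) K) (i j : Fin n) : MvPolynomial (Fin n × Fin n) K :=
  ∑ k, ∑ l, MvPolynomial.C ((g : Matrix (Fin n) (Fin n) K) i l *
    ((g⁻¹ : GL (Fin n) K) : Matrix (Fin n) (Fin n) K) k j) * MvPolynomial.X (l, k)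

theorem eval_entryPoly (g x : GL (Fin n) K) (i j : Fin n) :
    MvPolynomial.eval (coords x) (entryPoly g i j) =
      ((g * x * g⁻¹ : GL (Fin n) K) : Matrix (Fin n) (Fin n) K) i j := by
  simp only [entryPoly, Units.val_mul, Matrix.mul_apply, map_sum, map_mul, MvPolynomial.eval_C,
    MvPolynomial.eval_X, coords, Finset.sum_mul]
  refine Finset.sum_congr rfl fun k _ => Finset.sum_congr rfl fun l _ => ?_
  ring

/-- Simultaneous diagonalization. -/
theorem exists_isDiag_of_commute {A : Set (GL (Fin n) K)}
    (hA : ∀ a ∈ A, ∀ b ∈ A, a * b = b * a)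
    (hdiag : ∀ a ∈ A, ∃ g : GL (Fin n) K,
      ((g * a * g⁻¹ : GL (Fin n) K) : Matrix (Fin n) (Fin n) K).IsDiag) :
    ∃ g : GL (Fin n) K, ∀ a ∈ A,
      ((g * a * g⁻¹ : GL (Fin n) K) : Matrix (Fin n) (Fin n) K).IsDiag := by
  classical
  let f : A → Module.End K (Fin n → K) := fun a =>
    Matrix.toLin' ((a : GL (Fin n) K) : Matrix (Fin n) (Fin n) K)
  -- coordinates in which `a` is diagonal
  have hcoord : ∀ a : A, ∃ (e : (Fin n → K) ≃ₗ[K] (Fin n → K)) (d : Fin n → K),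
      ∀ v i, e (f a v) i = d i * e v i := by
    intro a
    obtain ⟨g, hg⟩ := hdiag a a.2
    refine ⟨Matrix.toLin'OfInv (M := ((g⁻¹ : GL (Fin n) K) : Matrix (Fin n) (Fin n) K))
      (M' := (g : Matrix (Fin n) (Fin n) K)) (by simp) (by simp), Matrix.diag
        ((g * a * g⁻¹ : GL (Fin n) K) : Matrix (Fin n) (Fin n) K), fun v i => ?_⟩
    have h1 : (g : Matrix (Fin n) (Fin n) K) * ((a : GL (Fin n) K) : Matrix (Fin n) (Fin n) K) =
        Matrix.diagonal (Matrix.diag ((g * a * g⁻¹ : GL (Fin n) K) : Matrix (Fin n) (Fin n) K)) *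
          (g : Matrix (Fin n) (Fin n) K) := by
      rw [hg.diagonal_diag, ← Units.val_mul, ← Units.val_mul, inv_mul_cancel_right]
    simp only [Matrix.toLin'OfInv_apply, f]
    rw [Matrix.toLin'_apply, Matrix.toLin'_apply, Matrix.toLin'_apply, Matrix.mulVec_mulVec, h1,
      ← Matrix.mulVec_mulVec, Matrix.mulVec_diagonal]
  have hgen : ∀ (a : A) (μ : K) (v : Fin n → K), v ∈ (f a).maxGenEigenspace μ →
      f a v = μ • v := by
    intro a μ v hv
    obtain ⟨e, d, hd⟩ := hcoord a
    obtain ⟨k, hk⟩ := (Module.End.mem_maxGenEigenspace (f a) μ v).1 hv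
    have h1 : ∀ (k : ℕ) (i : Fin n), e (((f a - μ • 1) ^ k) v) i = (d i - μ) ^ k * e v i := by
      intro k i
      induction k with
      | zero => simp
      | succ k ih =>
        rw [pow_succ', Module.End.mul_apply, LinearMap.sub_apply, map_sub, Pi.sub_apply, hd,
          LinearMap.smul_apply, Module.End.one_apply, map_smul, Pi.smul_apply, smul_eq_mul,
          ← sub_mul, ih, pow_succ']
        ring
    apply e.injective
    ext i
    have h2 := h1 k i
    rw [hk, map_zero, Pi.zero_apply] at h2
    rw [hd, map_smul, Pi.smul_apply, smul_eq_mul]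
    rcases mul_eq_zero.1 h2.symm with h | h
    · rw [sub_eq_zero.1 (eq_zero_of_pow_eq_zero h)]
    · rw [h, mul_zero, mul_zero]
  have htop : ∀ a : A, ⨆ μ, (f a).maxGenEigenspace μ = ⊤ := by
    intro a
    obtain ⟨e, d, hd⟩ := hcoord a
    rw [eq_top_iff]
    intro v _
    have hv : v = ∑ i, e.symm (Pi.single i (e v i)) := by
      rw [← map_sum, Finset.univ_sum_single, LinearEquiv.symm_apply_apply]
    rw [hv]
    refine Submodule.sum_mem _ fun i _ => ?_
    refine Submodule.mem_iSup_of_mem (d i) ?_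
    refine (Module.End.mem_maxGenEigenspace _ _ _).2 ⟨1, ?_⟩
    rw [pow_one, LinearMap.sub_apply, sub_eq_zero, LinearMap.smul_apply, Module.End.one_apply]
    apply e.injective
    ext j
    rw [hd, map_smul, LinearEquiv.apply_symm_apply, Pi.smul_apply, smul_eq_mul]
    by_cases hij : j = i
    · rw [hij]
    · simp [hij]
  have hcomm : Pairwise fun a b => Commute (f a) (f b) := by
    intro a b _
    change f a * f b = f b * f a
    simp only [f, Module.End.mul_eq_comp, ← Matrix.toLin'_mul, ← Units.val_mul, hA a a.2 b b.2]
  have hspan := Module.End.iSup_iInf_maxGenEigenspace_eq_top_of_iSup_maxGenEigenspace_eq_top_of_commute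
    f hcomm htop
  let X : Set (Fin n → K) := {v | ∀ a : A, ∃ μ : K, f a v = μ • v}
  have hX : Submodule.span K X = ⊤ := by
    rw [eq_top_iff, ← hspan]
    refine iSup_le fun χ v hv => Submodule.subset_span fun a => ⟨χ a, hgen a _ v ?_⟩
    exact (Submodule.mem_iInf _).1 hv a
  let b₀ := Module.Basis.ofSpan hX.ge
  let b := b₀.reindex (b₀.indexEquiv (Pi.basisFun K (Fin n)))
  have hb : ∀ i, b i ∈ X := by
    intro i
    rw [Module.Basis.reindex_apply]
    exact Module.Basis.ofSpan_subset hX.ge ⟨_, rfl⟩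
  refine ⟨⟨b.toMatrix (Pi.basisFun K (Fin n)), (Pi.basisFun K (Fin n)).toMatrix b,
    Module.Basis.toMatrix_mul_toMatrix_flip _ _, Module.Basis.toMatrix_mul_toMatrix_flip _ _⟩,
    fun a ha => ?_⟩
  choose μ hμ using fun i => hb i ⟨a, ha⟩
  have h1 : (a : Matrix (Fin n) (Fin n) K) * (Pi.basisFun K (Fin n)).toMatrix b =
      (Pi.basisFun K (Fin n)).toMatrix b * Matrix.diagonal μ := by
    ext i j
    rw [Matrix.mul_diagonal]
    have h2 := congrFun (hμ j) i
    simp only [f, Matrix.toLin'_apply, Pi.smul_apply, smul_eq_mul] at h2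
    rw [Matrix.mul_apply, Module.Basis.toMatrix_apply, Pi.basisFun_repr, mul_comm, ← h2]
    rfl
  rw [Units.val_mul, Units.val_mul, mul_assoc]
  change (b.toMatrix (Pi.basisFun K (Fin n)) * ((a : Matrix (Fin n) (Fin n) K) *
    (Pi.basisFun K (Fin n)).toMatrix b)).IsDiag
  rw [h1, ← mul_assoc, Module.Basis.toMatrix_mul_toMatrix_flip, one_mul]
  exact Matrix.isDiag_diagonal μ

theorem continuous_mul_left (a : GL (Fin n) K) :
    @Continuous _ _ (zariskiTopology K n) (zariskiTopology K n) fun x => a * x := by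
  let _ := zariskiTopology K n
  refine continuous_generateFrom_iff.2 ?_
  rintro _ ⟨f, rfl⟩
  obtain ⟨f', hf'⟩ := exists_eval_mul (a : Matrix (Fin n) (Fin n) K) 1 f
  refine TopologicalSpace.isOpen_generateFrom_of_mem ⟨f', ?_⟩
  ext x
  have := hf' (x : Matrix (Fin n) (Fin n) K)
  rw [mul_one] at this
  exact not_congr (by rw [← Units.val_mul] at this; exact ⟨fun h => this.trans h, fun h => this.symm.trans h⟩)

/-- The closed subgroup of diagonal matrices defined by a set of monomials. -/
theorem isZariskiClosed_map_diagHom (g : GL (Fin n) K) {Γ : Subgroup (Fin n → Kˣ)}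
    (R : Set (Fin n → ℤ)) (hΓ : ∀ x, x ∈ Γ ↔ ∀ k ∈ R, mono k x = 1) :
    IsZariskiClosed ((Γ.map (diagHom g) : Subgroup (GL (Fin n) K)) : Set (GL (Fin n) K)) := by
  let f : {ij : Fin n × Fin n // ij.1 ≠ ij.2} ⊕ R → MvPolynomial (Fin n × Fin n) K :=
    Sum.elim (fun ij => entryPoly g ij.1.1 ij.1.2)
      fun k => ∏ i, entryPoly g i i ^ (k.1 i).toNat - ∏ i, entryPoly g i i ^ (-(k.1 i)).toNat
  have hmono : ∀ (k : Fin n → ℤ) (x : Fin n → Kˣ), mono k x = 1 ↔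
      ∏ i, (x i : K) ^ (k i).toNat - ∏ i, (x i : K) ^ (-(k i)).toNat = 0 := by
    intro k x
    have h1 : k = (fun i => ((k i).toNat : ℤ)) - fun i => ((-(k i)).toNat : ℤ) := by
      ext i
      simp only [Pi.sub_apply]
      omega
    conv_lhs => rw [h1]
    rw [mono_sub, div_eq_one, sub_eq_zero, ← Units.val_inj]
    simp only [mono_apply, zpow_natCast, Units.coe_prod, Units.val_pow_eq_pow_val]
  refine isZariskiClosed_of_forall f fun t => ⟨?_, fun h => ?_⟩
  · rintro ⟨x, hx, rfl⟩ (⟨ij, hij⟩ | ⟨k, hk⟩)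
    · simp only [f, Sum.elim_inl, eval_entryPoly, coe_conj_diagHom]
      exact Matrix.diagonal_apply_ne _ hij
    · simp only [f, Sum.elim_inr, map_sub, map_prod, map_pow, eval_entryPoly, coe_conj_diagHom,
        Matrix.diagonal_apply_eq]
      exact (hmono k x).1 ((hΓ x).1 hx k hk)
  · obtain ⟨x, rfl⟩ := exists_diagHom_eq (g := g) (t := t) (by
      intro i j hij
      have := h (Sum.inl ⟨(i, j), hij⟩)
      simpa only [f, Sum.elim_inl, eval_entryPoly] using this)
    refine ⟨x, (hΓ x).2 fun k hk => (hmono k x).2 ?_, rfl⟩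
    have := h (Sum.inr ⟨k, hk⟩)
    simpa only [f, Sum.elim_inr, map_sub, map_prod, map_pow, eval_entryPoly, coe_conj_diagHom,
        Matrix.diagonal_apply_eq] using this

theorem IsSplitTorus.commute {k : Type*} [Field k] [Algebra k K] {S : Subgroup (GL (Fin n) K)}
    (hS : IsSplitTorus k S) {s t : GL (Fin n) K} (hs : s ∈ S) (ht : t ∈ S) : s * t = t * s := by
  obtain ⟨g, -, hg⟩ := hS.diagonalizable
  obtain ⟨x, rfl⟩ := exists_diagHom_eq (hg s hs)
  obtain ⟨y, rfl⟩ := exists_diagHom_eq (hg t ht)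
  rw [← map_mul, ← map_mul, mul_comm]

/-- A torus of `L` which commutes with the maximal torus `T` is contained in `T`. -/
theorem IsMaximalTorus.le_of_commute {L T S : Subgroup (GL (Fin n) K)} (hT : IsMaximalTorus L T)
    (hL : IsZariskiClosed (L : Set (GL (Fin n) K))) {k : Type*} [Field k] [Algebra k K]
    (hS : IsSplitTorus k S) (hSL : S ≤ L) (hST : ∀ s ∈ S, ∀ t ∈ T, s * t = t * s) : S ≤ T := by
  obtain ⟨⟨hTt, hTL⟩, hmax⟩ := hT
  let M : Subgroup (GL (Fin n) K) :=
    { carrier := {x | ∃ s ∈ S, ∃ t ∈ T, x = s * t}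
      one_mem' := ⟨1, one_mem S, 1, one_mem T, (mul_one 1).symm⟩
      mul_mem' := by
        rintro _ _ ⟨s, hs, t, ht, rfl⟩ ⟨s', hs', t', ht', rfl⟩
        refine ⟨s * s', mul_mem hs hs', t * t', mul_mem ht ht', ?_⟩
        rw [mul_assoc, ← mul_assoc t, ← hST s' hs' t ht]
        group
      inv_mem' := by
        rintro _ ⟨s, hs, t, ht, rfl⟩
        refine ⟨s⁻¹, inv_mem hs, t⁻¹, inv_mem ht, ?_⟩
        rw [hST s hs t ht, mul_inv_rev] }
  have hSM : S ≤ M := fun s hs => ⟨s, hs, 1, one_mem T, (mul_one s).symm⟩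
  have hTM : T ≤ M := fun t ht => ⟨1, one_mem S, t, ht, (one_mul t).symm⟩
  have hML : M ≤ L := by
    rintro _ ⟨s, hs, t, ht, rfl⟩
    exact mul_mem (hSL hs) (hTL ht)
  obtain ⟨g, hg⟩ := exists_isDiag_of_commute (A := (S : Set (GL (Fin n) K)) ∪ T) (by
      rintro a (ha | ha) b (hb | hb)
      · exact hS.commute ha hb
      · exact hST a ha b hb
      · exact (hST b hb a ha).symm
      · exact hTt.commute ha hb) (by
      rintro a (ha | ha)
      · obtain ⟨g, -, hg⟩ := hS.diagonalizable
        exact ⟨g, hg a ha⟩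
      · obtain ⟨g, -, hg⟩ := hTt.diagonalizable
        exact ⟨g, hg a ha⟩)
  have hMg : M ≤ (diagHom g).range := by
    rintro _ ⟨s, hs, t, ht, rfl⟩
    exact mul_mem (exists_diagHom_eq (hg s (Or.inl hs))) (exists_diagHom_eq (hg t (Or.inr ht)))
  -- the closure of `M`
  let Γ : Subgroup (Fin n → Kˣ) :=
    { carrier := {x | ∀ k ∈ relations (M.comap (diagHom g)), mono k x = 1}
      one_mem' := fun k _ => map_one _
      mul_mem' := fun hx hy k hk => by rw [map_mul, hx k hk, hy k hk, one_mul]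
      inv_mem' := fun hx k hk => by rw [map_inv, hx k hk, inv_one] }
  have hMΓ : M ≤ Γ.map (diagHom g) := by
    intro m hm
    obtain ⟨x, rfl⟩ := hMg hm
    exact ⟨x, fun k hk => hk x hm, rfl⟩
  have hΓtorus : IsSplitTorus K (Γ.map (diagHom g)) := by
    refine ⟨isZariskiClosed_map_diagHom g _ fun x => Iff.rfl, ?_, g, ?_, ?_⟩
    · let _ := zariskiTopology K n
      refine ⟨⟨1, one_mem _⟩, ?_⟩
      have hpre : IsPreconnected (M : Set (GL (Fin n) K)) := by
        refine isPreconnected_of_forall 1 ?_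
        rintro _ ⟨s, hs, t, ht, rfl⟩
        refine ⟨(S : Set (GL (Fin n) K)) ∪ (fun x => s * x) '' T, ?_, Or.inl (one_mem S),
          Or.inr ⟨t, ht, rfl⟩, ?_⟩
        · rintro x (hx | ⟨t', ht', rfl⟩)
          · exact hSM hx
          · exact ⟨s, hs, t', ht', rfl⟩
        · refine IsPreconnected.union s hs ⟨1, one_mem T, mul_one s⟩ hS.connected.isPreconnected ?_
          exact hTt.connected.isPreconnected.image _ (continuous_mul_left s).continuousOn
      refine hpre.subset_closure hMΓ ?_
      rintro _ ⟨x, hx, rfl⟩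
      by_contra hcon
      obtain ⟨f, hf, hfx⟩ := isZariskiClosed_iff.1
        (show IsZariskiClosed (closure (M : Set (GL (Fin n) K))) from isClosed_closure) _ hcon
      obtain ⟨Q, hQ⟩ := exists_eval_diagHom g f
      rw [hQ] at hfx
      refine hfx (eval_eq_zero_of_relations (Γ := M.comap (diagHom g)) (fun y hy => ?_) hx)
      rw [← hQ]
      exact hf _ (subset_closure hy)
    · exact ⟨g, by ext; rfl⟩
    · rintro _ ⟨x, -, rfl⟩
      rw [coe_conj_diagHom]
      exact Matrix.isDiag_diagonal _
  have hΓL : Γ.map (diagHom g) ≤ L := by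
    rintro _ ⟨x, hx, rfl⟩
    exact diagHom_mem_of_relations hL g fun k hk => hx k fun y hy => hk y (hML hy)
  exact (hSM.trans hMΓ).trans (hmax ⟨hΓtorus, hΓL⟩ (hTM.trans hMΓ))

theorem isZariskiClosed_centralizer (S : Set (GL (Fin n) K)) :
    IsZariskiClosed (Subgroup.centralizer S : Set (GL (Fin n) K)) := by
  refine isZariskiClosed_of_forall (ι := S × Fin n × Fin n) (fun p =>
    ∑ k, MvPolynomial.C ((p.1 : GL (Fin n) K) p.2.1 k) * MvPolynomial.X (k, p.2.2) -
      ∑ k, MvPolynomial.X (p.2.1, k) * MvPolynomial.C ((p.1 : GL (Fin n) K) k p.2.2)) fun x => ?_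
  rw [SetLike.mem_coe, Subgroup.mem_centralizer_iff]
  simp only [map_sub, map_sum, map_mul, MvPolynomial.eval_C, MvPolynomial.eval_X, coords,
    sub_eq_zero, ← Matrix.mul_apply, Prod.forall, Subtype.forall]
  refine forall₂_congr fun s hs => ?_
  rw [← Units.val_inj, ← Matrix.ext_iff]
  rfl

theorem IsLevi.isZariskiClosed {k : Type*} [Field k] [Algebra k K] {G L : Subgroup (GL (Fin n) K)}
    (hG : IsZariskiClosed (G : Set (GL (Fin n) K))) (hL : IsLevi k G L) :
    IsZariskiClosed (L : Set (GL (Fin n) K)) := by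
  obtain ⟨S, -, -, rfl⟩ := hL
  exact hG.inter (isZariskiClosed_centralizer _)

/-- In a twisted Levi sequence every `G^i` is the centralizer of a subgroup of `T`. -/
theorem IsTwistedLeviSequence.exists_eq_centralizer {F E : Type*} [Field F] [Algebra F K]
    [Field E] [Algebra E K] {G : Subgroup (GL (Fin n) K)} {d : ℕ}
    {Gs : Fin (d + 1) → Subgroup (GL (Fin n) K)} (hGs : IsTwistedLeviSequence F E G Gs)
    (hG : IsZariskiClosed (G : Set (GL (Fin n) K))) {T : Subgroup (GL (Fin n) K)}
    (hT : IsMaximalTorus (Gs 0) T) (i : Fin (d + 1)) :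
    ∃ S ≤ T, Gs i = G ⊓ Subgroup.centralizer (S : Set (GL (Fin n) K)) := by
  have hclosed := (hGs.levi 0).isZariskiClosed hG
  have hT0 : T ≤ Gs 0 := hT.1.2
  obtain ⟨S₀, hS₀, hS₀G, h0⟩ := hGs.levi 0
  have hS₀T : S₀ ≤ T := by
    refine hT.le_of_commute hclosed hS₀ ?_ fun s hs t ht => ?_
    · rw [h0]
      exact fun s hs => ⟨hS₀G hs, Subgroup.mem_centralizer_iff.2 fun t ht => hS₀.commute ht hs⟩
    · have := hT0 ht
      rw [h0] at this
      exact Subgroup.mem_centralizer_iff.1 this.2 s hs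
  obtain ⟨S, hS, hSG, hi⟩ := hGs.levi i
  have hST : ∀ s ∈ S, ∀ t ∈ T, s * t = t * s := by
    intro s hs t ht
    have := hGs.mono (Fin.zero_le i) (hT0 ht)
    rw [hi] at this
    exact Subgroup.mem_centralizer_iff.1 this.2 s hs
  refine ⟨S, hT.le_of_commute hclosed hS ?_ hST, hi⟩
  rw [h0]
  exact fun s hs => ⟨hSG hs, Subgroup.mem_centralizer_iff.2 fun t ht =>
    (hST s hs t (hS₀T ht)).symm⟩

end Levi

section Roots

variable {K : Type*} [Field K] {n : ℕ}

/-- The chain rule for a polynomial curve. -/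
theorem derivative_aeval {ι R : Type*} [Fintype ι] [CommRing R] (p : ι → Polynomial R)
    (f : MvPolynomial ι R) :
    Polynomial.derivative (MvPolynomial.aeval p f) =
      ∑ i, Polynomial.derivative (p i) * MvPolynomial.aeval p (MvPolynomial.pderiv i f) := by
  classical
  induction f using MvPolynomial.induction_on with
  | C a => simp [Polynomial.algebraMap_eq]
  | add f f' hf hf' => simp only [map_add, hf, hf', mul_add, Finset.sum_add_distrib]
  | mul_X f j hf =>
    simp only [map_mul, MvPolynomial.aeval_X, Polynomial.derivative_mul, hf, Derivation.leibniz,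
      smul_eq_mul, MvPolynomial.pderiv_X, map_add, mul_add, Finset.sum_add_distrib]
    rw [add_comm, Finset.sum_mul]
    congr 1
    · rw [Finset.sum_eq_single j]
      · simp [mul_comm]
      · intro i _ hij
        simp [Pi.single_eq_of_ne' hij]
      · simp
    · exact Finset.sum_congr rfl fun i _ => by ring

theorem lieAlg_mono {L G : Subgroup (GL (Fin n) K)} (h : L ≤ G) : lieAlg L ⊆ lieAlg G :=
  fun _ hX f hf => hX f fun g hg => hf g (h hg)

theorem roots_mono {L G : Subgroup (GL (Fin n) K)} (h : L ≤ G) (T : Subgroup (GL (Fin n) K)) :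
    roots L T ⊆ roots G T :=
  fun _ ⟨ha, ha1, X, hX, hX0, hXa⟩ => ⟨ha, ha1, X, lieAlg_mono h hX, hX0, hXa⟩

/-- Linear equations satisfied by a group are satisfied by its Lie algebra. -/
theorem sum_eq_zero_of_mem_lieAlg {L : Subgroup (GL (Fin n) K)} {c : Fin n × Fin n → K}
    (hc : ∀ x ∈ L, ∑ ij, c ij * coords x ij = 0) {X : Matrix (Fin n) (Fin n) K}
    (hX : X ∈ lieAlg L) : ∑ ij, c ij * X ij.1 ij.2 = 0 := by
  classical
  have h := hX (∑ ij, MvPolynomial.C (c ij) * MvPolynomial.X ij) fun x hx => by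
    simpa using hc x hx
  rw [← h]
  refine Finset.sum_congr rfl fun ij _ => ?_
  rw [mul_comm]
  congr 1
  rw [map_sum, map_sum, Finset.sum_eq_single ij]
  · simp [MvPolynomial.pderiv_X]
  · intro kl _ hkl
    simp [MvPolynomial.pderiv_X, Pi.single_eq_of_ne hkl]
  · simp

/-- The Lie algebra of a group commuting with `s` commutes with `s`. -/
theorem commute_of_mem_lieAlg {L : Subgroup (GL (Fin n) K)} {s : GL (Fin n) K}
    (hs : ∀ x ∈ L, s * x = x * s) {X : Matrix (Fin n) (Fin n) K} (hX : X ∈ lieAlg L) :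
    (s : Matrix (Fin n) (Fin n) K) * X = X * s := by
  classical
  have key : ∀ (Y : Matrix (Fin n) (Fin n) K) (i j : Fin n),
      ∑ kl : Fin n × Fin n, ((if kl.2 = j then (s : Matrix (Fin n) (Fin n) K) i kl.1 else 0) -
        (if kl.1 = i then (s : Matrix (Fin n) (Fin n) K) kl.2 j else 0)) * Y kl.1 kl.2 =
      ((s : Matrix (Fin n) (Fin n) K) * Y) i j - (Y * s) i j := by
    intro Y i j
    simp only [sub_mul, Finset.sum_sub_distrib, ite_mul, zero_mul]
    congr 1
    · rw [Fintype.sum_prod_type, Matrix.mul_apply]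
      simp
    · rw [Fintype.sum_prod_type_right, Matrix.mul_apply]
      simp [mul_comm]
  ext i j
  rw [← sub_eq_zero, ← key]
  refine sum_eq_zero_of_mem_lieAlg (fun x hx => ?_) hX
  have := key (x : Matrix (Fin n) (Fin n) K) i j
  rw [← Units.val_mul, ← Units.val_mul, hs x hx, sub_self] at this
  exact this

/-- Every root is the quotient of two diagonal entries. -/
theorem exists_root_eq {G T : Subgroup (GL (Fin n) K)} (g : GL (Fin n) K) {a : T →* Kˣ}
    (ha : a ∈ roots G T) :
    ∃ i j : Fin n, ∀ (x : Fin n → Kˣ) (hx : diagHom g x ∈ T),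
      a ⟨_, hx⟩ = mono (Pi.single i 1 - Pi.single j 1) x := by
  obtain ⟨-, -, X, -, hX0, hX⟩ := ha
  let Y := (g : Matrix (Fin n) (Fin n) K) * X * ((g⁻¹ : GL (Fin n) K) : Matrix (Fin n) (Fin n) K)
  have hY : Y ≠ 0 := by
    intro h
    apply hX0
    have : ((g⁻¹ : GL (Fin n) K) : Matrix (Fin n) (Fin n) K) * Y * g = X := by
      simp only [Y]
      rw [mul_assoc, mul_assoc, mul_assoc, ← Units.val_mul, inv_mul_cancel, Units.val_one, mul_one,
        ← mul_assoc, ← Units.val_mul, inv_mul_cancel, Units.val_one, one_mul]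
    rw [← this, h, mul_zero, zero_mul]
  obtain ⟨i, j, hij⟩ : ∃ i j, Y i j ≠ 0 := by
    by_contra! h
    exact hY (by ext i j; exact h i j)
  refine ⟨i, j, fun x hx => ?_⟩
  have h1 : Matrix.diagonal (fun i => (x i : K)) * Y =
      (a ⟨_, hx⟩ : K) • Y * Matrix.diagonal (fun i => (x i : K)) := by
    rw [← coe_conj_diagHom g]
    have h2 := hX ⟨_, hx⟩
    simp only [Y, Units.val_mul] at h2 ⊢
    have h3 : ((diagHom g x : GL (Fin n) K) : Matrix (Fin n) (Fin n) K) * X =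
        ((a ⟨_, hx⟩ : K) • X) * (diagHom g x : GL (Fin n) K) := by
      rw [← h2, mul_assoc _ _ ((diagHom g x : GL (Fin n) K) : Matrix (Fin n) (Fin n) K),
        ← Units.val_mul, inv_mul_cancel, Units.val_one, mul_one]
    have h4 : ((g⁻¹ : GL (Fin n) K) : Matrix (Fin n) (Fin n) K) * g = 1 := by
      rw [← Units.val_mul, inv_mul_cancel, Units.val_one]
    calc _ = (g : Matrix (Fin n) (Fin n) K) * (diagHom g x : GL (Fin n) K) *
          (((g⁻¹ : GL (Fin n) K) : Matrix (Fin n) (Fin n) K) * g) * X *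
            ((g⁻¹ : GL (Fin n) K) : Matrix (Fin n) (Fin n) K) := by simp only [mul_assoc]
      _ = (g : Matrix (Fin n) (Fin n) K) * ((diagHom g x : GL (Fin n) K) * X) *
            ((g⁻¹ : GL (Fin n) K) : Matrix (Fin n) (Fin n) K) := by
          rw [h4, mul_one]; simp only [mul_assoc]
      _ = (a ⟨_, hx⟩ : K) • ((g : Matrix (Fin n) (Fin n) K) * X *
          (((g⁻¹ : GL (Fin n) K) : Matrix (Fin n) (Fin n) K) * g) * (diagHom g x : GL (Fin n) K) *
            ((g⁻¹ : GL (Fin n) K) : Matrix (Fin n) (Fin n) K)) := by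
          rw [h3, h4, mul_one]; simp only [mul_assoc, smul_mul_assoc, mul_smul_comm]
      _ = _ := by simp only [mul_assoc, smul_mul_assoc]
  have h2 := congrFun (congrFun h1 i) j
  rw [Matrix.diagonal_mul, Matrix.mul_diagonal, Matrix.smul_apply, smul_eq_mul] at h2
  rw [mono_sub, mono_single, mono_single, eq_div_iff_mul_eq', ← Units.val_inj, Units.val_mul]
  apply mul_right_cancel₀ hij
  rw [h2]
  ring

section Realization

variable {k : Type*} [Field k] [Algebra k K] {G T : Subgroup (GL (Fin n) K)}
  {u : (T →* Kˣ) → K → GL (Fin n) K}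

theorem IsRealization.injective (hu : IsRealization k G T u) {a : T →* Kˣ} (ha : a ∈ roots G T) :
    Function.Injective (u a) := by
  obtain ⟨f, hf⟩ := hu.regular_inv a ha
  intro c d h
  rw [← hf c, h, hf d]

theorem IsRealization.map_zero (hu : IsRealization k G T u) {a : T →* Kˣ} (ha : a ∈ roots G T) :
    u a 0 = 1 := by
  have := hu.map_add a ha 0 0
  rwa [add_zero, left_eq_mul] at this

theorem IsRealization.map_neg (hu : IsRealization k G T u) {a : T →* Kˣ} (ha : a ∈ roots G T)
    (c : K) : u a (-c) = (u a c)⁻¹ := by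
  rw [eq_inv_iff_mul_eq_one, ← hu.map_add a ha, neg_add_cancel, hu.map_zero ha]

/-- A root whose root subgroup lies in `L` is a root of `L`. -/
theorem IsRealization.mem_roots_of_forall_mem [Infinite K] (hu : IsRealization k G T u)
    {a : T →* Kˣ} (ha : a ∈ roots G T) {L : Subgroup (GL (Fin n) K)} (hL : ∀ c, u a c ∈ L) :
    a ∈ roots L T := by
  choose p₀ hp₀ using hu.regular a ha
  let p : Fin n × Fin n → Polynomial K := fun ij =>
    (p₀ ij.1 ij.2).map (algebraMap k K)
  have hp : ∀ c, (fun ij => (p ij).eval c) = coords (u a c) := by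
    intro c
    ext ij
    simp [p, coords, hp₀, Polynomial.aeval_def, Polynomial.eval_map]
  have heval : ∀ (f : MvPolynomial (Fin n × Fin n) K) (c : K),
      (MvPolynomial.aeval p f).eval c = MvPolynomial.eval (coords (u a c)) f := by
    intro f c
    rw [← hp, ← MvPolynomial.coe_aeval_eq_eval, ← Polynomial.coe_aeval_eq_eval]
    change ((Polynomial.aeval c).comp (MvPolynomial.aeval p)) f = MvPolynomial.aeval _ f
    rw [MvPolynomial.comp_aeval]
  have hone : coords (1 : GL (Fin n) K) = coords (u a 0) := by rw [hu.map_zero ha]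
  let X : Matrix (Fin n) (Fin n) K := fun i j => (Polynomial.derivative (p (i, j))).eval 0
  have hchain : ∀ f : MvPolynomial (Fin n × Fin n) K,
      (Polynomial.derivative (MvPolynomial.aeval p f)).eval 0 = ∑ ij : Fin n × Fin n,
        X ij.1 ij.2 * MvPolynomial.eval (coords (1 : GL (Fin n) K)) (MvPolynomial.pderiv ij f) := by
    intro f
    rw [derivative_aeval, Polynomial.eval_finsetSum]
    refine Finset.sum_congr rfl fun ij _ => ?_
    rw [Polynomial.eval_mul, heval, hone]
  refine ⟨ha.1, ha.2.1, X, fun f hf => ?_, fun hX0 => ?_, fun t => ?_⟩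
  · rw [← hchain]
    have : MvPolynomial.aeval p f = 0 := Polynomial.funext fun c => by
      rw [heval, hf _ (hL c), Polynomial.eval_zero]
    rw [this, _root_.map_zero, Polynomial.eval_zero]
  · obtain ⟨f, hf⟩ := hu.regular_inv a ha
    have : MvPolynomial.aeval p (MvPolynomial.map (algebraMap k K) f) = Polynomial.X :=
      Polynomial.funext fun c => by
        rw [heval, MvPolynomial.eval_map, Polynomial.eval_X]
        exact hf c
    have h := hchain (MvPolynomial.map (algebraMap k K) f)
    rw [this, hX0] at h
    simp at h
  · have h1 : ∀ i j, ∑ q, (∑ m, Polynomial.C ((t : GL (Fin n) K) i m) * p (m, q)) *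
        Polynomial.C (((t : GL (Fin n) K)⁻¹ : GL (Fin n) K) q j) =
        (p (i, j)).comp (Polynomial.C (a t : K) * Polynomial.X) := by
      intro i j
      refine Polynomial.funext fun c => ?_
      have h2 := congrArg (fun x : GL (Fin n) K => (x : Matrix (Fin n) (Fin n) K) i j)
        (hu.torus_conj a ha t c)
      simp only [Units.val_mul, Matrix.mul_apply] at h2
      have h3 : ∀ c i j, (p (i, j)).eval c = (u a c : Matrix (Fin n) (Fin n) K) i j :=
        fun c i j => congrFun (hp c) (i, j)
      simp only [Polynomial.eval_finsetSum, Polynomial.eval_mul, Polynomial.eval_C,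
        Polynomial.eval_comp, Polynomial.eval_X, h3]
      exact h2
    ext i j
    have h2 := congrArg (fun q => (Polynomial.derivative q).eval 0) (h1 i j)
    simp only [Polynomial.derivative_comp, Polynomial.derivative_sum, Polynomial.derivative_mul,
      Polynomial.derivative_C, Polynomial.eval_finsetSum, Polynomial.eval_mul, Polynomial.eval_C,
      zero_mul, zero_add, mul_zero, add_zero, Polynomial.eval_comp, Polynomial.eval_X,
      Polynomial.derivative_X, mul_one] at h2
    simp only [Matrix.mul_apply, Matrix.smul_apply, smul_eq_mul]
    exact h2

/-- The roots of the centralizer of a subgroup of `T`. -/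
theorem IsRealization.mem_roots_centralizer [Infinite K] (hu : IsRealization k G T u)
    {L S : Subgroup (GL (Fin n) K)} (hST : S ≤ T)
    (hL : L = G ⊓ Subgroup.centralizer (S : Set (GL (Fin n) K))) {a : T →* Kˣ} :
    a ∈ roots L T ↔ a ∈ roots G T ∧ ∀ s (hs : s ∈ S), a ⟨s, hST hs⟩ = 1 := by
  constructor
  · intro ha
    refine ⟨roots_mono (hL.trans_le inf_le_left) T ha, fun s hs => ?_⟩
    obtain ⟨-, -, X, hX, hX0, hXa⟩ := ha
    have h1 := commute_of_mem_lieAlg (s := s) (fun x hx => by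
      rw [hL] at hx
      exact Subgroup.mem_centralizer_iff.1 hx.2 s hs) hX
    have h2 := hXa ⟨s, hST hs⟩
    rw [h1, mul_assoc, ← Units.val_mul, mul_inv_cancel, Units.val_one, mul_one] at h2
    have h3 : ((a ⟨s, hST hs⟩ : K) - 1) • X = 0 := by rw [sub_smul, one_smul, ← h2, sub_self]
    rw [← Units.val_inj, Units.val_one, ← sub_eq_zero]
    exact (smul_eq_zero.1 h3).resolve_right hX0
  · rintro ⟨ha, h⟩
    refine hu.mem_roots_of_forall_mem ha fun c => ?_
    rw [hL]
    refine ⟨hu.mem a ha c, Subgroup.mem_centralizer_iff.2 fun s hs => ?_⟩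
    have := hu.torus_conj a ha ⟨s, hST hs⟩ c
    rwa [h s hs, Units.val_one, one_mul, mul_inv_eq_iff_eq_mul] at this

theorem IsRealization.mem_centralizer [Infinite K] (hu : IsRealization k G T u)
    {L S : Subgroup (GL (Fin n) K)} (hST : S ≤ T)
    (hL : L = G ⊓ Subgroup.centralizer (S : Set (GL (Fin n) K))) {a : T →* Kˣ}
    (ha : a ∈ roots L T) (c : K) : u a c ∈ L := by
  obtain ⟨ha, h⟩ := (hu.mem_roots_centralizer hST hL).1 ha
  rw [hL]
  refine ⟨hu.mem a ha c, Subgroup.mem_centralizer_iff.2 fun s hs => ?_⟩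
  have := hu.torus_conj a ha ⟨s, hST hs⟩ c
  rwa [h s hs, Units.val_one, one_mul, mul_inv_eq_iff_eq_mul] at this

/-- A root whose root subgroup meets the centralizer `L` nontrivially is a root of `L`. -/
theorem IsRealization.mem_roots_of_mem [Infinite K] (hu : IsRealization k G T u)
    {L S : Subgroup (GL (Fin n) K)} (hST : S ≤ T)
    (hL : L = G ⊓ Subgroup.centralizer (S : Set (GL (Fin n) K))) {a : T →* Kˣ}
    (ha : a ∈ roots G T) {c : K} (hc : c ≠ 0) (h : u a c ∈ L) : a ∈ roots L T := by
  refine (hu.mem_roots_centralizer hST hL).2 ⟨ha, fun s hs => ?_⟩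
  rw [hL] at h
  have h1 := Subgroup.mem_centralizer_iff.1 h.2 s hs
  rw [← mul_inv_eq_iff_eq_mul, hu.torus_conj a ha ⟨s, hST hs⟩] at h1
  have h2 := hu.injective ha h1
  rw [← Units.val_inj, Units.val_one]
  exact mul_right_cancel₀ hc (h2.trans (one_mul c).symm)

/-- The roots of `L` are closed under combinations which are roots of `G`. -/
theorem IsRealization.mul_mem_roots [Infinite K] (hu : IsRealization k G T u)
    {L S : Subgroup (GL (Fin n) K)} (hST : S ≤ T)
    (hL : L = G ⊓ Subgroup.centralizer (S : Set (GL (Fin n) K))) {a b : T →* Kˣ}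
    (ha : a ∈ roots L T) (hb : b ∈ roots L T) {p q : ℕ} (hab : a ^ p * b ^ q ∈ roots G T) :
    a ^ p * b ^ q ∈ roots L T := by
  refine (hu.mem_roots_centralizer hST hL).2 ⟨hab, fun s hs => ?_⟩
  rw [MonoidHom.mul_apply, MonoidHom.pow_apply, MonoidHom.pow_apply,
    ((hu.mem_roots_centralizer hST hL).1 ha).2 s hs,
    ((hu.mem_roots_centralizer hST hL).1 hb).2 s hs, one_pow, one_pow, one_mul]

/-- The root subgroups lie in the derived group. -/
theorem IsRealization.mem_commutator (hu : IsRealization k G T u) (hTG : T ≤ G) {a : T →* Kˣ}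
    (ha : a ∈ roots G T) (c : K) : u a c ∈ ⁅G, G⁆ := by
  obtain ⟨t, ht⟩ : ∃ t, a t ≠ 1 := by
    by_contra! h
    exact ha.2.1 (MonoidHom.ext h)
  have ht' : (a t : K) - 1 ≠ 0 := fun h => ht (Units.val_inj.1 (sub_eq_zero.1 h))
  have h1 : u a c = (t : GL (Fin n) K) * u a (c / ((a t : K) - 1)) *
      (t : GL (Fin n) K)⁻¹ * (u a (c / ((a t : K) - 1)))⁻¹ := by
    rw [hu.torus_conj a ha, ← hu.map_neg ha, ← hu.map_add a ha]
    congr 1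
    field_simp
    ring
  rw [h1]
  exact Subgroup.commutator_mem_commutator (hTG t.2) (hu.mem a ha _)

end Realization

end Roots

section SL2

variable {K : Type*} [Field K] {n : ℕ}

theorem coe_upperSL (c : K) : (upperSL c : Matrix (Fin 2) (Fin 2) K) = !![1, c; 0, 1] := rfl

theorem coe_lowerSL (c : K) : (lowerSL c : Matrix (Fin 2) (Fin 2) K) = !![1, 0; c, 1] := rfl

theorem coe_diagSL (c : Kˣ) : (diagSL c : Matrix (Fin 2) (Fin 2) K) =
    !![(c : K), 0; 0, ((c⁻¹ : Kˣ) : K)] := rfl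

/-- The element `(0, 1; -1, 0)` of `SL₂`. -/
def weylSL (K : Type*) [Field K] : Matrix.SpecialLinearGroup (Fin 2) K :=
  upperSL 1 * lowerSL (-1) * upperSL 1

theorem coe_weylSL : (weylSL K : Matrix (Fin 2) (Fin 2) K) = !![0, 1; -1, 0] := by
  simp [weylSL, coe_upperSL, coe_lowerSL]

theorem diagSL_mul (c d : Kˣ) : diagSL (c * d) = diagSL c * diagSL d := by
  ext i j
  fin_cases i <;> fin_cases j <;> simp [coe_diagSL, mul_comm]

theorem upperSL_mul_weylSL_mul_upperSL (x : Kˣ) :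
    upperSL (x : K) * weylSL K * upperSL ((x⁻¹ : Kˣ) : K) =
      lowerSL ((x⁻¹ : Kˣ) : K) * diagSL (-x) := by
  ext i j
  fin_cases i <;> fin_cases j <;>
    simp [coe_weylSL, coe_upperSL, coe_lowerSL, coe_diagSL]

theorem weylSL_mul_upperSL (c : K) : weylSL K * upperSL (-c) = lowerSL c * weylSL K := by
  ext i j
  fin_cases i <;> fin_cases j <;>
    simp [coe_weylSL, coe_upperSL, coe_lowerSL]

theorem weylSL_mul_lowerSL (c : K) : weylSL K * lowerSL c = upperSL (-c) * weylSL K := by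
  ext i j
  fin_cases i <;> fin_cases j <;>
    simp [coe_weylSL, coe_upperSL, coe_lowerSL]

theorem lowerSL_mul_upperSL_mul_lowerSL (x : Kˣ) :
    lowerSL (-((x⁻¹ : Kˣ) : K)) * upperSL (x : K) * lowerSL (-((x⁻¹ : Kˣ) : K)) =
      diagSL x * weylSL K := by
  ext i j
  fin_cases i <;> fin_cases j <;>
    simp [coe_weylSL, coe_upperSL, coe_lowerSL, coe_diagSL]

theorem diagSL_mul_upperSL (c : Kˣ) (x : K) :
    diagSL c * upperSL x * (diagSL c)⁻¹ = upperSL ((c : K) ^ 2 * x) := by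
  rw [mul_inv_eq_iff_eq_mul]
  ext i j
  fin_cases i <;> fin_cases j <;>
    simp [coe_upperSL, coe_diagSL]
  field_simp

theorem upperSL_neg (c : K) : upperSL (-c) = (upperSL c)⁻¹ := by
  rw [eq_inv_iff_mul_eq_one]
  ext i j
  fin_cases i <;> fin_cases j <;> simp [coe_upperSL]

theorem lowerSL_neg (c : K) : lowerSL (-c) = (lowerSL c)⁻¹ := by
  rw [eq_inv_iff_mul_eq_one]
  ext i j
  fin_cases i <;> fin_cases j <;> simp [coe_lowerSL]

theorem lowerSL_zero : lowerSL (0 : K) = 1 := by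
  ext i j
  fin_cases i <;> fin_cases j <;> simp [coe_lowerSL]

theorem upperSL_zero : upperSL (0 : K) = 1 := by
  ext i j
  fin_cases i <;> fin_cases j <;> simp [coe_upperSL]

theorem commutator_upperSL_lowerSL (x z : K) (α : Kˣ) (hα : (α : K) = 1 + x * z + x ^ 2 * z ^ 2) :
    upperSL x * lowerSL z * (upperSL x)⁻¹ * (lowerSL z)⁻¹ =
      lowerSL (x * z ^ 2 * ((α⁻¹ : Kˣ) : K)) * diagSL α *
        upperSL (-(x ^ 2 * z * ((α⁻¹ : Kˣ) : K))) := by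
  rw [← upperSL_neg, ← lowerSL_neg]
  have h : (α : K) ≠ 0 := α.ne_zero
  ext i j
  fin_cases i <;> fin_cases j
  · simp [coe_upperSL, coe_lowerSL, coe_diagSL, hα]; ring
  · simp [coe_upperSL, coe_lowerSL, coe_diagSL]; field_simp; ring
  · simp [coe_upperSL, coe_lowerSL, coe_diagSL]; field_simp; ring
  · simp [coe_upperSL, coe_lowerSL, coe_diagSL]; field_simp; rw [hα]; ring

/-- A polynomial in `x` which is a polynomial in `x⁻¹` is constant. -/
theorem eq_C_of_eval_inv_eq {p q : Polynomial K} {X : Set K} (hX : X.Infinite)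
    (h : ∀ x ∈ X, x ≠ 0 ∧ p.eval x⁻¹ = q.eval x) : q = Polynomial.C (p.coeff 0) := by
  have h1 : p.reverse = Polynomial.X ^ p.natDegree * q := by
    refine Polynomial.eq_of_infinite_eval_eq _ _ (hX.mono fun x hx => ?_)
    obtain ⟨hx0, hx⟩ := h x hx
    let _ := invertibleOfNonzero (inv_ne_zero hx0)
    have h3 := Polynomial.eval₂_reverse_mul_pow (RingHom.id K) x⁻¹ p
    rw [invOf_eq_inv, inv_inv, Polynomial.eval₂_id, Polynomial.eval₂_id] at h3
    change p.reverse.eval x = (Polynomial.X ^ p.natDegree * q).eval x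
    rw [Polynomial.eval_mul, Polynomial.eval_pow, Polynomial.eval_X, ← hx, ← h3, mul_left_comm,
      ← mul_pow, mul_inv_cancel₀ hx0, one_pow, mul_one]
  have h2 : q.natDegree = 0 := by
    by_cases hq : q = 0
    · rw [hq, Polynomial.natDegree_zero]
    · have h3 := p.reverse_natDegree_le
      rw [h1, Polynomial.natDegree_mul (pow_ne_zero _ Polynomial.X_ne_zero) hq,
        Polynomial.natDegree_X_pow] at h3
      omega
  have h3 := congrArg (fun f => Polynomial.coeff f p.natDegree) h1
  simp only [Polynomial.coeff_X_pow_mul', le_refl, if_true, Nat.sub_self] at h3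
  rw [Polynomial.eq_C_of_natDegree_eq_zero h2, ← h3, Polynomial.coeff_reverse,
    Polynomial.revAt_le le_rfl, Nat.sub_self]

/-- Products of matrices with entries in an algebra of functions. -/
theorem mul_entries_mem {Y : Type*} {A : Subalgebra K (Y → K)}
    {M M' : Y → Matrix (Fin n) (Fin n) K} (hM : ∀ i j, (fun c => M c i j) ∈ A)
    (hM' : ∀ i j, (fun c => M' c i j) ∈ A) (i j : Fin n) : (fun c => (M c * M' c) i j) ∈ A := by
  have : (fun c => (M c * M' c) i j) = ∑ l, (fun c => M c i l) * fun c => M' c l j := by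
    ext c
    simp [Matrix.mul_apply]
  rw [this]
  exact sum_mem fun l _ => mul_mem (hM i l) (hM' l j)

theorem const_mem {Y : Type*} (A : Subalgebra K (Y → K)) (a : K) : (fun _ => a) ∈ A :=
  A.algebraMap_mem a

theorem eval_mem {Y : Type*} {A : Subalgebra K (Y → K)} {f : Y → K} (hf : f ∈ A)
    (P : Polynomial K) : (fun c => P.eval (f c)) ∈ A := by
  have : (fun c => P.eval (f c)) = Polynomial.aeval f P := by
    ext c
    rw [Polynomial.aeval_fn_apply, Polynomial.coe_aeval_eq_eval]
  rw [this]
  exact Algebra.adjoin_le (Set.singleton_subset_iff.2 hf)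
    (Polynomial.aeval_mem_adjoin_singleton K f)

theorem exists_eval_of_mem_adjoin {Y : Type*} {ι f : Y → K} (hf : f ∈ Algebra.adjoin K {ι}) :
    ∃ P : Polynomial K, ∀ c, f c = P.eval (ι c) := by
  rw [Algebra.adjoin_singleton_eq_range_aeval] at hf
  obtain ⟨P, rfl⟩ := hf
  refine ⟨P, fun c => ?_⟩
  change Polynomial.aeval ι P c = _
  rw [Polynomial.aeval_fn_apply, Polynomial.coe_aeval_eq_eval]

/-- Laurent polynomials, as functions. -/
def laurentFun (K : Type*) [Field K] : Subalgebra K (Kˣ → K) :=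
  Algebra.adjoin K {fun c : Kˣ => (c : K), fun c : Kˣ => ((c⁻¹ : Kˣ) : K)}

theorem exists_eval_of_mem_laurentFun {f : Kˣ → K} (hf : f ∈ laurentFun K) :
    ∃ (m : ℕ) (P : Polynomial K), ∀ c : Kˣ, f c * (c : K) ^ m = P.eval (c : K) := by
  induction hf using Algebra.adjoin_induction with
  | mem f hf =>
    rcases hf with rfl | rfl
    · exact ⟨0, Polynomial.X, fun c => by simp⟩
    · exact ⟨1, 1, fun c => by simp⟩
  | algebraMap a => exact ⟨0, Polynomial.C a, fun c => by simp⟩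
  | add f f' _ _ h h' =>
    obtain ⟨m, P, hP⟩ := h
    obtain ⟨m', P', hP'⟩ := h'
    refine ⟨m + m', P * Polynomial.X ^ m' + P' * Polynomial.X ^ m, fun c => ?_⟩
    simp only [Polynomial.eval_add, Polynomial.eval_mul, Polynomial.eval_pow, Polynomial.eval_X,
      ← hP, ← hP', Pi.add_apply]
    ring
  | mul f f' _ _ h h' =>
    obtain ⟨m, P, hP⟩ := h
    obtain ⟨m', P', hP'⟩ := h'
    refine ⟨m + m', P * P', fun c => ?_⟩
    simp only [Polynomial.eval_mul, ← hP, ← hP', Pi.mul_apply]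
    ring

/-- A character given by a Laurent polynomial is a power. -/
theorem exists_zpow_of_mem_laurentFun {χ : Kˣ →* Kˣ}
    (hχ : (fun c => (χ c : K)) ∈ laurentFun K) : ∃ k : ℤ, ∀ c, χ c = c ^ k := by
  obtain ⟨m, P, hP⟩ := exists_eval_of_mem_laurentFun hχ
  obtain ⟨k, hk⟩ := exists_mono_eq (n := 1) (Γ := ⊤)
    ((χ.comp (Pi.evalMonoidHom (fun _ : Fin 1 => Kˣ) 0)).comp (Subgroup.subtype ⊤)) (fun _ => m)
    (Polynomial.aeval (MvPolynomial.X 0) P) (by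
      intro x
      rw [← MvPolynomial.coe_aeval_eq_eval, RingHom.coe_coe, ← Polynomial.aeval_algHom_apply,
        MvPolynomial.aeval_X, Polynomial.coe_aeval_eq_eval, ← hP]
      simp [mono_apply])
  refine ⟨k 0, fun c => ?_⟩
  have := hk ⟨fun _ => c, trivial⟩
  simpa [mono_apply] using this

theorem conj_lower {ζ : Matrix.SpecialLinearGroup (Fin 2) K →* GL (Fin n) K} (c : K) :
    ζ (lowerSL c) = ζ (weylSL K) * ζ (upperSL (-c)) * (ζ (weylSL K))⁻¹ := by
  rw [eq_mul_inv_iff_mul_eq, ← map_mul, ← map_mul, weylSL_mul_upperSL]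

/-- The diagonal of a homomorphism from `SL₂` which is regular on upper triangular unipotents. -/
theorem exists_zpow_diagSL {ζ : Matrix.SpecialLinearGroup (Fin 2) K →* GL (Fin n) K}
    (hreg : ∀ i j, ∃ P : Polynomial K, ∀ c, (ζ (upperSL c) : Matrix (Fin n) (Fin n) K) i j =
      P.eval c) {g : GL (Fin n) K} (hg : ∀ c, ζ (diagSL c) ∈ (diagHom g).range) :
    ∃ k : Fin n → ℤ, ∀ c, ζ (diagSL c) = diagHom g fun i => c ^ k i := by
  choose P hP using hreg
  choose x hx using hg
  have hmem : ∀ i, (fun c => (x c i : K)) ∈ laurentFun K := by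
    have hc : (fun c : Kˣ => (c : K)) ∈ laurentFun K := Algebra.subset_adjoin (Or.inl rfl)
    have hc' : (fun c : Kˣ => ((c⁻¹ : Kˣ) : K)) ∈ laurentFun K :=
      Algebra.subset_adjoin (Or.inr rfl)
    have hup : ∀ {f : Kˣ → K}, f ∈ laurentFun K → ∀ i j,
        (fun c => (ζ (upperSL (f c)) : Matrix (Fin n) (Fin n) K) i j) ∈ laurentFun K := by
      intro f hf i j
      simp only [hP]
      exact eval_mem hf _
    have hconst : ∀ (M : Matrix (Fin n) (Fin n) K) (i j : Fin n),
        (fun _ : Kˣ => M i j) ∈ laurentFun K := fun M i j => const_mem _ _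
    have hlow : ∀ i j, (fun c : Kˣ => (ζ (lowerSL (-((c⁻¹ : Kˣ) : K))) :
        Matrix (Fin n) (Fin n) K) i j) ∈ laurentFun K := by
      intro i j
      simp only [conj_lower, Units.val_mul, neg_neg]
      exact mul_entries_mem (mul_entries_mem (hconst _) (hup hc')) (hconst _) i j
    intro i
    have h1 : (fun c => (x c i : K)) = fun c => (((((g : Matrix (Fin n) (Fin n) K) *
        ζ (lowerSL (-((c⁻¹ : Kˣ) : K)))) * ζ (upperSL (c : K))) *
          ζ (lowerSL (-((c⁻¹ : Kˣ) : K)))) *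
            (((ζ (weylSL K))⁻¹ * g⁻¹ : GL (Fin n) K) : Matrix (Fin n) (Fin n) K)) i i := by
      ext c
      have h2 := congrFun (congrFun (coe_conj_diagHom g (x c)) i) i
      rw [Matrix.diagonal_apply_eq, hx] at h2
      rw [← h2]
      have h3 : g * ζ (diagSL c) * g⁻¹ = g * ζ (lowerSL (-((c⁻¹ : Kˣ) : K))) *
          ζ (upperSL (c : K)) * ζ (lowerSL (-((c⁻¹ : Kˣ) : K))) * ((ζ (weylSL K))⁻¹ * g⁻¹) := by
        have h4 : ζ (diagSL c) = ζ (lowerSL (-((c⁻¹ : Kˣ) : K))) * ζ (upperSL (c : K)) *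
            ζ (lowerSL (-((c⁻¹ : Kˣ) : K))) * (ζ (weylSL K))⁻¹ := by
          rw [← map_mul, ← map_mul, lowerSL_mul_upperSL_mul_lowerSL, map_mul, mul_inv_cancel_right]
        rw [h4]
        simp only [mul_assoc]
      rw [h3]
      rfl
    rw [h1]
    exact mul_entries_mem (mul_entries_mem (mul_entries_mem (mul_entries_mem (hconst _) hlow)
      (hup hc)) hlow) (hconst _) i i
  let χ : Fin n → Kˣ →* Kˣ := fun i => MonoidHom.mk' (fun c => x c i) fun c d => by
    rw [← Pi.mul_apply]
    refine congrFun (diagHom_injective g ?_) i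
    rw [map_mul, hx, hx, hx, diagSL_mul, map_mul]
  choose k hk using fun i => exists_zpow_of_mem_laurentFun (χ := χ i) (hmem i)
  refine ⟨k, fun c => ?_⟩
  rw [← hx]
  congr 1
  ext i
  rw [← hk]
  rfl

end SL2

section Rational

variable {K : Type*} [Field K] {n : ℕ} {F : Type*} [Field F] [Algebra F K]
  {E : IntermediateField F K}

theorem aeval_mem {c : K} (hc : c ∈ E) (P : Polynomial E) : Polynomial.aeval c P ∈ E := by
  rw [show c = algebraMap E K ⟨c, hc⟩ from rfl, Polynomial.aeval_algebraMap_apply]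
  exact SetLike.coe_mem _

theorem map_mul_mul_of_mem (π : K →ₗ[E] E) {A B : Matrix (Fin n) (Fin n) K}
    (hA : ∀ i j, A i j ∈ E) (hB : ∀ i j, B i j ∈ E) (M : Matrix (Fin n) (Fin n) K) :
    (A * M * B).map (fun c => (π c : K)) = A * M.map (fun c => (π c : K)) * B := by
  ext i j
  simp only [Matrix.map_apply, Matrix.mul_apply, map_sum, AddSubmonoidClass.coe_finsetSum,
    Finset.sum_mul]
  refine Finset.sum_congr rfl fun k _ => Finset.sum_congr rfl fun l _ => ?_
  have h : A i l * M l k * B k j = ((⟨A i l, hA i l⟩ : E) * (⟨B k j, hB k j⟩ : E)) • M l k := by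
    rw [Algebra.smul_def]
    change _ = A i l * B k j * M l k
    ring
  rw [h, map_smul]
  change A i l * B k j * _ = _
  ring

/-- A homomorphism from `SL₂` which is defined over `E` on the upper triangular matrices maps
the Weyl element to a matrix defined over `E`. -/
theorem weylSL_mem_ratPoints [Infinite E]
    {ζ : Matrix.SpecialLinearGroup (Fin 2) K →* GL (Fin n) K}
    (hreg : ∀ i j, ∃ P : Polynomial E, ∀ c, (ζ (upperSL c) : Matrix (Fin n) (Fin n) K) i j =
      Polynomial.aeval c P)
    (hdiag : ∀ c : Kˣ, (c : K) ∈ E → ζ (diagSL c) ∈ ratPoints (K := K) (n := n) E) :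
    ζ (weylSL K) ∈ ratPoints (K := K) (n := n) E := by
  choose P hP using hreg
  obtain ⟨π, hπ⟩ := LinearMap.exists_leftInverse_of_injective (Algebra.linearMap E K)
    (LinearMap.ker_eq_bot.2 (algebraMap E K).injective)
  have hπ' : ∀ c (hc : c ∈ E), (π c : K) = c := fun c hc =>
    congrArg Subtype.val (LinearMap.congr_fun hπ ⟨c, hc⟩)
  have hup : ∀ (c : K), c ∈ E → ∀ i j, (ζ (upperSL c) : Matrix (Fin n) (Fin n) K) i j ∈ E := by
    intro c hc i j
    rw [hP]
    exact aeval_mem hc _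
  set N := ζ (weylSL K) with hN
  let pr : Matrix (Fin n) (Fin n) K → Matrix (Fin n) (Fin n) K := fun M => M.map fun c => (π c : K)
  have hpr1 : pr 1 = 1 := by
    ext i j
    simp only [pr, Matrix.map_apply]
    refine hπ' _ ?_
    rw [Matrix.one_apply]
    split_ifs
    · exact one_mem E
    · exact zero_mem E
  let A : Matrix (Fin n) (Fin n) K := pr N * ((N⁻¹ : GL (Fin n) K) : Matrix (Fin n) (Fin n) K)
  have hA : A = 1 := by
    let B : E → Matrix (Fin n) (Fin n) K := fun z =>
      pr (ζ (lowerSL (z : K))) * ((ζ (lowerSL (z : K)))⁻¹ : GL (Fin n) K)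
    let C : E → Matrix (Fin n) (Fin n) K := fun x =>
      ζ (upperSL (x : K)) * A * ζ (upperSL (-(x : K)))
    have hBC : ∀ x : E, x ≠ 0 → B x⁻¹ = C x := by
      intro x hx0
      have hx : (x : K) ≠ 0 := fun h => hx0 (Subtype.ext h)
      have hinv : ((x⁻¹ : E) : K) = (((Units.mk0 (x : K) hx)⁻¹ : Kˣ) : K) := by
        rw [Units.val_inv_eq_inv_val, Units.val_mk0]; rfl
      have h1 : ζ (lowerSL ((x⁻¹ : E) : K)) = ζ (upperSL (x : K)) * N *
          (ζ (upperSL ((x⁻¹ : E) : K)) * (ζ (diagSL (-(Units.mk0 (x : K) hx))))⁻¹) := by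
        rw [← mul_assoc, eq_mul_inv_iff_mul_eq, hN, ← map_mul, ← map_mul, ← map_mul, hinv,
          ← upperSL_mul_weylSL_mul_upperSL]
        rfl
      have h2 : pr (ζ (lowerSL ((x⁻¹ : E) : K))) = ζ (upperSL (x : K)) * pr N *
          ((ζ (upperSL ((x⁻¹ : E) : K)) * (ζ (diagSL (-(Units.mk0 (x : K) hx))))⁻¹ :
            GL (Fin n) K) : Matrix (Fin n) (Fin n) K) := by
        rw [h1, Units.val_mul, Units.val_mul]
        refine map_mul_mul_of_mem π (hup x x.2) (mem_ratPoints_intermediateField.1 ?_) _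
        refine mul_mem (mem_ratPoints_intermediateField.2 (hup _ (x⁻¹).2)) (inv_mem (hdiag _ ?_))
        rw [Units.val_neg, Units.val_mk0]
        exact neg_mem x.2
      have h3 : (ζ (upperSL ((x⁻¹ : E) : K)) * (ζ (diagSL (-(Units.mk0 (x : K) hx))))⁻¹ :
            GL (Fin n) K) * (ζ (lowerSL ((x⁻¹ : E) : K)))⁻¹ = N⁻¹ * ζ (upperSL (-(x : K))) := by
        rw [h1, upperSL_neg, map_inv]
        group
      simp only [B, C, A]
      rw [h2, mul_assoc, ← Units.val_mul, h3, Units.val_mul]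
      simp only [mul_assoc]
    have hid : (fun x : E => (x : K)) ∈ Algebra.adjoin K {fun x : E => (x : K)} :=
      Algebra.subset_adjoin rfl
    have hconst : ∀ (M : Matrix (Fin n) (Fin n) K) (i j : Fin n),
        (fun _ : E => M i j) ∈ Algebra.adjoin K {fun x : E => (x : K)} := fun M i j => const_mem _ _
    have hupE : ∀ {f : E → K}, f ∈ Algebra.adjoin K {fun x : E => (x : K)} → ∀ i j,
        (fun c => (ζ (upperSL (f c)) : Matrix (Fin n) (Fin n) K) i j) ∈
          Algebra.adjoin K {fun x : E => (x : K)} := by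
      intro f hf i j
      simp only [hP, Polynomial.aeval_def, ← Polynomial.eval_map]
      exact eval_mem hf _
    have hprE : ∀ i j, (fun z : E => pr (ζ (lowerSL (z : K))) i j) ∈
        Algebra.adjoin K {fun x : E => (x : K)} := by
      intro i j
      have : (fun z : E => pr (ζ (lowerSL (z : K))) i j) = ∑ k, ∑ l,
          (fun z : E => (ζ (upperSL (-(z : K))) : Matrix (Fin n) (Fin n) K) l k) *
            fun _ => (π ((N : Matrix (Fin n) (Fin n) K) i l *
              ((N⁻¹ : GL (Fin n) K) : Matrix (Fin n) (Fin n) K) k j) : K) := by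
        ext z
        simp only [pr, conj_lower, Matrix.map_apply, Units.val_mul, Matrix.mul_apply,
          Finset.sum_mul, map_sum, AddSubmonoidClass.coe_finsetSum, Finset.sum_apply,
          Pi.mul_apply]
        refine Finset.sum_congr rfl fun k _ => Finset.sum_congr rfl fun l _ => ?_
        have h := hup (-(z : K)) (neg_mem z.2) l k
        have h' : (N : Matrix (Fin n) (Fin n) K) i l *
            (ζ (upperSL (-(z : K))) : Matrix (Fin n) (Fin n) K) l k *
            ((N⁻¹ : GL (Fin n) K) : Matrix (Fin n) (Fin n) K) k j =
            (⟨_, h⟩ : E) • ((N : Matrix (Fin n) (Fin n) K) i l *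
              ((N⁻¹ : GL (Fin n) K) : Matrix (Fin n) (Fin n) K) k j) := by
          rw [Algebra.smul_def]
          change _ = (ζ (upperSL (-(z : K))) : Matrix (Fin n) (Fin n) K) l k * _
          ring
        rw [h', map_smul]
        rfl
      rw [this]
      exact sum_mem fun k _ => sum_mem fun l _ => mul_mem (hupE (neg_mem hid) l k) (const_mem _ _)
    ext i j
    obtain ⟨p, hp⟩ := exists_eval_of_mem_adjoin (ι := fun x : E => (x : K))
      (f := fun z => B z i j) (by
        refine mul_entries_mem hprE (fun i j => ?_) i j
        have : ∀ z : E, (ζ (lowerSL (z : K)))⁻¹ = N * ζ (upperSL (z : K)) * N⁻¹ := fun z => by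
          rw [← map_inv, ← lowerSL_neg, conj_lower, neg_neg]
        simp only [this, Units.val_mul]
        exact mul_entries_mem (mul_entries_mem (hconst _) (hupE hid)) (hconst _) i j)
    obtain ⟨q, hq⟩ := exists_eval_of_mem_adjoin (ι := fun x : E => (x : K))
      (f := fun z => C z i j) (mul_entries_mem (mul_entries_mem (hupE hid) (hconst _))
        (hupE (neg_mem hid)) i j)
    have hqp : q = Polynomial.C (p.coeff 0) := by
      refine eq_C_of_eval_inv_eq (X := (fun x : E => (x : K)) '' {x | x ≠ 0}) ?_ ?_
      · exact Set.Infinite.image Subtype.val_injective.injOn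
          (Set.Finite.infinite_compl (Set.finite_singleton (0 : E)))
      · rintro _ ⟨x, hx, rfl⟩
        refine ⟨fun h => hx (Subtype.ext h), ?_⟩
        have h1 := hp x⁻¹
        have h2 := hq x
        simp only [hBC x hx] at h1
        rw [← h2, h1]
        rfl
    have h0 := hq 0
    have h0' := hp 0
    simp only [C, B, ZeroMemClass.coe_zero, neg_zero, lowerSL_zero, upperSL_zero, map_one,
      Units.val_one, one_mul, mul_one, inv_one, hpr1] at h0 h0'
    rw [h0, hqp, Polynomial.eval_C, Polynomial.coeff_zero_eq_eval_zero, ← h0']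
  have hprN : pr N = N := by
    have : A * N = pr N := by
      simp only [A]
      rw [mul_assoc, ← Units.val_mul, inv_mul_cancel, Units.val_one, mul_one]
    rw [← this, hA, one_mul]
  rw [mem_ratPoints_intermediateField]
  intro i j
  rw [← hprN]
  exact SetLike.coe_mem _

end Rational

section Coroot

variable {F : Type*} [Field F] {K : Type*} [Field K] [Algebra F K] {n : ℕ}
  {E : IntermediateField F K} {G T : Subgroup (GL (Fin n) K)} {u : (T →* Kˣ) → K → GL (Fin n) K}
  {g : GL (Fin n) K} {a : T →* Kˣ}

theorem IsRealization.mem_ratPoints_iff (hu : IsRealization E G T u) (ha : a ∈ roots G T) {x : K} :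
    u a x ∈ ratPoints (K := K) (n := n) E ↔ x ∈ E := by
  constructor
  · intro h
    obtain ⟨f, hf⟩ := hu.regular_inv a ha
    have h1 : ∀ ij, ∃ c : E, (c : K) = coords (u a x) ij := fun ij =>
      ⟨⟨_, mem_ratPoints_intermediateField.1 h ij.1 ij.2⟩, rfl⟩
    choose c hc using h1
    have h2 : coords (u a x) = algebraMap E K ∘ c := funext fun ij => (hc ij).symm
    rw [← hf x, h2, MvPolynomial.aeval_algebraMap_apply]
    exact SetLike.coe_mem _
  · intro h
    rw [mem_ratPoints_intermediateField]
    intro i j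
    obtain ⟨P, hP⟩ := hu.regular a ha i j
    rw [hP]
    exact aeval_mem h P

theorem IsRealization.mem_rootGroup_iff (hu : IsRealization E G T u) (ha : a ∈ roots G T)
    {z : GL (Fin n) K} : z ∈ rootGroup E u a ↔ ∃ x ∈ E, u a x = z := by
  constructor
  · rintro ⟨⟨x, rfl⟩, h⟩
    exact ⟨x, (hu.mem_ratPoints_iff ha).1 h, rfl⟩
  · rintro ⟨x, hx, rfl⟩
    exact ⟨⟨x, rfl⟩, (hu.mem_ratPoints_iff ha).2 hx⟩

/-- The coroot of `a`, and the rationality of the associated homomorphism from `SL₂`. -/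
theorem IsRealization.exists_coroot [Infinite E] (hu : IsRealization E G T u)
    (ha : a ∈ roots G T)
    (hg : g ∈ ratPoints (K := K) (n := n) E) (hT : T ≤ (diagHom g).range) :
    ∃ (ζ : Matrix.SpecialLinearGroup (Fin 2) K →* GL (Fin n) K) (k : Fin n → ℤ),
      (∀ c, ζ (upperSL c) = u a c) ∧ (∀ c, ζ (lowerSL c) = u a⁻¹ c) ∧
      (∀ c, ∃ h : ζ (diagSL c) ∈ T, (a ⟨_, h⟩ : K) = (c : K) ^ 2) ∧
      (∀ c, ζ (diagSL c) = diagHom g fun i => c ^ k i) ∧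
      (∀ c : Kˣ, (c : K) ∈ E → ζ (diagSL c) ∈ ratPoints (K := K) (n := n) E) ∧
      ζ (weylSL K) ∈ ratPoints (K := K) (n := n) E ∧
      ∀ c ∈ E, u a⁻¹ c ∈ ratPoints (K := K) (n := n) E := by
  obtain ⟨ζ, hup, hlow, hdiag⟩ := hu.sl₂ a ha
  have hreg : ∀ i j, ∃ P : Polynomial E, ∀ c, (ζ (upperSL c) : Matrix (Fin n) (Fin n) K) i j =
      Polynomial.aeval c P := by
    intro i j
    obtain ⟨P, hP⟩ := hu.regular a ha i j
    exact ⟨P, fun c => by rw [hup, hP]⟩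
  obtain ⟨k, hk⟩ := exists_zpow_diagSL (ζ := ζ) (fun i j => by
    obtain ⟨P, hP⟩ := hreg i j
    exact ⟨P.map (algebraMap E K), fun c => by rw [hP, Polynomial.eval_map, Polynomial.aeval_def]⟩)
    fun c => hT (hdiag c)
  have hrat : ∀ c : Kˣ, (c : K) ∈ E → ζ (diagSL c) ∈ ratPoints (K := K) (n := n) E := by
    intro c hc
    rw [hk, diagHom_mem_ratPoints hg]
    intro i
    rw [Units.val_zpow_eq_zpow_val]
    exact zpow_mem hc _
  have hw := weylSL_mem_ratPoints hreg hrat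
  refine ⟨ζ, k, hup, hlow, fun c => ⟨hdiag c, ?_⟩, hk, hrat, hw, fun c hc => ?_⟩
  · apply hu.injective ha
    have h1 := hu.torus_conj a ha ⟨_, hdiag c⟩ 1
    rw [mul_one] at h1
    rw [← h1, ← hup, ← map_inv, ← map_mul, ← map_mul, diagSL_mul_upperSL, mul_one, hup]
  · rw [← hlow, conj_lower, hup]
    exact mul_mem (mul_mem hw ((hu.mem_ratPoints_iff ha).2 (neg_mem hc))) (inv_mem hw)

end Coroot

section Offset

variable {F : Type*} [Field F] [ValuativeRel F] [TopologicalSpace F] [IsNonarchimedeanLocalField F]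
  {K : Type*} [Field K] [Algebra F K] {n : ℕ} {E : IntermediateField F K}
  {G T : Subgroup (GL (Fin n) K)} {u : (T →* Kˣ) → K → GL (Fin n) K}
  {y : (T →* Kˣ) → GL (Fin n) K → WithTop ℝ} {g : GL (Fin n) K} {a : T →* Kˣ}

theorem infinite_localField (F : Type*) [Field F] [ValuativeRel F] [TopologicalSpace F]
    [IsNonarchimedeanLocalField F] : Infinite F := by
  obtain ⟨N, -⟩ := exists_nontriviallyNormedField F
  exact @NontriviallyNormedField.infinite F N

theorem infinite_intermediateField (E : IntermediateField F K) : Infinite E :=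
  have := infinite_localField F
  Infinite.of_injective _ (algebraMap F E).injective

theorem exists_eq_coe {v : WithTop ℝ} (hv : v ≠ ⊤) : ∃ c : ℝ, v = c :=
  ⟨v.untop hv, (WithTop.coe_untop v hv).symm⟩

/-- On the root subgroups a point of the apartment is the valuation of `E`, up to a shift. -/
theorem IsApartmentPoint.exists_offset [IsAlgClosure F K] (hu : IsRealization E G T u)
    (hy : IsApartmentPoint E G T u y) (ha : a ∈ roots G T)
    (hg : g ∈ ratPoints (K := K) (n := n) E) (hT : T ≤ (diagHom g).range) :
    ∃ C : ℝ, (∀ x ∈ E, y a (u a x) = val F x + (C : WithTop ℝ)) ∧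
      ∀ x ∈ E, x ≠ 0 → y a⁻¹ (u a⁻¹ x) = val F x + ((-C : ℝ) : WithTop ℝ) := by
  have := infinite_intermediateField E
  have : Algebra.IsAlgebraic F K := IsAlgClosure.isAlgebraic
  obtain ⟨ζ, k, hup, hlow, hsq, hk, hrat, hw, hratlow⟩ := hu.exists_coroot ha hg hT
  have hfin : ∀ x ∈ E, x ≠ 0 → ∃ c : ℝ, y a (u a x) = c := by
    intro x hx hx0
    refine exists_eq_coe fun h => hx0 ?_
    rw [hy.eq_top_iff a ha _ ((hu.mem_rootGroup_iff ha).2 ⟨x, hx, rfl⟩), ← hu.map_zero ha] at h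
    exact hu.injective ha h
  have hroot : ∀ x ∈ E, u a x ∈ rootGroup E u a := fun x hx =>
    (hu.mem_rootGroup_iff ha).2 ⟨x, hx, rfl⟩
  have hroot' : ∀ x ∈ E, u a⁻¹ x ∈ rootGroup E u a⁻¹ := fun x hx => ⟨⟨x, rfl⟩, hratlow x hx⟩
  have hN : u a 1 * u a⁻¹ (-1) * u a 1 = ζ (weylSL K) := by
    rw [weylSL, map_mul, map_mul, hup, hlow]
  obtain ⟨κ, hκ⟩ := hy.reflection a ha (ζ (weylSL K)) ⟨1, one_mem _, by rw [one_mul, hN]⟩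
  have hrefl : ∀ x ∈ E, x ≠ 0 → y a⁻¹ (u a⁻¹ x) = y a (u a (-x)) + (κ : WithTop ℝ) := by
    intro x hx hx0
    have h1 : ζ (weylSL K) * u a⁻¹ x * (ζ (weylSL K))⁻¹ = u a (-x) := by
      rw [mul_inv_eq_iff_eq_mul, ← hlow, ← hup, ← map_mul, ← map_mul, weylSL_mul_lowerSL]
    rw [hκ _ (hroot' x hx) fun h => hx0 ?_, h1]
    rw [h, mul_one, mul_inv_cancel, ← hu.map_zero ha] at h1
    rw [← neg_eq_zero]
    exact (hu.injective ha h1).symm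
  have hmain : ∀ x ∈ E, x ≠ 0 → ∃ v f : ℝ, val F x = v ∧ y a (u a x) = f ∧ f = v - κ / 2 := by
    intro x hx hx0
    obtain ⟨v, hv⟩ := exists_val_eq (F := F) hx0
    obtain ⟨f, hf⟩ := hfin x hx hx0
    obtain ⟨f', hf'⟩ := hfin x⁻¹ (inv_mem hx) (inv_ne_zero hx0)
    refine ⟨v, f, hv, hf, ?_⟩
    let c := Units.mk0 x hx0
    have h5 := hy.opposite a ha (u a x) (hroot x hx) (u a⁻¹ (-x⁻¹))
      (hroot' _ (neg_mem (inv_mem hx))) (u a⁻¹ (-x⁻¹)) (hroot' _ (neg_mem (inv_mem hx))) (by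
        refine ⟨ζ (diagSL c), ⟨(hsq c).1, hrat c hx⟩, ?_⟩
        rw [hN, ← hlow, ← hup, ← map_mul, ← map_mul, ← map_mul, ← lowerSL_mul_upperSL_mul_lowerSL]
        simp [c])
    rw [hrefl _ (neg_mem (inv_mem hx)) (neg_ne_zero.2 (inv_ne_zero hx0)), neg_neg, hf, hf'] at h5
    have h6 := hy.torus_conj a ha ⟨_, (hsq c⁻¹).1⟩ (hrat c⁻¹ (by
      rw [Units.val_inv_eq_inv_val]; exact inv_mem hx)) (u a x) (hroot x hx)
    rw [hu.torus_conj a ha, (hsq c⁻¹).2, val_pow] at h6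
    have h7 : ((c⁻¹ : Kˣ) : K) ^ 2 * x = x⁻¹ := by
      rw [Units.val_inv_eq_inv_val, Units.val_mk0]
      field_simp
    have h8 : val F ((c⁻¹ : Kˣ) : K) = ((-v : ℝ) : WithTop ℝ) := by
      rw [Units.val_inv_eq_inv_val, Units.val_mk0]
      exact val_inv_eq hv
    rw [h7, hf, hf', h8] at h6
    norm_cast at h5 h6
    simp only [nsmul_eq_mul] at h6
    push_cast at h6
    linarith
  refine ⟨-κ / 2, fun x hx => ?_, fun x hx hx0 => ?_⟩
  · by_cases hx0 : x = 0
    · rw [hx0, val_zero, top_add, hy.eq_top_iff a ha _ (hroot 0 (zero_mem E)), hu.map_zero ha]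
    · obtain ⟨v, f, hv, hf, h⟩ := hmain x hx hx0
      rw [hv, hf, h]
      norm_cast
      ring
  · obtain ⟨v, f, hv, hf, h⟩ := hmain (-x) (neg_mem hx) (neg_ne_zero.2 hx0)
    rw [val_neg] at hv
    rw [hrefl x hx hx0, hv, hf, h]
    norm_cast
    ring

end Offset

section Commutator

theorem commutator_mem_of_closure {Γ : Type*} [Group Γ] {A B : Set Γ} {N : Subgroup Γ}
    (hA : A ⊆ Subgroup.normalizer (N : Set Γ)) (hB : B ⊆ Subgroup.normalizer (N : Set Γ))
    (hAB : ∀ a ∈ A, ∀ b ∈ B, a * b * a⁻¹ * b⁻¹ ∈ N) {x z : Γ} (hx : x ∈ Subgroup.closure A)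
    (hz : z ∈ Subgroup.closure B) : x * z * x⁻¹ * z⁻¹ ∈ N := by
  have hA' : Subgroup.closure A ≤ Subgroup.normalizer (N : Set Γ) := (Subgroup.closure_le _).2 hA
  have hB' : Subgroup.closure B ≤ Subgroup.normalizer (N : Set Γ) := (Subgroup.closure_le _).2 hB
  have key : ∀ a ∈ A, ∀ z ∈ Subgroup.closure B, a * z * a⁻¹ * z⁻¹ ∈ N := by
    intro a ha z hz
    induction hz using Subgroup.closure_induction with
    | mem b hb => exact hAB a ha b hb
    | one => simp
    | mul b b' hb hb' ih ih' =>
      have h1 := (Subgroup.mem_normalizer_iff.1 (hB' hb) _).1 ih'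
      have h2 := mul_mem ih h1
      simpa [mul_assoc] using h2
    | inv b hb ih =>
      have h1 := (Subgroup.mem_normalizer_iff.1 (inv_mem (hB' hb)) _).1 (inv_mem ih)
      simpa [mul_assoc] using h1
  induction hx using Subgroup.closure_induction with
  | mem a ha => exact key a ha z hz
  | one => simp
  | mul a a' ha ha' ih ih' =>
    have h1 := (Subgroup.mem_normalizer_iff.1 (hA' ha) _).1 ih'
    have h2 := mul_mem h1 ih
    simpa [mul_assoc] using h2
  | inv a ha ih =>
    have h1 := (Subgroup.mem_normalizer_iff.1 (inv_mem (hA' ha)) _).1 (inv_mem ih)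
    simpa [mul_assoc] using h1

theorem subset_normalizer_closure {Γ : Type*} [Group Γ] {A B : Set Γ} (hinv : ∀ a ∈ A, a⁻¹ ∈ A)
    (h : ∀ a ∈ A, ∀ b ∈ B, a * b * a⁻¹ ∈ Subgroup.closure B) :
    A ⊆ Subgroup.normalizer (Subgroup.closure B : Set Γ) := by
  have key : ∀ a ∈ A, ∀ z ∈ Subgroup.closure B, a * z * a⁻¹ ∈ Subgroup.closure B := by
    intro a ha z hz
    induction hz using Subgroup.closure_induction with
    | mem b hb => exact h a ha b hb
    | one => simp
    | mul b b' hb hb' ih ih' =>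
      have h2 := mul_mem ih ih'
      simpa [mul_assoc] using h2
    | inv b hb ih =>
      have h1 := inv_mem ih
      simpa [mul_assoc] using h1
  intro a ha
  refine Subgroup.mem_normalizer_iff.2 fun z => ⟨key a ha z, fun hz => ?_⟩
  have := key a⁻¹ (hinv a ha) _ hz
  simpa [mul_assoc] using this

end Commutator

section Filtration

theorem rootFiltration_anti {F K : Type*} [Field F] [Field K] [Algebra F K]
    {E : IntermediateField F K} {n : ℕ} {T : Subgroup (GL (Fin n) K)}
    {u : (T →* Kˣ) → K → GL (Fin n) K} {y : (T →* Kˣ) → GL (Fin n) K → WithTop ℝ}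
    {a : T →* Kˣ} {k l : ℝ} (h : k ≤ l) :
    rootFiltration E u y a l ⊆ rootFiltration E u y a k :=
  fun _ ⟨h1, h2⟩ => ⟨h1, le_trans (by exact_mod_cast h) h2⟩

variable {F : Type*} [Field F] [ValuativeRel F] [TopologicalSpace F] [IsNonarchimedeanLocalField F]
  {K : Type*} [Field K] [Algebra F K] {n : ℕ} {E : IntermediateField F K}
  {G T : Subgroup (GL (Fin n) K)} {u : (T →* Kˣ) → K → GL (Fin n) K}
  {y : (T →* Kˣ) → GL (Fin n) K → WithTop ℝ} {g : GL (Fin n) K} {C : (T →* Kˣ) → ℝ}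
  {Φ : Set (T →* Kˣ)} {S : Subgroup (GL (Fin n) K)} {k l : ℝ}

/-- A point of the apartment of `T`, described by its coordinates `C`, where `T` is diagonalized
by `g`. -/
structure IsCoordinatized (E : IntermediateField F K) (G T : Subgroup (GL (Fin n) K))
    (u : (T →* Kˣ) → K → GL (Fin n) K) (y : (T →* Kˣ) → GL (Fin n) K → WithTop ℝ)
    (g : GL (Fin n) K) (C : (T →* Kˣ) → ℝ) : Prop where
  realization : IsRealization E G T u
  apartment : IsApartmentPoint E G T u y
  rational : g ∈ ratPoints (K := K) (n := n) E
  le_range : T ≤ (diagHom g).range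
  le : T ≤ G
  offset : ∀ a ∈ roots G T, ∀ x ∈ E, y a (u a x) = val F x + (C a : WithTop ℝ)
  offset_inv : ∀ a ∈ roots G T, a⁻¹ ∈ roots G T → C a⁻¹ = -C a

theorem IsApartmentPoint.exists_isCoordinatized [IsAlgClosure F K] (hu : IsRealization E G T u)
    (hy : IsApartmentPoint E G T u y) (hg : g ∈ ratPoints (K := K) (n := n) E)
    (hT : T ≤ (diagHom g).range) (hTG : T ≤ G) : ∃ C, IsCoordinatized E G T u y g C := by
  classical
  choose! C hC hC' using fun a ha => hy.exists_offset hu (a := a) ha hg hT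
  refine ⟨C, hu, hy, hg, hT, hTG, hC, fun a ha ha' => ?_⟩
  have h1 := hC a⁻¹ ha' 1 (one_mem E)
  rw [hC' a ha 1 (one_mem E) one_ne_zero, val_one, zero_add, zero_add, WithTop.coe_inj] at h1
  exact h1.symm

/-- The value of the coroot of `a` at `c`. -/
def corootElt (u : (T →* Kˣ) → K → GL (Fin n) K) (a : T →* Kˣ) (c : Kˣ) : GL (Fin n) K :=
  u a⁻¹ (-((c⁻¹ : Kˣ) : K)) * u a c * u a⁻¹ (-((c⁻¹ : Kˣ) : K)) *
    (u a 1 * u a⁻¹ (-1) * u a 1)⁻¹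

theorem corootElt_eq {ζ : Matrix.SpecialLinearGroup (Fin 2) K →* GL (Fin n) K} {a : T →* Kˣ}
    (hup : ∀ c, ζ (upperSL c) = u a c) (hlow : ∀ c, ζ (lowerSL c) = u a⁻¹ c) (c : Kˣ) :
    corootElt u a c = ζ (diagSL c) := by
  rw [corootElt, ← hup, ← hup, ← hlow, ← hlow, ← map_mul, ← map_mul, ← map_mul, ← map_mul,
    lowerSL_mul_upperSL_mul_lowerSL, mul_inv_eq_iff_eq_mul, map_mul]
  rfl

/-- The generators of the filtration subgroup of depth `l`. -/
def filtrationGens (E : IntermediateField F K) (S : Subgroup (GL (Fin n) K)) (Φ : Set (T →* Kˣ))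
    (u : (T →* Kˣ) → K → GL (Fin n) K) (y : (T →* Kˣ) → GL (Fin n) K → WithTop ℝ) (l : ℝ) :
    Set (GL (Fin n) K) :=
  torusFiltration E S l ∪ ⋃ a ∈ Φ, rootFiltration E u y a l

/-- The group generated by `S(E)_l` and the `U_a(E)_{y,l}`, `a ∈ Φ`. -/
def filtration (E : IntermediateField F K) (S : Subgroup (GL (Fin n) K)) (Φ : Set (T →* Kˣ))
    (u : (T →* Kˣ) → K → GL (Fin n) K) (y : (T →* Kˣ) → GL (Fin n) K → WithTop ℝ) (l : ℝ) :
    Subgroup (GL (Fin n) K) :=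
  Subgroup.closure (filtrationGens E S Φ u y l)

theorem torusFiltration_anti (h : k ≤ l) : torusFiltration E S l ⊆ torusFiltration E S k :=
  fun _ ⟨h1, h2, h3⟩ => ⟨h1, h2, fun χ hχ => le_trans (by exact_mod_cast h) (h3 χ hχ)⟩

theorem filtrationGens_anti (h : k ≤ l) :
    filtrationGens E S Φ u y l ⊆ filtrationGens E S Φ u y k :=
  Set.union_subset_union (torusFiltration_anti h)
    (Set.iUnion₂_mono fun _ _ => rootFiltration_anti h)

theorem filtration_anti (h : k ≤ l) : filtration E S Φ u y l ≤ filtration E S Φ u y k :=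
  Subgroup.closure_mono (filtrationGens_anti h)

theorem coe_le_add_coe {a c : ℝ} {v : WithTop ℝ} :
    (a : WithTop ℝ) ≤ v + (c : WithTop ℝ) ↔ ((a - c : ℝ) : WithTop ℝ) ≤ v := by
  induction v using WithTop.recTopCoe with
  | top => simp
  | coe v =>
    norm_cast
    exact sub_le_iff_le_add.symm

theorem IsCoordinatized.mem_rootFiltration (h : IsCoordinatized E G T u y g C) {a : T →* Kˣ}
    (ha : a ∈ roots G T) {z : GL (Fin n) K} :
    z ∈ rootFiltration E u y a l ↔
      ∃ x ∈ E, ((l - C a : ℝ) : WithTop ℝ) ≤ val F x ∧ u a x = z := by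
  constructor
  · rintro ⟨h1, h2⟩
    obtain ⟨x, hx, rfl⟩ := (h.realization.mem_rootGroup_iff ha).1 h1
    rw [h.offset a ha x hx, coe_le_add_coe] at h2
    exact ⟨x, hx, h2, rfl⟩
  · rintro ⟨x, hx, h2, rfl⟩
    refine ⟨(h.realization.mem_rootGroup_iff ha).2 ⟨x, hx, rfl⟩, ?_⟩
    rwa [h.offset a ha x hx, coe_le_add_coe]

theorem IsCoordinatized.mem_torusFiltration [Algebra.IsAlgebraic F K]
    (h : IsCoordinatized E G T u y g C) (hS : S ≤ T)
    (hl : 0 < l) {z : GL (Fin n) K} :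
    z ∈ torusFiltration E S l ↔
      ∃ x, diagHom g x = z ∧ (∀ i, (x i : K) ∈ E) ∧ z ∈ S ∧ IsCongrOne F l x := by
  constructor
  · intro hz
    obtain ⟨x, rfl⟩ := h.le_range (hS hz.2.1)
    obtain ⟨h1, h2, h3⟩ := (diagHom_mem_torusFiltration (hS.trans h.le_range) hl).1 hz
    exact ⟨x, rfl, (diagHom_mem_ratPoints h.rational).1 h1, h2, h3⟩
  · rintro ⟨x, rfl, h1, h2, h3⟩
    exact (diagHom_mem_torusFiltration (hS.trans h.le_range) hl).2
      ⟨(diagHom_mem_ratPoints h.rational).2 h1, h2, h3⟩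

theorem IsCoordinatized.inv_mem_torusFiltration [Algebra.IsAlgebraic F K]
    (h : IsCoordinatized E G T u y g C) (hS : S ≤ T) (hl : 0 < l) {z : GL (Fin n) K}
    (hz : z ∈ torusFiltration E S l) : z⁻¹ ∈ torusFiltration E S l := by
  obtain ⟨x, rfl, h1, h2, h3⟩ := (h.mem_torusFiltration hS hl).1 hz
  refine (h.mem_torusFiltration hS hl).2 ⟨x⁻¹, map_inv _ _, fun i => ?_, inv_mem h2, h3.inv hl⟩
  rw [Pi.inv_apply, Units.val_inv_eq_inv_val]
  exact inv_mem (h1 i)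

theorem IsCoordinatized.inv_mem_rootFiltration [Algebra.IsAlgebraic F K]
    (h : IsCoordinatized E G T u y g C) {a : T →* Kˣ}
    (ha : a ∈ roots G T) {z : GL (Fin n) K} (hz : z ∈ rootFiltration E u y a l) :
    z⁻¹ ∈ rootFiltration E u y a l := by
  obtain ⟨x, hx, h1, rfl⟩ := (h.mem_rootFiltration ha).1 hz
  refine (h.mem_rootFiltration ha).2 ⟨-x, neg_mem hx, ?_, h.realization.map_neg ha x⟩
  rwa [val_neg]

theorem IsCoordinatized.inv_mem_filtrationGens [Algebra.IsAlgebraic F K]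
    (h : IsCoordinatized E G T u y g C) (hΦ : Φ ⊆ roots G T) (hS : S ≤ T) (hl : 0 < l)
    {z : GL (Fin n) K} (hz : z ∈ filtrationGens E S Φ u y l) :
    z⁻¹ ∈ filtrationGens E S Φ u y l := by
  rcases hz with hz | hz
  · exact Or.inl (h.inv_mem_torusFiltration hS hl hz)
  · obtain ⟨a, ha, hz⟩ := Set.mem_iUnion₂.1 hz
    exact Or.inr (Set.mem_iUnion₂.2 ⟨a, ha, h.inv_mem_rootFiltration (hΦ ha) hz⟩)

theorem mem_filtration_of_torus {z : GL (Fin n) K} (hz : z ∈ torusFiltration E S l) :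
    z ∈ filtration E S Φ u y l := Subgroup.subset_closure (Or.inl hz)

theorem mem_filtration_of_root {a : T →* Kˣ} (ha : a ∈ Φ) {z : GL (Fin n) K}
    (hz : z ∈ rootFiltration E u y a l) : z ∈ filtration E S Φ u y l :=
  Subgroup.subset_closure (Or.inr (Set.mem_iUnion₂.2 ⟨a, ha, hz⟩))

theorem commutator_mem_symm {Γ : Type*} [Group Γ] {N : Subgroup Γ} {x z : Γ}
    (h : x * z * x⁻¹ * z⁻¹ ∈ N) : z * x * z⁻¹ * x⁻¹ ∈ N := by
  simpa [mul_assoc] using inv_mem h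

/-- Commutators of torus elements with elements of root subgroups. -/
theorem IsCoordinatized.commutator_torus_root [Algebra.IsAlgebraic F K]
    (h : IsCoordinatized E G T u y g C) (hS : S ≤ T) (hk : 0 < k) {a : T →* Kˣ}
    (ha : a ∈ roots G T) {s z : GL (Fin n) K} (hs : s ∈ torusFiltration E S k)
    (hz : z ∈ rootFiltration E u y a l) : s * z * s⁻¹ * z⁻¹ ∈ rootFiltration E u y a (k + l) := by
  obtain ⟨x, hx, h1, rfl⟩ := (h.mem_rootFiltration ha).1 hz
  obtain ⟨t, rfl, h2, h3, h4⟩ := (h.mem_torusFiltration hS hk).1 hs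
  obtain ⟨i, j, hij⟩ := exists_root_eq g ha
  have h5 := h.realization.torus_conj a ha ⟨_, hS h3⟩ x
  rw [hij] at h5
  have hmem : ((mono (Pi.single i 1 - Pi.single j 1) t : Kˣ) : K) ∈ E := by
    rw [mono_sub, mono_single, mono_single, Units.val_div_eq_div_val]
    exact div_mem (h2 i) (h2 j)
  refine (h.mem_rootFiltration ha).2
    ⟨(((mono (Pi.single i 1 - Pi.single j 1) t : Kˣ) : K) - 1) * x,
      mul_mem (sub_mem hmem (one_mem E)) hx, ?_, ?_⟩
  · rw [add_sub_assoc]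
    exact le_val_mul (h4.mono hk _) h1
  · rw [h5, ← h.realization.map_neg ha, ← h.realization.map_add a ha]
    congr 1
    ring

/-- Commutators of elements of opposite root subgroups. -/
theorem IsCoordinatized.commutator_opposite [IsAlgClosure F K]
    (h : IsCoordinatized E G T u y g C) (hS : S ≤ T)
    (hcoroot : ∀ a ∈ Φ, a⁻¹ ∈ Φ → ∀ c, corootElt u a c ∈ S) (hΦ : Φ ⊆ roots G T)
    (hk : 0 < k) (hl : 0 < l) {a : T →* Kˣ} (ha : a ∈ Φ) (ha' : a⁻¹ ∈ Φ) {z z' : GL (Fin n) K}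
    (hz : z ∈ rootFiltration E u y a k) (hz' : z' ∈ rootFiltration E u y a⁻¹ l) :
    z * z' * z⁻¹ * z'⁻¹ ∈ filtration E S Φ u y (k + l) := by
  have := infinite_intermediateField E
  have : Algebra.IsAlgebraic F K := IsAlgClosure.isAlgebraic
  obtain ⟨x, hx, hvx, rfl⟩ := (h.mem_rootFiltration (hΦ ha)).1 hz
  obtain ⟨w, hw, hvw, rfl⟩ := (h.mem_rootFiltration (hΦ ha')).1 hz'
  obtain ⟨ζ, m, hup, hlow, hsq, hm, hrat, -⟩ :=
    h.realization.exists_coroot (hΦ ha) h.rational h.le_range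
  rw [h.offset_inv a (hΦ ha) (hΦ ha')] at hvw
  have hkl : 0 < k + l := add_pos hk hl
  have hv1 : ((k + l : ℝ) : WithTop ℝ) ≤ val F (x * w) := by
    have := le_val_mul hvx hvw
    rwa [show k - C a + (l - -C a) = k + l by ring] at this
  have hv2 : ((k + l : ℝ) : WithTop ℝ) ≤ val F (x * w + x ^ 2 * w ^ 2 ) := by
    refine le_val_add hv1 ?_
    have h1 := le_val_mul hv1 hv1
    rw [show x * w * (x * w) = x ^ 2 * w ^ 2 by ring] at h1
    exact le_trans (by norm_cast; linarith) h1
  have hv3 : ((k + l : ℝ) : WithTop ℝ) ≤ val F (1 + x * w + x ^ 2 * w ^ 2 - 1) := by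
    rwa [show 1 + x * w + x ^ 2 * w ^ 2 - 1 = x * w + x ^ 2 * w ^ 2 by ring]
  have hv4 := val_eq_zero_of_sub_one hkl hv3
  have hα0 : 1 + x * w + x ^ 2 * w ^ 2 ≠ 0 := fun h0 => by
    rw [h0, val_zero] at hv4
    exact WithTop.top_ne_zero hv4
  have hαE : 1 + x * w + x ^ 2 * w ^ 2 ∈ E :=
    add_mem (add_mem (one_mem E) (mul_mem hx hw)) (mul_mem (pow_mem hx 2) (pow_mem hw 2))
  obtain ⟨α, hα⟩ : ∃ α : Kˣ, (α : K) = 1 + x * w + x ^ 2 * w ^ 2 := ⟨Units.mk0 _ hα0, rfl⟩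
  have hαinv : ((0 : ℝ) : WithTop ℝ) ≤ val F ((α⁻¹ : Kˣ) : K) := by
    rw [Units.val_inv_eq_inv_val, hα, val_inv_eq_zero hv4]
    rfl
  have hαinvE : ((α⁻¹ : Kˣ) : K) ∈ E := by
    rw [Units.val_inv_eq_inv_val, hα]
    exact inv_mem hαE
  rw [← hup, ← hlow, ← map_inv, ← map_inv, ← map_mul, ← map_mul, ← map_mul,
    commutator_upperSL_lowerSL x w α hα, map_mul, map_mul]
  refine mul_mem (mul_mem ?_ ?_) ?_
  · rw [hlow]
    refine mem_filtration_of_root ha' ((h.mem_rootFiltration (hΦ ha')).2 ⟨_, ?_, ?_, rfl⟩)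
    · exact mul_mem (mul_mem hx (pow_mem hw 2)) hαinvE
    · rw [h.offset_inv a (hΦ ha) (hΦ ha')]
      refine le_trans ?_ (le_val_mul (le_val_mul hvx (by
        rw [pow_two]; exact le_val_mul hvw hvw)) hαinv)
      norm_cast
      linarith
  · refine mem_filtration_of_torus ((h.mem_torusFiltration hS hkl).2 ⟨_, (hm α).symm, ?_, ?_, ?_⟩)
    · intro i
      rw [Units.val_zpow_eq_zpow_val, hα]
      exact zpow_mem hαE _
    · rw [← corootElt_eq hup hlow]
      exact hcoroot a ha ha' α
    · intro i
      rw [← mem_unitFiltration hkl]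
      refine zpow_mem ((mem_unitFiltration hkl).2 ?_) _
      rwa [hα]
  · rw [hup]
    refine mem_filtration_of_root ha ((h.mem_rootFiltration (hΦ ha)).2 ⟨_, ?_, ?_, rfl⟩)
    · exact neg_mem (mul_mem (mul_mem (pow_mem hx 2) hw) hαinvE)
    · rw [val_neg]
      refine le_trans ?_ (le_val_mul (le_val_mul (by
        rw [pow_two]; exact le_val_mul hvx hvx) hvw) hαinv)
      norm_cast
      linarith

theorem IsCoordinatized.commutator_gens [IsAlgClosure F K]
    (h : IsCoordinatized E G T u y g C) (hS : S ≤ T)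
    (hcoroot : ∀ a ∈ Φ, a⁻¹ ∈ Φ → ∀ c, corootElt u a c ∈ S) (hΦ : Φ ⊆ roots G T)
    (hclosed : ∀ a ∈ Φ, ∀ b ∈ Φ, ∀ p q : ℕ, a ^ p * b ^ q ∈ roots G T → a ^ p * b ^ q ∈ Φ)
    (hk : 0 < k) (hl : 0 < l) {z z' : GL (Fin n) K} (hz : z ∈ filtrationGens E S Φ u y k)
    (hz' : z' ∈ filtrationGens E S Φ u y l) :
    z * z' * z⁻¹ * z'⁻¹ ∈ filtration E S Φ u y (k + l) := by
  have : Algebra.IsAlgebraic F K := IsAlgClosure.isAlgebraic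
  rcases hz with hz | hz <;> rcases hz' with hz' | hz'
  · obtain ⟨x, rfl⟩ := h.le_range (hS hz.2.1)
    obtain ⟨x', rfl⟩ := h.le_range (hS hz'.2.1)
    rw [← map_mul, ← map_inv, ← map_inv, ← map_mul, ← map_mul, mul_right_comm,
      mul_inv_cancel_right, mul_inv_cancel, map_one]
    exact one_mem _
  · obtain ⟨a, ha, hz'⟩ := Set.mem_iUnion₂.1 hz'
    exact mem_filtration_of_root ha (h.commutator_torus_root hS hk (hΦ ha) hz hz')
  · obtain ⟨a, ha, hz⟩ := Set.mem_iUnion₂.1 hz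
    refine commutator_mem_symm (mem_filtration_of_root ha ?_)
    rw [add_comm]
    exact h.commutator_torus_root hS hl (hΦ ha) hz' hz
  · obtain ⟨a, ha, hz⟩ := Set.mem_iUnion₂.1 hz
    obtain ⟨b, hb, hz'⟩ := Set.mem_iUnion₂.1 hz'
    by_cases hab : b = a⁻¹
    · subst hab
      exact h.commutator_opposite hS hcoroot hΦ hk hl ha hb hz hz'
    · refine (Subgroup.closure_le _).2 ?_
        (h.apartment.commutator a (hΦ ha) b (hΦ hb) hab k l z hz.1 hz.2 z' hz'.1 hz'.2)
      rintro w ⟨p, q, hp, hq, hpq, hw, hv⟩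
      refine mem_filtration_of_root (hclosed a ha b hb p q hpq) ⟨hw, le_trans ?_ hv⟩
      have hp' : (1 : ℝ) ≤ p := by exact_mod_cast hp
      have hq' : (1 : ℝ) ≤ q := by exact_mod_cast hq
      have h1 := mul_le_mul_of_nonneg_right hp' hk.le
      have h2 := mul_le_mul_of_nonneg_right hq' hl.le
      exact_mod_cast (by linarith : k + l ≤ p * k + q * l)

/-- The filtration subgroups satisfy `[MP_k, MP_l] ⊆ MP_{k+l}`. -/
theorem IsCoordinatized.commutator_filtration [IsAlgClosure F K]
    (h : IsCoordinatized E G T u y g C) (hS : S ≤ T)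
    (hcoroot : ∀ a ∈ Φ, a⁻¹ ∈ Φ → ∀ c, corootElt u a c ∈ S) (hΦ : Φ ⊆ roots G T)
    (hclosed : ∀ a ∈ Φ, ∀ b ∈ Φ, ∀ p q : ℕ, a ^ p * b ^ q ∈ roots G T → a ^ p * b ^ q ∈ Φ)
    (hk : 0 < k) (hl : 0 < l) {z z' : GL (Fin n) K} (hz : z ∈ filtration E S Φ u y k)
    (hz' : z' ∈ filtration E S Φ u y l) :
    z * z' * z⁻¹ * z'⁻¹ ∈ filtration E S Φ u y (k + l) := by
  have : Algebra.IsAlgebraic F K := IsAlgClosure.isAlgebraic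
  have hnorm : ∀ {m l : ℝ}, 0 < m → 0 < l → filtrationGens E S Φ u y m ⊆
      Subgroup.normalizer (filtration E S Φ u y l : Set (GL (Fin n) K)) := by
    intro m l hm hl
    refine subset_normalizer_closure (fun a ha => h.inv_mem_filtrationGens hΦ hS hm ha)
      fun a ha b hb => ?_
    have h1 := filtration_anti (by linarith : l ≤ m + l)
      (h.commutator_gens hS hcoroot hΦ hclosed hm hl ha hb)
    have h2 := mul_mem h1 (Subgroup.subset_closure hb)
    rwa [inv_mul_cancel_right] at h2
  exact commutator_mem_of_closure (hnorm hk (add_pos hk hl)) (hnorm hl (add_pos hk hl))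
    (fun a ha b hb => h.commutator_gens hS hcoroot hΦ hclosed hk hl ha hb) hz hz'

end Filtration

section Weights

variable {K : Type*} [Field K] {n : ℕ}

theorem eq_zero_of_forall_zpow_eq_one [Infinite K] {m : ℤ} (h : ∀ c : Kˣ, c ^ m = 1) : m = 0 := by
  by_contra hm
  have h1 : (Polynomial.X : Polynomial K) * (Polynomial.X ^ m.natAbs - Polynomial.C 1) = 0 := by
    refine Polynomial.funext fun c => ?_
    by_cases hc : c = 0
    · simp [hc]
    · have h2 : (Units.mk0 c hc) ^ m.natAbs = 1 := by
        rcases Int.natAbs_eq m with h' | h' <;>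
        · have h3 := h (Units.mk0 c hc)
          rw [h'] at h3
          simpa using h3
      have h3 := congrArg Units.val h2
      rw [Units.val_pow_eq_pow_val, Units.val_mk0, Units.val_one] at h3
      simp [h3]
  exact (mul_ne_zero Polynomial.X_ne_zero
    (Polynomial.X_pow_sub_C_ne_zero (Int.natAbs_pos.2 hm) 1)) h1

theorem mono_zpow (k v : Fin n → ℤ) (c : Kˣ) :
    mono v (fun i => c ^ k i) = c ^ ∑ i, v i * k i := by
  have h : ∀ s : Finset (Fin n), ∏ i ∈ s, (c ^ k i) ^ v i = c ^ ∑ i ∈ s, v i * k i := by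
    intro s
    induction s using Finset.induction_on with
    | empty => simp
    | insert i s hi ih =>
      rw [Finset.prod_insert hi, Finset.sum_insert hi, ih, zpow_add, mul_comm (v i), zpow_mul]
  exact h Finset.univ

end Weights

section Triangular

variable {F : Type*} [Field F] [ValuativeRel F] [TopologicalSpace F] [IsNonarchimedeanLocalField F]
  {K : Type*} [Field K] [Algebra F K] {n : ℕ} {E : IntermediateField F K}
  {G T : Subgroup (GL (Fin n) K)} {u : (T →* Kˣ) → K → GL (Fin n) K}
  {y : (T →* Kˣ) → GL (Fin n) K → WithTop ℝ} {g : GL (Fin n) K} {C : (T →* Kˣ) → ℝ}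
  {Φ : Set (T →* Kˣ)} {S : Subgroup (GL (Fin n) K)} {k l : ℝ}

/-- The `(i, j)` matrix entry has weight `a ^ m` under conjugation by `T`. -/
def HasWeight (g : GL (Fin n) K) (a : T →* Kˣ) (i j : Fin n) (m : ℕ) : Prop :=
  ∀ (x : Fin n → Kˣ) (hx : diagHom g x ∈ T), mono (Pi.single i 1 - Pi.single j 1) x = a ⟨_, hx⟩ ^ m

/-- A generic cocharacter of `T` (with real coefficients). -/
theorem IsCoordinatized.exists_weights [IsAlgClosure F K] (h : IsCoordinatized E G T u y g C) :
    ∃ lam : Fin n → ℝ, ∀ a ∈ roots G T, ∃ w : ℝ, w ≠ 0 ∧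
      ∀ i j m, HasWeight g a i j m → lam i - lam j = m * w := by
  have := infinite_intermediateField E
  have hKinf : Infinite K := Infinite.of_injective _ (algebraMap E K).injective
  let L : Submodule ℝ (Fin n → ℝ) :=
    ⨅ v ∈ relations (T.comap (diagHom g)), LinearMap.ker (∑ i, (v i : ℝ) • LinearMap.proj i)
  have hL : ∀ lam : Fin n → ℝ, lam ∈ L ↔
      ∀ v ∈ relations (T.comap (diagHom g)), ∑ i, (v i : ℝ) * lam i = 0 := by
    intro lam
    simp only [L, Submodule.mem_iInf, LinearMap.mem_ker, LinearMap.sum_apply,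
      LinearMap.smul_apply, LinearMap.proj_apply, smul_eq_mul]
  let f : Fin n → Fin n → Module.Dual ℝ (Fin n → ℝ) := fun i j =>
    LinearMap.proj (R := ℝ) (φ := fun _ : Fin n => ℝ) i - LinearMap.proj j
  have hf : ∀ i j lam, f i j lam = lam i - lam j := fun i j lam => LinearMap.sub_apply _ _ _
  let ι := {ij : Fin n × Fin n // ∃ lam ∈ L, lam ij.1 - lam ij.2 ≠ 0}
  obtain ⟨lam, hlamL, hlam⟩ := Module.Dual.exists_forall_mem_ne_zero_of_forall_exists L
    (fun ij : ι => f ij.1.1 ij.1.2) (by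
    rintro ⟨ij, lam, hlam, hne⟩
    exact ⟨lam, hlam, by rwa [hf]⟩)
  simp only [hf] at hlam
  refine ⟨lam, fun a ha => ?_⟩
  obtain ⟨p, q, hpq⟩ := exists_root_eq g ha
  refine ⟨lam p - lam q, ?_, fun i j m hm => ?_⟩
  · obtain ⟨ζ, κ, -, -, hsq, hκ, -⟩ := h.realization.exists_coroot ha h.rational h.le_range
    refine hlam ⟨(p, q), fun i => (κ i : ℝ), ?_, ?_⟩
    · rw [hL]
      intro v hv
      have : ∑ i, v i * κ i = 0 := by
        refine eq_zero_of_forall_zpow_eq_one (K := K) fun c => ?_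
        rw [← mono_zpow]
        refine mem_relations.1 hv _ ?_
        rw [Subgroup.mem_comap, ← hκ]
        exact (hsq c).1
      exact_mod_cast this
    · intro h0
      have h1 : κ p = κ q := by
        have h0' : (κ p : ℝ) - κ q = 0 := h0
        exact_mod_cast sub_eq_zero.1 h0'
      have : (2 : ℤ) = 0 := by
        refine eq_zero_of_forall_zpow_eq_one (K := K) fun c => ?_
        obtain ⟨hc, hac⟩ := hsq c
        have h2 : diagHom g (fun i => c ^ κ i) ∈ T := by rwa [← hκ]
        have h3 : a ⟨_, hc⟩ = a ⟨_, h2⟩ := by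
          congr 1
          exact Subtype.ext (hκ c)
        rw [h3, hpq, mono_sub, mono_single, mono_single, h1, div_self', Units.val_one]
          at hac
        refine Units.ext ?_
        rw [zpow_ofNat, Units.val_pow_eq_pow_val, ← hac, Units.val_one]
      norm_num at this
  · have h1 := (hL lam).1 hlamL ((Pi.single i 1 - Pi.single j 1) -
      (m : ℤ) • (Pi.single p 1 - Pi.single q 1)) fun x hx => by
        rw [mono_sub, mono_smul, ← hpq x hx, hm x hx, zpow_natCast, div_self']
    have h2 : ∀ i' : Fin n, ∑ i, ((Pi.single i' 1 : Fin n → ℤ) i : ℝ) * lam i = lam i' := by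
      intro i'
      rw [Finset.sum_eq_single i']
      · simp
      · intro b _ hb
        simp [hb]
      · simp
    simp only [Pi.sub_apply, Pi.smul_apply, smul_eq_mul, Int.cast_sub, Int.cast_mul,
      Int.cast_natCast, sub_mul, mul_assoc, mul_sub, Finset.sum_sub_distrib, ← Finset.mul_sum,
      h2] at h1
    rw [mul_sub]
    linarith

theorem exists_val_bound {ι : Type*} (s : Finset ι) (f : ι → K) :
    ∃ B : ℝ, 0 ≤ B ∧ ∀ i ∈ s, ((-B : ℝ) : WithTop ℝ) ≤ val F (f i) := by
  classical
  induction s using Finset.induction_on with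
  | empty => exact ⟨0, le_rfl, by simp⟩
  | insert i s _ ih =>
    obtain ⟨B, hB, h⟩ := ih
    by_cases hi : f i = 0
    · refine ⟨B, hB, fun j hj => ?_⟩
      rcases Finset.mem_insert.1 hj with rfl | hj
      · rw [hi, val_zero]; exact le_top
      · exact h j hj
    · obtain ⟨v, hv⟩ := exists_val_eq (F := F) hi
      refine ⟨max B (-v), le_max_of_le_left hB, fun j hj => ?_⟩
      rcases Finset.mem_insert.1 hj with rfl | hj
      · rw [hv]
        norm_cast
        linarith [le_max_right B (-v)]
      · refine le_trans ?_ (h j hj)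
        norm_cast
        linarith [le_max_left B (-v)]

/-- The matrix entries of the elements of a root subgroup. -/
theorem IsCoordinatized.exists_entries [IsAlgClosure F K] (h : IsCoordinatized E G T u y g C)
    {a : T →* Kˣ} (ha : a ∈ roots G T) :
    ∃ B : ℝ, 0 ≤ B ∧ ∀ (c : K) (i j : Fin n),
      (((g * u a c * g⁻¹ : GL (Fin n) K) - 1 : Matrix (Fin n) (Fin n) K) i j ≠ 0 →
        ∃ m, 1 ≤ m ∧ HasWeight g a i j m) ∧
      ∀ v w : ℝ, (v : WithTop ℝ) ≤ val F c → (∀ m, 1 ≤ m → HasWeight g a i j m → w ≤ m * v - B) →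
        (w : WithTop ℝ) ≤
          val F (((g * u a c * g⁻¹ : GL (Fin n) K) - 1 : Matrix (Fin n) (Fin n) K) i j) := by
  have := infinite_intermediateField E
  have : Algebra.IsAlgebraic F K := IsAlgClosure.isAlgebraic
  have hKinf : Infinite K := Infinite.of_injective _ (algebraMap E K).injective
  have hQ : ∀ i j, ∃ Q : Polynomial K, ∀ c,
      ((g * u a c * g⁻¹ : GL (Fin n) K) : Matrix (Fin n) (Fin n) K) i j = Q.eval c := by
    intro i j
    have hu : ∀ i j, (fun c => (u a c : Matrix (Fin n) (Fin n) K) i j) ∈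
        Algebra.adjoin K {fun c : K => c} := by
      intro i j
      obtain ⟨P, hP⟩ := h.realization.regular a ha i j
      simp only [hP, Polynomial.aeval_def, ← Polynomial.eval_map]
      exact eval_mem (f := fun c : K => c) (Algebra.subset_adjoin (Set.mem_singleton _)) _
    have hmem : (fun c => ((g : Matrix (Fin n) (Fin n) K) *
        (u a c : Matrix (Fin n) (Fin n) K) * ((g⁻¹ : GL (Fin n) K) : Matrix (Fin n) (Fin n) K)) i j) ∈
          Algebra.adjoin K {fun c : K => c} :=
      mul_entries_mem (M := fun c => (g : Matrix (Fin n) (Fin n) K) * (u a c : Matrix (Fin n) (Fin n) K))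
        (mul_entries_mem (M := fun _ => (g : Matrix (Fin n) (Fin n) K))
          (fun i j => const_mem _ _) hu)
        (M' := fun _ => ((g⁻¹ : GL (Fin n) K) : Matrix (Fin n) (Fin n) K))
        (fun i j => const_mem _ _) i j
    obtain ⟨Q, hQ⟩ := exists_eval_of_mem_adjoin hmem
    exact ⟨Q, fun c => by rw [Units.val_mul, Units.val_mul]; exact hQ c⟩
  choose Q hQ using hQ
  have hcoeff : ∀ i j m, (Q i j).coeff m ≠ 0 → HasWeight g a i j m := by
    intro i j m hm x hx
    have h1 : (Q i j).comp (Polynomial.C (a ⟨_, hx⟩ : K) * Polynomial.X) =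
        Polynomial.C ((mono (Pi.single i 1 - Pi.single j 1) x : Kˣ) : K) * Q i j := by
      refine Polynomial.funext fun c => ?_
      simp only [Polynomial.eval_comp, Polynomial.eval_mul, Polynomial.eval_C, Polynomial.eval_X]
      rw [← hQ, ← hQ, ← h.realization.torus_conj a ha ⟨_, hx⟩]
      have h2 : g * (diagHom g x * u a c * (diagHom g x)⁻¹) * g⁻¹ =
          (g * diagHom g x * g⁻¹) * (g * u a c * g⁻¹) * (g * diagHom g x⁻¹ * g⁻¹) := by
        rw [map_inv]; group
      change ((g * (diagHom g x * u a c * (diagHom g x)⁻¹) * g⁻¹ : GL (Fin n) K) :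
        Matrix (Fin n) (Fin n) K) i j = _
      rw [h2, Units.val_mul _ (g * diagHom g x⁻¹ * g⁻¹), Units.val_mul _ (g * u a c * g⁻¹),
        coe_conj_diagHom, coe_conj_diagHom,
        Matrix.mul_diagonal, Matrix.diagonal_mul, mono_sub, mono_single, mono_single,
        Units.val_div_eq_div_val, Pi.inv_apply, Units.val_inv_eq_inv_val]
      ring
    have h2 := congrArg (fun f => Polynomial.coeff f m) h1
    simp only [Polynomial.comp_C_mul_X_coeff, Polynomial.coeff_C_mul] at h2
    refine Units.ext ?_
    rw [Units.val_pow_eq_pow_val]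
    exact mul_right_cancel₀ hm (by rw [← h2]; ring)
  have hzero : ∀ i j, (Q i j).coeff 0 = (1 : Matrix (Fin n) (Fin n) K) i j := by
    intro i j
    rw [Polynomial.coeff_zero_eq_eval_zero, ← hQ, h.realization.map_zero ha, mul_one,
      mul_inv_cancel, Units.val_one]
  have hsum : ∀ c i j, ((g * u a c * g⁻¹ : GL (Fin n) K) - 1 : Matrix (Fin n) (Fin n) K) i j =
      ∑ m ∈ Finset.range ((Q i j).natDegree), (Q i j).coeff (m + 1) * c ^ (m + 1) := by
    intro c i j
    rw [Matrix.sub_apply, hQ, Polynomial.eval_eq_sum_range, Finset.sum_range_succ', hzero, pow_zero,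
      mul_one, add_sub_cancel_right]
  obtain ⟨B, hB, hBQ⟩ := exists_val_bound (F := F) (Finset.univ.sigma fun ij : Fin n × Fin n =>
    Finset.range ((Q ij.1 ij.2).natDegree + 1)) fun p => (Q p.1.1 p.1.2).coeff p.2
  refine ⟨B, hB, fun c i j => ⟨fun hne => ?_, fun v w hv hw => ?_⟩⟩
  · rw [hsum] at hne
    obtain ⟨m, -, hm⟩ := Finset.exists_ne_zero_of_sum_ne_zero hne
    exact ⟨m + 1, by omega, hcoeff i j _ (left_ne_zero_of_mul hm)⟩
  · rw [hsum]
    refine le_val_sum _ _ fun m hm => ?_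
    by_cases h0 : (Q i j).coeff (m + 1) = 0
    · rw [h0, zero_mul, val_zero]
      exact le_top
    · have h1 := hw (m + 1) (by omega) (hcoeff i j _ h0)
      have h2 := hBQ ⟨(i, j), m + 1⟩ (Finset.mem_sigma.2 ⟨Finset.mem_univ _, Finset.mem_range.2 (by
        have := Finset.mem_range.1 hm
        simp only
        omega)⟩)
      have h3 : (((m + 1 : ℕ) * v : ℝ) : WithTop ℝ) ≤ val F (c ^ (m + 1)) := by
        rw [val_pow]
        have := nsmul_le_nsmul_right hv (m + 1)
        refine le_trans (le_of_eq ?_) this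
        rw [← WithTop.coe_nsmul, nsmul_eq_mul]
      refine le_trans ?_ (le_val_mul h2 h3)
      norm_cast
      linarith

theorem finite_roots (hT : T ≤ (diagHom g).range) : (roots G T).Finite := by
  choose p q hpq using fun a : roots G T => exists_root_eq g a.2
  refine Set.finite_coe_iff.1 (Finite.of_injective (fun a => (p a, q a)) fun a b hab => ?_)
  refine Subtype.ext (MonoidHom.ext ?_)
  rintro ⟨t, ht⟩
  obtain ⟨x, rfl⟩ := hT ht
  simp only [Prod.mk.injEq] at hab
  rw [hpq a, hpq b, hab.1, hab.2]

/-- Unipotent matrices which are triangular for the ordering given by `lam`, with entries bounded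
in terms of `D`. -/
def triangular (F : Type*) [Field F] [ValuativeRel F] [TopologicalSpace F]
    [IsNonarchimedeanLocalField F] {K : Type*} [Field K] [Algebra F K] [Algebra.IsAlgebraic F K]
    {n : ℕ} (lam : Fin n → ℝ) (D : ℝ) : Submonoid (Matrix (Fin n) (Fin n) K) where
  carrier := {M | ∀ i j, ((M - 1) i j ≠ 0 → lam j < lam i) ∧
    ((-(D * (lam i - lam j)) : ℝ) : WithTop ℝ) ≤ val F (M i j)}
  one_mem' i j := by
    refine ⟨fun h => by simp at h, ?_⟩
    rw [Matrix.one_apply]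
    split_ifs with hij
    · rw [hij, val_one]
      simp
    · rw [val_zero]; exact le_top
  mul_mem' := by
    intro M M' hM hM' i j
    constructor
    · intro hne
      have h1 : M * M' - 1 = (M - 1) * (M' - 1) + (M - 1) + (M' - 1) := by noncomm_ring
      rw [h1] at hne
      by_contra hij
      have h2 : (M - 1) i j = 0 := by
        by_contra h; exact hij ((hM i j).1 h)
      have h3 : (M' - 1) i j = 0 := by
        by_contra h; exact hij ((hM' i j).1 h)
      rw [Matrix.add_apply, Matrix.add_apply, h2, h3, add_zero, add_zero, Matrix.mul_apply] at hne
      obtain ⟨m, -, hm⟩ := Finset.exists_ne_zero_of_sum_ne_zero hne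
      exact hij (((hM' m j).1 (right_ne_zero_of_mul hm)).trans
        ((hM i m).1 (left_ne_zero_of_mul hm)))
    · rw [Matrix.mul_apply]
      refine le_val_sum _ _ fun m _ => ?_
      have := le_val_mul (hM i m).2 (hM' m j).2
      rwa [show -(D * (lam i - lam m)) + -(D * (lam m - lam j)) = -(D * (lam i - lam j)) by ring]
        at this

theorem apply_self_of_mem_triangular [Algebra.IsAlgebraic F K] {lam : Fin n → ℝ} {D : ℝ}
    {M : Matrix (Fin n) (Fin n) K} (hM : M ∈ triangular F lam D) (i : Fin n) : M i i = 1 := by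
  have : (M - 1) i i = 0 := by
    by_contra h
    exact lt_irrefl _ ((hM i i).1 h)
  rwa [Matrix.sub_apply, Matrix.one_apply_eq, sub_eq_zero] at this

/-- The matrices congruent to `1` modulo `𝔭_N`. -/
def congruence (F : Type*) [Field F] [ValuativeRel F] [TopologicalSpace F]
    [IsNonarchimedeanLocalField F] {K : Type*} [Field K] [Algebra F K] [Algebra.IsAlgebraic F K]
    (n : ℕ) {N : ℝ} (hN : 0 ≤ N) : Submonoid (Matrix (Fin n) (Fin n) K) where
  carrier := {M | ∀ i j, (N : WithTop ℝ) ≤ val F ((M - 1) i j)}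
  one_mem' i j := by simp
  mul_mem' := by
    intro M M' hM hM' i j
    have h1 : M * M' - 1 = (M - 1) * (M' - 1) + (M - 1) + (M' - 1) := by noncomm_ring
    rw [h1]
    refine le_val_add (le_val_add ?_ (hM i j)) (hM' i j)
    rw [Matrix.mul_apply]
    refine le_val_sum _ _ fun m _ => ?_
    refine le_trans ?_ (le_val_mul (hM i m) (hM' m j))
    norm_cast
    linarith

/-- Conjugates by `g` of the elements of the group generated by a symmetric set lie in
a submonoid if the conjugates of the generators do. -/
theorem conj_mem_of_mem_closure {A : Set (GL (Fin n) K)} (hinv : ∀ a ∈ A, a⁻¹ ∈ A)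
    {M : Submonoid (Matrix (Fin n) (Fin n) K)} (g : GL (Fin n) K)
    (hM : ∀ a ∈ A, ((g * a * g⁻¹ : GL (Fin n) K) : Matrix (Fin n) (Fin n) K) ∈ M)
    {x : GL (Fin n) K} (hx : x ∈ Subgroup.closure A) :
    ((g * x * g⁻¹ : GL (Fin n) K) : Matrix (Fin n) (Fin n) K) ∈ M := by
  rw [← Subgroup.mem_toSubmonoid, Subgroup.closure_toSubmonoid, Set.union_eq_left.2 (fun a ha => by
    simpa using hinv _ ha)] at hx
  induction hx using Submonoid.closure_induction with
  | mem a ha => exact hM a ha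
  | one => simp [M.one_mem]
  | mul a b _ _ iha ihb =>
    have := mul_mem iha ihb
    rwa [← Units.val_mul, show g * a * g⁻¹ * (g * b * g⁻¹) = g * (a * b) * g⁻¹ by group] at this

end Triangular

section Decomposition

variable {F : Type*} [Field F] [ValuativeRel F] [TopologicalSpace F] [IsNonarchimedeanLocalField F]
  {K : Type*} [Field K] [Algebra F K] {n : ℕ} {E : IntermediateField F K}
  {G T : Subgroup (GL (Fin n) K)} {u : (T →* Kˣ) → K → GL (Fin n) K}
  {y : (T →* Kˣ) → GL (Fin n) K → WithTop ℝ} {g : GL (Fin n) K} {C : (T →* Kˣ) → ℝ}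
  {Φ : Set (T →* Kˣ)} {S : Subgroup (GL (Fin n) K)} {s : ℝ}

theorem triangular_mono [Algebra.IsAlgebraic F K] {lam : Fin n → ℝ} {D D' : ℝ} (hD : D ≤ D') :
    triangular (K := K) F lam D ≤ triangular F lam D' := by
  intro M hM i j
  refine ⟨(hM i j).1, ?_⟩
  by_cases h : (M - 1) i j = 0
  · by_cases hij : i = j
    · subst hij
      rw [apply_self_of_mem_triangular hM, val_one, sub_self, mul_zero, neg_zero]
      rfl
    · rw [Matrix.sub_apply, Matrix.one_apply_ne hij, sub_zero] at h
      rw [h, val_zero]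
      exact le_top
  · refine le_trans ?_ (hM i j).2
    have h1 := (hM i j).1 h
    have h2 := mul_le_mul_of_nonneg_right hD (sub_nonneg.2 h1.le)
    exact_mod_cast neg_le_neg h2

theorem exists_upper_bound {ι : Type*} {A : Set ι} (hA : A.Finite) {P : ι → ℝ → Prop}
    (hP : ∀ a ∈ A, ∃ D, P a D) (hmono : ∀ a D D', D ≤ D' → P a D → P a D') :
    ∃ D, 0 ≤ D ∧ ∀ a ∈ A, P a D := by
  choose! D hD using hP
  obtain ⟨D', hD'⟩ := (hA.image D).bddAbove
  exact ⟨max D' 0, le_max_right _ _, fun a ha => hmono a _ _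
    ((hD' ⟨a, ha, rfl⟩).trans (le_max_left _ _)) (hD a ha)⟩

/-- The root subgroups of positive weight are triangular, uniformly in their elements. -/
theorem IsCoordinatized.exists_triangular_bound [IsAlgClosure F K] [Algebra.IsAlgebraic F K]
    (h : IsCoordinatized E G T u y g C) {lam : Fin n → ℝ} {w : (T →* Kˣ) → ℝ}
    (hlam : ∀ a ∈ roots G T, ∀ i j m, HasWeight g a i j m → lam i - lam j = m * w a) (s : ℝ) :
    ∃ D : ℝ, 0 ≤ D ∧ ∀ a ∈ roots G T, 0 < w a → ∀ z ∈ rootFiltration E u y a s,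
      ((g * z * g⁻¹ : GL (Fin n) K) : Matrix (Fin n) (Fin n) K) ∈ triangular F lam D := by
  refine exists_upper_bound (finite_roots h.le_range) (fun a ha => ?_)
    fun a D D' hD hP hw z hz => triangular_mono hD (hP hw z hz)
  obtain ⟨B, hB, hent⟩ := h.exists_entries ha
  refine ⟨(B + |s - C a|) / w a, fun hw z hz i j => ?_⟩
  obtain ⟨c, hc, hv, rfl⟩ := (h.mem_rootFiltration ha).1 hz
  obtain ⟨h1, h2⟩ := hent c i j
  constructor
  · intro hne
    obtain ⟨m, hm, hwt⟩ := h1 hne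
    have h3 := hlam a ha i j m hwt
    have hm' : (0 : ℝ) < m := by exact_mod_cast hm
    have := mul_pos hm' hw
    linarith
  · have h3 := h2 (s - C a) (-((B + |s - C a|) / w a * (lam i - lam j))) hv (fun m hm hwt => by
      rw [hlam a ha i j m hwt, show (B + |s - C a|) / w a * (m * w a) = (B + |s - C a|) * m by
        field_simp]
      have hm' : (1 : ℝ) ≤ m := by exact_mod_cast hm
      have h4 := neg_abs_le (s - C a)
      nlinarith)
    have h4 : ((g * u a c * g⁻¹ : GL (Fin n) K) : Matrix (Fin n) (Fin n) K) i j =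
        ((g * u a c * g⁻¹ : GL (Fin n) K) - 1 : Matrix (Fin n) (Fin n) K) i j +
          (1 : Matrix (Fin n) (Fin n) K) i j := by rw [Matrix.sub_apply, sub_add_cancel]
    rw [h4]
    refine le_val_add h3 ?_
    by_cases hij : i = j
    · subst hij
      rw [Matrix.one_apply_eq, val_one, sub_self, mul_zero, neg_zero]
      rfl
    · rw [Matrix.one_apply_ne hij, val_zero]
      exact le_top

/-- Elements of large depth are close to `1`. -/
theorem IsCoordinatized.exists_congruence_bound [IsAlgClosure F K] [Algebra.IsAlgebraic F K]
    (h : IsCoordinatized E G T u y g C) (hΦ : Φ ⊆ roots G T) (hS : S ≤ T) :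
    ∃ D : ℝ, 0 ≤ D ∧ ∀ N, D + 1 ≤ N → ∀ z ∈ filtration E S Φ u y N, ∀ i j,
      ((N - D : ℝ) : WithTop ℝ) ≤
        val F (((g * z * g⁻¹ : GL (Fin n) K) - 1 : Matrix (Fin n) (Fin n) K) i j) := by
  obtain ⟨D, hD0, hD⟩ := exists_upper_bound (finite_roots (G := G) h.le_range)
    (P := fun a D => ∀ N, D ≤ N → ∀ z ∈ rootFiltration E u y a N, ∀ i j, ((N - D : ℝ) : WithTop ℝ) ≤
        val F (((g * z * g⁻¹ : GL (Fin n) K) - 1 : Matrix (Fin n) (Fin n) K) i j))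
    (fun a ha => by
      obtain ⟨B, hB, hent⟩ := h.exists_entries ha
      refine ⟨C a + B, fun N hN z hz i j => ?_⟩
      obtain ⟨c, hc, hv, rfl⟩ := (h.mem_rootFiltration ha).1 hz
      refine (hent c i j).2 _ _ hv fun m hm _ => ?_
      have hm' : (1 : ℝ) ≤ m := by exact_mod_cast hm
      nlinarith)
    (fun a D D' hDD' hP N hN z hz i j => by
      refine le_trans ?_ (hP N (hDD'.trans hN) z hz i j)
      norm_cast
      linarith)
  refine ⟨D, hD0, fun N hN z hz => ?_⟩
  have hN0 : 0 < N := by linarith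
  have hND : 0 ≤ N - D := by linarith
  refine conj_mem_of_mem_closure (M := congruence F n hND)
    (fun a ha => h.inv_mem_filtrationGens hΦ hS hN0 ha) g (fun a ha i j => ?_) hz
  rcases ha with ha | ha
  · obtain ⟨x, rfl, -, -, hx⟩ := (h.mem_torusFiltration hS hN0).1 ha
    rw [coe_conj_diagHom, Matrix.sub_apply]
    by_cases hij : i = j
    · subst hij
      rw [Matrix.diagonal_apply_eq, Matrix.one_apply_eq]
      refine le_trans ?_ (hx i)
      norm_cast
      linarith
    · rw [Matrix.diagonal_apply_ne _ hij, Matrix.one_apply_ne hij, sub_zero, val_zero]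
      exact le_top
  · obtain ⟨b, hb, ha⟩ := Set.mem_iUnion₂.1 ha
    exact hD b (hΦ hb) N (by linarith) a ha i j

/-- The group generated by the `U_a(E)_{y,s}` with `0 < w a`. -/
def positivePart (E : IntermediateField F K) (Φ : Set (T →* Kˣ))
    (u : (T →* Kˣ) → K → GL (Fin n) K) (y : (T →* Kˣ) → GL (Fin n) K → WithTop ℝ)
    (w : (T →* Kˣ) → ℝ) (s : ℝ) : Subgroup (GL (Fin n) K) :=
  Subgroup.closure (⋃ a ∈ {a ∈ Φ | 0 < w a}, rootFiltration E u y a s)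

theorem positivePart_le {w : (T →* Kˣ) → ℝ} :
    positivePart E Φ u y w s ≤ filtration E S Φ u y s :=
  Subgroup.closure_mono fun _ hz => Or.inr
    (Set.biUnion_subset_biUnion_left (fun _ ha => ha.1) hz)

/-- Approximate Iwahori decomposition. -/
theorem IsCoordinatized.exists_decomposition [IsAlgClosure F K]
    (h : IsCoordinatized E G T u y g C) (hS : S ≤ T)
    (hcoroot : ∀ a ∈ Φ, a⁻¹ ∈ Φ → ∀ c, corootElt u a c ∈ S) (hΦ : Φ ⊆ roots G T)
    (hclosed : ∀ a ∈ Φ, ∀ b ∈ Φ, ∀ p q : ℕ, a ^ p * b ^ q ∈ roots G T → a ^ p * b ^ q ∈ Φ)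
    (hs : 0 < s) {w : (T →* Kˣ) → ℝ} (hw : ∀ a ∈ Φ, w a ≠ 0) (j : ℕ) {x : GL (Fin n) K}
    (hx : x ∈ filtration E S Φ u y s) :
    ∃ p ∈ positivePart E Φ u y (-w) s, ∃ t ∈ Subgroup.closure (torusFiltration E S s),
      ∃ q ∈ positivePart E Φ u y w s, ∃ z ∈ filtration E S Φ u y (s + j * s),
        x = p * t * q * z := by
  have : Algebra.IsAlgebraic F K := IsAlgClosure.isAlgebraic
  have htorus : Subgroup.closure (torusFiltration E S s) ≤ filtration E S Φ u y s :=
    Subgroup.closure_mono fun _ hz => Or.inl hz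
  induction j with
  | zero => exact ⟨1, one_mem _, 1, one_mem _, 1, one_mem _, x, by simpa using hx, by simp⟩
  | succ j ih =>
    set k : ℝ := s + j * s with hk
    have hsk : s ≤ k := by
      have : (0 : ℝ) ≤ j * s := by positivity
      linarith
    have hk0 : 0 < k := hs.trans_le hsk
    have hks : s + ((j + 1 : ℕ) : ℝ) * s = k + s := by
      push_cast
      rw [hk]; ring
    rw [hks]
    let D : Set (GL (Fin n) K) := {x | ∃ p ∈ positivePart E Φ u y (-w) s,
      ∃ t ∈ Subgroup.closure (torusFiltration E S s),
      ∃ q ∈ positivePart E Φ u y w s, ∃ z ∈ filtration E S Φ u y (k + s), x = p * t * q * z}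
    have hcomm : ∀ {a b}, a ∈ filtration E S Φ u y s → b ∈ filtration E S Φ u y k →
        a⁻¹ * b⁻¹ * a * b ∈ filtration E S Φ u y (k + s) := by
      intro a b ha hb
      have := h.commutator_filtration hS hcoroot hΦ hclosed hs hk0 (inv_mem ha) (inv_mem hb)
      rwa [inv_inv, inv_inv, add_comm] at this
    have hgen : ∀ d ∈ D, ∀ b ∈ filtrationGens E S Φ u y k, d * b ∈ D := by
      rintro _ ⟨p, hp, t, ht, q, hq, z, hz, rfl⟩ b hb
      have hbk : b ∈ filtration E S Φ u y k := Subgroup.subset_closure hb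
      have hz' : b⁻¹ * z * b ∈ filtration E S Φ u y (k + s) := by
        have h1 := h.commutator_filtration hS hcoroot hΦ hclosed hk0 (add_pos hk0 hs)
          (inv_mem hbk) hz
        have h2 := mul_mem (filtration_anti (by linarith) h1) hz
        rwa [inv_inv, inv_mul_cancel_right] at h2
      rcases hb with hb | hb
      · refine ⟨p, hp, t * b, mul_mem ht (Subgroup.subset_closure (torusFiltration_anti hsk hb)),
          q, hq, (q⁻¹ * b⁻¹ * q * b) * (b⁻¹ * z * b),
          mul_mem (hcomm (positivePart_le hq) hbk) hz', by group⟩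
      · obtain ⟨a, ha, hb⟩ := Set.mem_iUnion₂.1 hb
        rcases lt_or_gt_of_ne (hw a ha) with hlt | hlt
        · have hb' : b ∈ positivePart E Φ u y (-w) s :=
            Subgroup.subset_closure (Set.mem_iUnion₂.2
              ⟨a, ⟨ha, by simpa using hlt⟩, rootFiltration_anti hsk hb⟩)
          refine ⟨p * b, mul_mem hp hb', t, ht, q, hq,
            ((t * q)⁻¹ * b⁻¹ * (t * q) * b) * (b⁻¹ * z * b),
            mul_mem (hcomm (mul_mem (htorus ht) (positivePart_le hq)) hbk) hz', by group⟩
        · have hb' : b ∈ positivePart E Φ u y w s :=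
            Subgroup.subset_closure (Set.mem_iUnion₂.2
              ⟨a, ⟨ha, hlt⟩, rootFiltration_anti hsk hb⟩)
          exact ⟨p, hp, t, ht, q * b, mul_mem hq hb', b⁻¹ * z * b, hz', by group⟩
    have hall : ∀ z ∈ filtration E S Φ u y k, ∀ d ∈ D, d * z ∈ D ∧ d * z⁻¹ ∈ D := by
      intro z hz
      induction hz using Subgroup.closure_induction with
      | mem b hb => exact fun d hd => ⟨hgen d hd b hb,
          hgen d hd _ (h.inv_mem_filtrationGens hΦ hS hk0 hb)⟩
      | one => simp
      | mul a b _ _ iha ihb =>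
        intro d hd
        refine ⟨?_, ?_⟩
        · rw [← mul_assoc]
          exact (ihb _ (iha d hd).1).1
        · rw [mul_inv_rev, ← mul_assoc]
          exact (iha _ (ihb d hd).2).2
      | inv a _ iha =>
        intro d hd
        rw [inv_inv]
        exact (iha d hd).symm
    obtain ⟨p, hp, t, ht, q, hq, z, hz, rfl⟩ := ih
    exact (hall z hz _ ⟨p, hp, t, ht, q, hq, 1, one_mem _, (mul_one _).symm⟩).1

/-- The only elements of `T` in a filtration subgroup are those of `S`, if `S` is defined in `T`
by monomial equations. -/
theorem IsCoordinatized.mem_of_mem_filtration [IsAlgClosure F K]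
    (h : IsCoordinatized E G T u y g C) (hS : S ≤ T)
    (hcoroot : ∀ a ∈ Φ, a⁻¹ ∈ Φ → ∀ c, corootElt u a c ∈ S) (hΦ : Φ ⊆ roots G T)
    (hclosed : ∀ a ∈ Φ, ∀ b ∈ Φ, ∀ p q : ℕ, a ^ p * b ^ q ∈ roots G T → a ^ p * b ^ q ∈ Φ)
    (hs : 0 < s) {R : Set (Fin n → ℤ)}
    (hR : ∀ x, diagHom g x ∈ S ↔ ∀ k ∈ R, mono k x = 1) {t : GL (Fin n) K} (htT : t ∈ T)
    (ht : t ∈ filtration E S Φ u y s) : t ∈ S := by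
  have : Algebra.IsAlgebraic F K := IsAlgClosure.isAlgebraic
  obtain ⟨lam, hlam⟩ := h.exists_weights
  choose! w hw0 hw using hlam
  obtain ⟨D₁, hD₁0, hD₁⟩ := h.exists_triangular_bound hw s
  obtain ⟨D₂, hD₂0, hD₂⟩ := h.exists_triangular_bound (lam := -lam) (w := -w)
    (fun a ha i j m hm => by
      have := hw a ha i j m hm
      simp only [Pi.neg_apply]
      linarith) s
  obtain ⟨D₃, hD₃0, hD₃⟩ := h.exists_congruence_bound (S := S) hΦ hS
  obtain ⟨M, hM0, hM⟩ : ∃ M : ℝ, 0 ≤ M ∧ ∀ i j, lam i - lam j ≤ M := by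
    obtain ⟨M, hM⟩ := (Set.finite_range fun p : Fin n × Fin n => lam p.1 - lam p.2).bddAbove
    exact ⟨max M 0, le_max_right _ _, fun i j => (hM ⟨(i, j), rfl⟩).trans (le_max_left _ _)⟩
  obtain ⟨x, rfl⟩ := h.le_range htT
  -- `x` is congruent to elements of `S` to any precision
  have key : ∀ c : ℝ, 0 < c → ∃ v, diagHom g v ∈ S ∧ IsCongrOne F c (x / v) := by
    intro c hc
    obtain ⟨j, hj⟩ := exists_nat_gt ((c + D₁ * M + D₃ + 1) / s)
    rw [div_lt_iff₀ hs] at hj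
    obtain ⟨p, hp, τ, hτ, q, hq, z, hz, hx⟩ :=
      h.exists_decomposition hS hcoroot hΦ hclosed hs (fun a ha => hw0 a (hΦ ha)) j ht
    have hτS : τ ∈ S := (Subgroup.closure_le S).2 (fun _ hz => hz.2.1) hτ
    obtain ⟨v, rfl⟩ := h.le_range (hS hτS)
    refine ⟨v, hτS, fun i => ?_⟩
    have hsymm : ∀ w' : (T →* Kˣ) → ℝ, ∀ z ∈ ⋃ a ∈ {a ∈ Φ | 0 < w' a}, rootFiltration E u y a s,
        z⁻¹ ∈ ⋃ a ∈ {a ∈ Φ | 0 < w' a}, rootFiltration E u y a s := by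
      intro w' z hz
      obtain ⟨a, ha, hz⟩ := Set.mem_iUnion₂.1 hz
      exact Set.mem_iUnion₂.2 ⟨a, ha, h.inv_mem_rootFiltration (hΦ ha.1) hz⟩
    have hP := conj_mem_of_mem_closure (hsymm (-w)) (M := triangular F (-lam) D₂) g (fun z hz => by
      obtain ⟨a, ha, hz⟩ := Set.mem_iUnion₂.1 hz
      exact hD₂ a (hΦ ha.1) ha.2 z hz) (inv_mem hp)
    have hQ := conj_mem_of_mem_closure (hsymm w) (M := triangular F lam D₁) g (fun z hz => by
      obtain ⟨a, ha, hz⟩ := Set.mem_iUnion₂.1 hz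
      exact hD₁ a (hΦ ha.1) ha.2 z hz) hq
    have hDM := mul_nonneg hD₁0 hM0
    have hZ := hD₃ (s + j * s) (by linarith) z hz
    set P : Matrix (Fin n) (Fin n) K := ((g * p⁻¹ * g⁻¹ : GL (Fin n) K) : Matrix (Fin n) (Fin n) K)
    set Q : Matrix (Fin n) (Fin n) K := ((g * q * g⁻¹ : GL (Fin n) K) : Matrix (Fin n) (Fin n) K)
    set Z : Matrix (Fin n) (Fin n) K := ((g * z * g⁻¹ : GL (Fin n) K) : Matrix (Fin n) (Fin n) K)
    have hPQ : P * Matrix.diagonal (fun i => (x i : K)) =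
        Matrix.diagonal (fun i => (v i : K)) * (Q * Z) := by
      rw [← coe_conj_diagHom g, ← coe_conj_diagHom g]
      simp only [P, Q, Z, ← Units.val_mul]
      rw [hx]
      congr 1
      group
    have h1 := congrFun (congrFun hPQ i) i
    rw [Matrix.mul_diagonal, Matrix.diagonal_mul, apply_self_of_mem_triangular hP, one_mul,
      show Q * Z = Q + Q * (Z - 1) by noncomm_ring, Matrix.add_apply,
      apply_self_of_mem_triangular hQ] at h1
    rw [Pi.div_apply, Units.val_div_eq_div_val, h1, mul_div_cancel_left₀ _ (v i).ne_zero,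
      add_sub_cancel_left, Matrix.mul_apply]
    refine le_val_sum _ _ fun m _ => ?_
    refine le_trans ?_ (le_val_mul (hQ i m).2 (hZ m i))
    have h2 := mul_le_mul_of_nonneg_left (hM i m) hD₁0
    norm_cast
    linarith
  rw [hR]
  intro k hk
  by_contra hne
  have hne' : ((mono k x : Kˣ) : K) - 1 ≠ 0 := fun h0 => hne (Units.val_inj.1 (sub_eq_zero.1 h0))
  obtain ⟨c, hc⟩ := exists_val_eq (F := F) hne'
  obtain ⟨v, hv, hxv⟩ := key (|c| + 1) (by positivity)
  have h1 := hxv.mono (by positivity) k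
  rw [map_div, (hR v).1 hv k hk, div_one, hc] at h1
  have h2 : |c| + 1 ≤ c := by exact_mod_cast h1
  linarith [le_abs_self c]

end Decomposition

section JGroups

variable {F : Type*} [Field F] [ValuativeRel F] [TopologicalSpace F] [IsNonarchimedeanLocalField F]
  {K : Type*} [Field K] [Algebra F K] {n : ℕ} {E : IntermediateField F K}
  {G T : Subgroup (GL (Fin n) K)} {u : (T →* Kˣ) → K → GL (Fin n) K}
  {y : (T →* Kˣ) → GL (Fin n) K → WithTop ℝ} {g : GL (Fin n) K} {C : (T →* Kˣ) → ℝ}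
  {L' L S S' : Subgroup (GL (Fin n) K)} {r l : ℝ}

theorem exists_mul_of_mem_closure {Γ : Type*} [Group Γ] {A : Set Γ} {N τ : Subgroup Γ}
    (hτ : τ ≤ Subgroup.normalizer (N : Set Γ)) (hA : A ⊆ N) {x : Γ}
    (hx : x ∈ Subgroup.closure ((τ : Set Γ) ∪ A)) : ∃ b ∈ N, ∃ t ∈ τ, x = b * t := by
  induction hx using Subgroup.closure_induction with
  | mem x hx =>
    rcases hx with hx | hx
    · exact ⟨1, one_mem N, x, hx, (one_mul x).symm⟩
    · exact ⟨x, hA hx, 1, one_mem τ, (mul_one x).symm⟩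
  | one => exact ⟨1, one_mem N, 1, one_mem τ, (mul_one 1).symm⟩
  | mul x z _ _ hx hz =>
    obtain ⟨b, hb, t, ht, rfl⟩ := hx
    obtain ⟨b', hb', t', ht', rfl⟩ := hz
    refine ⟨b * (t * b' * t⁻¹), mul_mem hb ((Subgroup.mem_normalizer_iff.1 (hτ ht) b').1 hb'),
      t * t', mul_mem ht ht', by group⟩
  | inv x _ hx =>
    obtain ⟨b, hb, t, ht, rfl⟩ := hx
    refine ⟨t⁻¹ * b⁻¹ * t⁻¹⁻¹,
      (Subgroup.mem_normalizer_iff.1 (inv_mem (hτ ht)) b⁻¹).1 (inv_mem hb), t⁻¹, inv_mem ht,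
      by group⟩

/-- `S(E)_l` as a subgroup. -/
theorem IsCoordinatized.exists_torusSubgroup [Algebra.IsAlgebraic F K]
    (h : IsCoordinatized E G T u y g C) (hS : S ≤ T) (hl : 0 < l) :
    ∃ τ : Subgroup (GL (Fin n) K), (τ : Set (GL (Fin n) K)) = torusFiltration E S l := by
  refine ⟨⟨⟨⟨torusFiltration E S l, ?_⟩, ?_⟩,
    fun hz => h.inv_mem_torusFiltration hS hl hz⟩, rfl⟩
  · intro a b ha hb
    obtain ⟨x, rfl, h1, h2, h3⟩ := (h.mem_torusFiltration hS hl).1 ha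
    obtain ⟨x', rfl, h1', h2', h3'⟩ := (h.mem_torusFiltration hS hl).1 hb
    refine (h.mem_torusFiltration hS hl).2 ⟨x * x', map_mul _ _ _, fun i => ?_, mul_mem h2 h2',
      h3.mul hl h3'⟩
    rw [Pi.mul_apply, Units.val_mul]
    exact mul_mem (h1 i) (h1' i)
  · refine (h.mem_torusFiltration hS hl).2 ⟨1, map_one _, fun i => one_mem E, one_mem S,
      fun i => ?_⟩
    simp

theorem IsCoordinatized.torusFiltration_mono [Algebra.IsAlgebraic F K]
    (h : IsCoordinatized E G T u y g C) (hSS' : S ≤ S') (hS' : S' ≤ T) (hl : 0 < l) :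
    torusFiltration E S l ⊆ torusFiltration E S' l := by
  intro z hz
  obtain ⟨x, rfl, h1, h2, h3⟩ := (h.mem_torusFiltration (hSS'.trans hS') hl).1 hz
  exact (h.mem_torusFiltration hS' hl).2 ⟨x, rfl, h1, hSS' h2, h3⟩

/-- `L' ⊆ L` are centralizers in `G` of subgroups of `T`. -/
structure IsLeviPair (G T L' L : Subgroup (GL (Fin n) K)) : Prop where
  le : L' ≤ L
  exists_small : ∃ S ≤ T, L' = G ⊓ Subgroup.centralizer (S : Set (GL (Fin n) K))
  exists_large : ∃ S ≤ T, L = G ⊓ Subgroup.centralizer (S : Set (GL (Fin n) K))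

theorem IsLeviPair.roots_subset (hL : IsLeviPair G T L' L) : roots L T ⊆ roots G T := by
  obtain ⟨S, -, h⟩ := hL.exists_large
  exact roots_mono (h.trans_le inf_le_left) T

theorem JE_mono [Algebra.IsAlgebraic F K] (h : IsCoordinatized E G T u y g C) (hSS' : S ≤ S')
    (hS' : S' ≤ T) (hr : 0 < r) : JE E L' L S u y r ≤ JE E L' L S' u y r :=
  Subgroup.closure_mono (Set.union_subset_union_left _ (Set.union_subset_union_left _
    (h.torusFiltration_mono hSS' hS' hr)))

theorem JEplus_mono [Algebra.IsAlgebraic F K] (h : IsCoordinatized E G T u y g C) (hSS' : S ≤ S')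
    (hS' : S' ≤ T) (hr : 0 < r) : JEplus E L' L S u y r ≤ JEplus E L' L S' u y r :=
  Subgroup.closure_mono (Set.union_subset_union_left _ (Set.union_subset_union_left _
    (h.torusFiltration_mono hSS' hS' hr)))

theorem JEplus_le_JE : JEplus E L' L S u y r ≤ JE E L' L S u y r := by
  refine Subgroup.closure_mono (Set.union_subset_union_right _ (Set.iUnion₂_mono fun a _ => ?_))
  refine Set.iUnion_subset fun t => rootFiltration_anti t.2.le

theorem JE_le_filtration (hLL : L' ≤ L) (hr : 0 < r) :
    JE E L' L S u y r ≤ filtration E S (roots L T) u y (r / 2) := by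
  have hr2 : r / 2 ≤ r := by linarith
  refine Subgroup.closure_mono (Set.union_subset (Set.union_subset ?_ ?_) ?_)
  · exact (torusFiltration_anti hr2).trans Set.subset_union_left
  · exact Set.iUnion₂_subset fun a ha z hz => Or.inr
      (Set.mem_iUnion₂.2 ⟨a, roots_mono hLL T ha, rootFiltration_anti hr2 hz⟩)
  · exact Set.iUnion₂_subset fun a ha z hz => Or.inr (Set.mem_iUnion₂.2 ⟨a, ha.1, hz⟩)

theorem filtration_le_JEplus (hr : 0 < r) :
    filtration E S (roots L T) u y r ≤ JEplus E L' L S u y r := by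
  refine Subgroup.closure_mono (Set.union_subset ?_ (Set.iUnion₂_subset fun a ha z hz => ?_))
  · exact fun z hz => Or.inl (Or.inl hz)
  · by_cases ha' : a ∈ roots L' T
    · exact Or.inl (Or.inr (Set.mem_iUnion₂.2 ⟨a, ha', hz⟩))
    · exact Or.inr (Set.mem_iUnion₂.2 ⟨a, ⟨ha, ha'⟩, Set.mem_iUnion.2 ⟨⟨r, by linarith⟩, hz⟩⟩)

theorem IsCoordinatized.closed_roots [IsAlgClosure F K] (h : IsCoordinatized E G T u y g C)
    (hL : IsLeviPair G T L' L) : ∀ a ∈ roots L T, ∀ b ∈ roots L T, ∀ p q : ℕ,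
      a ^ p * b ^ q ∈ roots G T → a ^ p * b ^ q ∈ roots L T := by
  have := infinite_intermediateField E
  have hKinf : Infinite K := Infinite.of_injective _ (algebraMap E K).injective
  obtain ⟨S, hS, hLS⟩ := hL.exists_large
  exact fun a ha b hb p q hab => h.realization.mul_mem_roots hS hLS ha hb hab

/-- `J₊(E)` is normalized by `J(E)`. -/
theorem IsCoordinatized.conj_mem_JEplus [IsAlgClosure F K] (h : IsCoordinatized E G T u y g C)
    (hL : IsLeviPair G T L' L) (hS : S ≤ T)
    (hcoroot : ∀ a ∈ roots L T, a⁻¹ ∈ roots L T → ∀ c, corootElt u a c ∈ S) (hr : 0 < r)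
    {x z : GL (Fin n) K} (hx : x ∈ JE E L' L S u y r) (hz : z ∈ JEplus E L' L S u y r) :
    x * z * x⁻¹ ∈ JEplus E L' L S u y r := by
  have h1 := h.commutator_filtration hS hcoroot hL.roots_subset (h.closed_roots hL) (half_pos hr)
    (half_pos hr) (JE_le_filtration hL.le hr hx) (JE_le_filtration hL.le hr (JEplus_le_JE hz))
  rw [add_halves] at h1
  have h2 := mul_mem (filtration_le_JEplus hr h1) hz
  rwa [inv_mul_cancel_right] at h2

/-- Groups generated by `S(E)_r` and filtration subgroups of root groups are normalized by
`T(E)_r`. -/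
theorem IsCoordinatized.torusFiltration_subset_normalizer [Algebra.IsAlgebraic F K]
    (h : IsCoordinatized E G T u y g C) (hS : S ≤ T) (hr : 0 < r) {A : Set (GL (Fin n) K)}
    (hA : ∀ z ∈ A, ∃ a ∈ roots G T, ∃ l, z ∈ rootFiltration E u y a l ∧
      rootFiltration E u y a l ⊆ A) :
    torusFiltration E T r ⊆
      Subgroup.normalizer (Subgroup.closure (torusFiltration E S r ∪ A) : Set (GL (Fin n) K)) := by
  refine subset_normalizer_closure (fun a ha => h.inv_mem_torusFiltration le_rfl hr ha) ?_
  rintro t ht z (hz | hz)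
  · obtain ⟨x, rfl⟩ := h.le_range ht.2.1
    obtain ⟨x', rfl⟩ := h.le_range (hS hz.2.1)
    rw [← map_mul, mul_comm, map_mul, mul_inv_cancel_right]
    exact Subgroup.subset_closure (Or.inl hz)
  · obtain ⟨a, ha, l, hzl, hlA⟩ := hA z hz
    have h1 := h.commutator_torus_root le_rfl hr ha ht hzl
    have h2 : t * z * t⁻¹ * z⁻¹ ∈ Subgroup.closure (torusFiltration E S r ∪ A) :=
      Subgroup.subset_closure (Or.inr (hlA (rootFiltration_anti (by linarith) h1)))
    have h3 := mul_mem h2 (Subgroup.subset_closure (Or.inr hz))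
    rwa [inv_mul_cancel_right] at h3

/-- `J(E) = J_S(E) T(E)_r`. -/
theorem IsCoordinatized.exists_mul_of_mem_JE [Algebra.IsAlgebraic F K]
    (h : IsCoordinatized E G T u y g C) (hL : IsLeviPair G T L' L) (hS : S ≤ T) (hr : 0 < r)
    {x : GL (Fin n) K} (hx : x ∈ JE E L' L T u y r) :
    ∃ b ∈ JE E L' L S u y r, ∃ t ∈ torusFiltration E T r, x = b * t := by
  obtain ⟨τ, hτ⟩ := h.exists_torusSubgroup le_rfl hr
  rw [JE, Set.union_assoc, ← hτ] at hx
  rw [← hτ]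
  refine exists_mul_of_mem_closure ?_ ?_ hx
  · rw [← SetLike.coe_subset_coe, hτ, JE, Set.union_assoc]
    refine h.torusFiltration_subset_normalizer hS hr ?_
    rintro z (hz | hz)
    · obtain ⟨a, ha, hz⟩ := Set.mem_iUnion₂.1 hz
      exact ⟨a, hL.roots_subset (roots_mono hL.le T ha), r, hz, fun w hw =>
        Or.inl (Set.mem_iUnion₂.2 ⟨a, ha, hw⟩)⟩
    · obtain ⟨a, ha, hz⟩ := Set.mem_iUnion₂.1 hz
      exact ⟨a, hL.roots_subset ha.1, r / 2, hz, fun w hw =>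
        Or.inr (Set.mem_iUnion₂.2 ⟨a, ha, hw⟩)⟩
  · rw [JE, Set.union_assoc]
    exact Set.subset_union_right.trans Subgroup.subset_closure

/-- `J₊(E) = J_{S,+}(E) T(E)_r`. -/
theorem IsCoordinatized.exists_mul_of_mem_JEplus [Algebra.IsAlgebraic F K]
    (h : IsCoordinatized E G T u y g C) (hL : IsLeviPair G T L' L) (hS : S ≤ T) (hr : 0 < r)
    {x : GL (Fin n) K} (hx : x ∈ JEplus E L' L T u y r) :
    ∃ b ∈ JEplus E L' L S u y r, ∃ t ∈ torusFiltration E T r, x = b * t := by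
  obtain ⟨τ, hτ⟩ := h.exists_torusSubgroup le_rfl hr
  rw [JEplus, Set.union_assoc, ← hτ] at hx
  rw [← hτ]
  refine exists_mul_of_mem_closure ?_ ?_ hx
  · rw [← SetLike.coe_subset_coe, hτ, JEplus, Set.union_assoc]
    refine h.torusFiltration_subset_normalizer hS hr ?_
    rintro z (hz | hz)
    · obtain ⟨a, ha, hz⟩ := Set.mem_iUnion₂.1 hz
      exact ⟨a, hL.roots_subset (roots_mono hL.le T ha), r, hz, fun w hw =>
        Or.inl (Set.mem_iUnion₂.2 ⟨a, ha, hw⟩)⟩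
    · obtain ⟨a, ha, hz⟩ := Set.mem_iUnion₂.1 hz
      obtain ⟨l, hz⟩ := Set.mem_iUnion.1 hz
      exact ⟨a, hL.roots_subset ha.1, l, hz, fun w hw =>
        Or.inr (Set.mem_iUnion₂.2 ⟨a, ha, Set.mem_iUnion.2 ⟨l, hw⟩⟩)⟩
  · rw [JEplus, Set.union_assoc]
    exact Set.subset_union_right.trans Subgroup.subset_closure

/-- A group containing `S(E)_r` and the root subgroups of `L` contains `J_S(E)`. -/
theorem IsCoordinatized.JE_le (h : IsCoordinatized E G T u y g C)
    (hL : IsLeviPair G T L' L) {M : Subgroup (GL (Fin n) K)} (hSM : torusFiltration E S r ⊆ M)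
    (hM : ∀ a ∈ roots L T, ∀ c ∈ E, u a c ∈ M) : JE E L' L S u y r ≤ M := by
  have hroot : ∀ a ∈ roots L T, ∀ l, rootFiltration E u y a l ⊆ M := by
    intro a ha l z hz
    obtain ⟨c, hc, rfl⟩ := (h.realization.mem_rootGroup_iff (hL.roots_subset ha)).1 hz.1
    exact hM a ha c hc
  refine (Subgroup.closure_le _).2 (Set.union_subset (Set.union_subset hSM ?_) ?_)
  · exact Set.iUnion₂_subset fun a ha => hroot a (roots_mono hL.le T ha) _
  · exact Set.iUnion₂_subset fun a ha => hroot a ha.1 _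

/-- `J_S(E)` is stable under automorphisms if `S` is. -/
theorem IsCoordinatized.galMap_mem_JE [IsAlgClosure F K] [Normal F E]
    (h : IsCoordinatized E G T u y g C) (hyF : IsGaloisFixed E G T u y)
    (hL : IsLeviPair G T L' L)
    (hL'σ : ∀ σ : K ≃ₐ[F] K, ∀ z ∈ L', galMap σ z ∈ L')
    (hLσ : ∀ σ : K ≃ₐ[F] K, ∀ z ∈ L, galMap σ z ∈ L) (hS : S ≤ T)
    (hSσ : ∀ σ : K ≃ₐ[F] K, ∀ z ∈ S, galMap σ z ∈ S) (hr : 0 < r) (σ : K ≃ₐ[F] K)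
    {x : GL (Fin n) K} (hx : x ∈ JE E L' L S u y r) : galMap σ x ∈ JE E L' L S u y r := by
  have := infinite_intermediateField E
  have : Algebra.IsAlgebraic F K := IsAlgClosure.isAlgebraic
  have hKinf : Infinite K := Infinite.of_injective _ (algebraMap E K).injective
  have hsymm : ∀ z : GL (Fin n) K, galMap σ.symm (galMap σ z) = z := by
    intro z
    apply Units.ext
    ext i j
    simp
  have hback : ∀ {M : Subgroup (GL (Fin n) K)}, (∀ σ : K ≃ₐ[F] K, ∀ z ∈ M, galMap σ z ∈ M) →
      ∀ z, galMap σ z ∈ M → z ∈ M := by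
    intro M hM z hz
    have := hM σ.symm _ hz
    rwa [hsymm] at this
  -- the action on the roots preserves the roots of `L'` and of `L`
  have hiff : ∀ {M S₀ : Subgroup (GL (Fin n) K)}, S₀ ≤ T →
      M = G ⊓ Subgroup.centralizer (S₀ : Set (GL (Fin n) K)) →
      (∀ σ : K ≃ₐ[F] K, ∀ z ∈ M, galMap σ z ∈ M) → ∀ a ∈ roots G T, ∀ b ∈ roots G T,
      (∀ z ∈ rootGroup E u a, galMap σ z ∈ rootGroup E u b) → (a ∈ roots M T ↔ b ∈ roots M T) := by
    intro M S₀ hS₀ hM hMσ a ha b hb hab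
    obtain ⟨c, hc, hcb⟩ := (h.realization.mem_rootGroup_iff hb).1
      (hab (u a 1) ((h.realization.mem_rootGroup_iff ha).2 ⟨1, one_mem E, rfl⟩))
    have hc0 : c ≠ 0 := by
      rintro rfl
      rw [h.realization.map_zero hb] at hcb
      have h1 := hsymm (u a 1)
      rw [← hcb, map_one, ← h.realization.map_zero ha] at h1
      exact zero_ne_one (h.realization.injective ha h1)
    constructor
    · intro ha'
      refine h.realization.mem_roots_of_mem hS₀ hM hb hc0 ?_
      rw [hcb]
      exact hMσ σ _ (h.realization.mem_centralizer hS₀ hM ha' 1)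
    · intro hb'
      refine h.realization.mem_roots_of_mem hS₀ hM ha one_ne_zero (hback hMσ _ ?_)
      rw [← hcb]
      exact h.realization.mem_centralizer hS₀ hM hb' c
  obtain ⟨S₁, hS₁, hLS₁⟩ := hL.exists_small
  obtain ⟨S₂, hS₂, hLS₂⟩ := hL.exists_large
  suffices JE E L' L S u y r ≤ (JE E L' L S u y r).comap (galMap σ) from this hx
  refine (Subgroup.closure_le _).2 (Set.union_subset (Set.union_subset ?_ ?_) ?_)
  · intro z hz
    refine Subgroup.subset_closure (Or.inl (Or.inl ?_))
    obtain ⟨x, rfl, h1, h2, h3⟩ := (h.mem_torusFiltration hS hr).1 hz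
    have h4 := hSσ σ _ h2
    obtain ⟨x', hx'⟩ := h.le_range (hS h4)
    refine (h.mem_torusFiltration hS hr).2 ⟨x', hx', ?_, h4, h3.galMap hr hx'.symm⟩
    rw [← diagHom_mem_ratPoints h.rational, hx']
    exact galMap_mem_ratPoints σ hz.1
  · refine Set.iUnion₂_subset fun a ha z hz => ?_
    have haG := hL.roots_subset (roots_mono hL.le T ha)
    obtain ⟨b, hb, hab⟩ := hyF σ a haG
    refine Subgroup.subset_closure (Or.inl (Or.inr (Set.mem_iUnion₂.2 ⟨b, ?_, (hab z hz.1).1, ?_⟩)))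
    · exact (hiff hS₁ hLS₁ hL'σ a haG b hb fun z hz => (hab z hz).1).1 ha
    · rw [(hab z hz.1).2]
      exact hz.2
  · refine Set.iUnion₂_subset fun a ha z hz => ?_
    have haG := hL.roots_subset ha.1
    obtain ⟨b, hb, hab⟩ := hyF σ a haG
    refine Subgroup.subset_closure (Or.inr (Set.mem_iUnion₂.2 ⟨b, ⟨?_, fun hb' => ha.2 ?_⟩,
      (hab z hz.1).1, ?_⟩))
    · exact (hiff hS₂ hLS₂ hLσ a haG b hb fun z hz => (hab z hz).1).1 ha.1
    · exact (hiff hS₁ hLS₁ hL'σ a haG b hb fun z hz => (hab z hz).1).2 hb'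
    · rw [(hab z hz.1).2]
      exact hz.2

end JGroups

section SatTorus

variable {F : Type*} [Field F] {K : Type*} [Field K] [Algebra F K] {n : ℕ} {g : GL (Fin n) K}
  {S : Subgroup (GL (Fin n) K)}

/-- The subgroup of a diagonalizable group `S` on which all characters of `S` of finite order are
trivial. -/
def satTorus (g : GL (Fin n) K) (S : Subgroup (GL (Fin n) K)) : Subgroup (GL (Fin n) K) :=
  (satSubgroup (S.comap (diagHom g))).map (diagHom g)

theorem diagHom_mem_satTorus {x : Fin n → Kˣ} :
    diagHom g x ∈ satTorus g S ↔ x ∈ satSubgroup (S.comap (diagHom g)) := by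
  refine ⟨?_, fun h => ⟨x, h, rfl⟩⟩
  rintro ⟨x', hx', h⟩
  rwa [← diagHom_injective g h]

theorem satTorus_le (hS : IsZariskiClosed (S : Set (GL (Fin n) K))) : satTorus g S ≤ S := by
  rintro _ ⟨x, hx, rfl⟩
  exact diagHom_mem_of_relations hS g fun k hk => hx k (relations_le_satRelations _ hk)

theorem satTorus_galMap (hS : S ≤ (diagHom g).range) (hSc : IsZariskiClosed (S : Set (GL (Fin n) K)))
    (hSσ : ∀ σ : K ≃ₐ[F] K, ∀ z ∈ S, galMap σ z ∈ S) (σ : K ≃ₐ[F] K) {z : GL (Fin n) K}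
    (hz : z ∈ satTorus g S) : galMap σ z ∈ satTorus g S := by
  obtain ⟨x', hx'⟩ := hS (hSσ σ z (satTorus_le hSc hz))
  obtain ⟨x, hx, rfl⟩ := hz
  rw [← hx', diagHom_mem_satTorus]
  refine satSubgroup_galMap (σ := σ) (fun w hw => ?_) hx hx'.symm
  have h1 := hSσ σ _ hw
  obtain ⟨w', hw'⟩ := hS h1
  refine ⟨w', ?_, hw'.symm⟩
  rw [Subgroup.mem_comap, hw']
  exact h1

end SatTorus

section Saturated

variable {F : Type*} [Field F] [ValuativeRel F] [TopologicalSpace F] [IsNonarchimedeanLocalField F]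
  {K : Type*} [Field K] [Algebra F K] {n : ℕ} {E : IntermediateField F K}
  {G T : Subgroup (GL (Fin n) K)} {u : (T →* Kˣ) → K → GL (Fin n) K}
  {y : (T →* Kˣ) → GL (Fin n) K → WithTop ℝ} {g : GL (Fin n) K} {C : (T →* Kˣ) → ℝ}
  {L' L S : Subgroup (GL (Fin n) K)} {r : ℝ}

theorem IsCoordinatized.corootElt_mem_torus [IsAlgClosure F K]
    (h : IsCoordinatized E G T u y g C) {a : T →* Kˣ} (ha : a ∈ roots G T) (c : Kˣ) :
    corootElt u a c ∈ T := by
  have := infinite_intermediateField E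
  obtain ⟨ζ, κ, hup, hlow, hsq, -⟩ := h.realization.exists_coroot ha h.rational h.le_range
  rw [corootElt_eq hup hlow]
  exact (hsq c).1

theorem IsCoordinatized.corootElt_mem_commutator (h : IsCoordinatized E G T u y g C)
    {a : T →* Kˣ} (ha : a ∈ roots G T) (ha' : a⁻¹ ∈ roots G T) (c : Kˣ) :
    corootElt u a c ∈ ⁅G, G⁆ := by
  have h1 := h.realization.mem_commutator h.le ha
  have h2 := h.realization.mem_commutator h.le ha'
  exact mul_mem (mul_mem (mul_mem (h2 _) (h1 _)) (h2 _))
    (inv_mem (mul_mem (mul_mem (h1 _) (h2 _)) (h1 _)))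

theorem IsCoordinatized.corootElt_mem_satTorus [IsAlgClosure F K]
    (h : IsCoordinatized E G T u y g C) {a : T →* Kˣ} (ha : a ∈ roots G T)
    (hS : ∀ c, corootElt u a c ∈ S) (c : Kˣ) : corootElt u a c ∈ satTorus g S := by
  have := infinite_intermediateField E
  have hKinf : Infinite K := Infinite.of_injective _ (algebraMap E K).injective
  obtain ⟨ζ, κ, hup, hlow, -, hκ, -⟩ := h.realization.exists_coroot ha h.rational h.le_range
  have hcor : ∀ c, corootElt u a c = diagHom g fun i => c ^ κ i := fun c => by
    rw [corootElt_eq hup hlow, hκ]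
  rw [hcor, diagHom_mem_satTorus]
  rintro k ⟨m, hm, hk⟩
  have h1 : m * ∑ i, k i * κ i = 0 := by
    refine eq_zero_of_forall_zpow_eq_one (K := K) fun c => ?_
    rw [mul_comm, zpow_mul, ← mono_zpow, ← mono_smul]
    refine hk _ ?_
    rw [Subgroup.mem_comap, ← hcor]
    exact hS c
  rw [mono_zpow, (mul_eq_zero.1 h1).resolve_left hm, zpow_zero]

/-- `J(E) ∩ GL_n(F)` is the product of `J_S(E) ∩ GL_n(F)` and `T(F)_r`. -/
theorem IsCoordinatized.exists_rational_decomposition [IsAlgClosure F K] [FiniteDimensional F E]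
    [IsGalois F E] (hE : IsTamelyRamified E) (h : IsCoordinatized E G T u y g C)
    (hyF : IsGaloisFixed E G T u y) (hL : IsLeviPair G T L' L)
    (hL'σ : ∀ σ : K ≃ₐ[F] K, ∀ z ∈ L', galMap σ z ∈ L')
    (hLσ : ∀ σ : K ≃ₐ[F] K, ∀ z ∈ L, galMap σ z ∈ L)
    (hTσ : ∀ σ : K ≃ₐ[F] K, ∀ z ∈ T, galMap σ z ∈ T) (hS : S ≤ T)
    (hSc : IsZariskiClosed (S : Set (GL (Fin n) K)))
    (hSσ : ∀ σ : K ≃ₐ[F] K, ∀ z ∈ S, galMap σ z ∈ S)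
    (hcoroot : ∀ a ∈ roots L T, a⁻¹ ∈ roots L T → ∀ c, corootElt u a c ∈ S) (hr : 0 < r)
    {x : GL (Fin n) K} (hx : x ∈ JE E L' L T u y r) (hxF : x ∈ ratPoints (K := K) (n := n) F) :
    ∃ b ∈ JE E L' L S u y r, ∃ t ∈ torusFiltration E T r,
      t ∈ ratPoints (K := K) (n := n) F ∧ x = b * t := by
  have : Algebra.IsAlgebraic F K := IsAlgClosure.isAlgebraic
  have hsat : satTorus g S ≤ S := satTorus_le hSc
  have hsatσ : ∀ σ : K ≃ₐ[F] K, ∀ z ∈ satTorus g S, galMap σ z ∈ satTorus g S := fun σ z hz =>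
    satTorus_galMap (hS.trans h.le_range) hSc hSσ σ hz
  obtain ⟨b, hb, t, ht, rfl⟩ := h.exists_mul_of_mem_JE hL (hsat.trans hS) hr hx
  obtain ⟨v, rfl, hvE, hvT, hv⟩ := (h.mem_torusFiltration le_rfl hr).1 ht
  have hfix : IsAlmostFixed F g (satSubgroup (S.comap (diagHom g))) r v := by
    intro σ
    obtain ⟨v', hv'⟩ := h.le_range (hTσ σ _ hvT)
    refine ⟨v / v', ?_, ?_, ?_⟩
    · rw [← diagHom_mem_satTorus]
      refine h.mem_of_mem_filtration (hsat.trans hS) (Φ := roots L T) (s := r / 2) ?_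
        hL.roots_subset (h.closed_roots hL) (half_pos hr)
        (R := (satRelations (S.comap (diagHom g)) : Set (Fin n → ℤ)))
        (fun x => diagHom_mem_satTorus) ?_ ?_
      · intro a ha ha' c
        exact h.corootElt_mem_satTorus (hL.roots_subset ha) (fun c => hcoroot a ha ha' c) c
      · rw [map_div, hv']
        exact div_mem hvT (hTσ σ _ hvT)
      · have h1 := galMap_eq_of_mem_ratPoints σ hxF
        rw [map_mul] at h1
        have h2 : diagHom g (v / v') = b⁻¹ * galMap σ b := by
          rw [map_div, hv', div_eq_iff_eq_mul, mul_assoc, h1, inv_mul_cancel_left]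
        rw [h2]
        exact JE_le_filtration hL.le hr (mul_mem (inv_mem hb)
          (h.galMap_mem_JE hyF hL hL'σ hLσ (hsat.trans hS) hsatσ hr σ hb))
    · rw [div_eq_mul_inv]
      exact hv.mul hr ((hv.galMap hr hv'.symm).inv hr)
    · rw [map_div, hv', div_mul_cancel]
  obtain ⟨w, hw, hwE, hwr, hwF⟩ := hfix.exists_fixed hE h.rational (fun σ x hx => by
    have h1 := hsatσ σ _ (diagHom_mem_satTorus.2 hx)
    obtain ⟨x', hx'⟩ := h.le_range (hS (hsat h1))
    exact ⟨x', by rwa [← diagHom_mem_satTorus, hx'], hx'.symm⟩) hr hvE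
  have hwS : diagHom g w ∈ satTorus g S := diagHom_mem_satTorus.2 hw
  refine ⟨b * diagHom g w, ?_, diagHom g (w⁻¹ * v), ?_, hwF, ?_⟩
  · refine JE_mono h hsat hS hr (mul_mem hb (Subgroup.subset_closure (Or.inl (Or.inl ?_))))
    exact (h.mem_torusFiltration (hsat.trans hS) hr).2 ⟨w, rfl, hwE, hwS, hwr⟩
  · refine (h.mem_torusFiltration le_rfl hr).2 ⟨_, rfl, fun i => ?_, ?_, (hwr.inv hr).mul hr hv⟩
    · rw [Pi.mul_apply, Units.val_mul, Pi.inv_apply, Units.val_inv_eq_inv_val]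
      exact mul_mem (inv_mem (hwE i)) (hvE i)
    · rw [map_mul, map_inv]
      exact mul_mem (inv_mem (hS (hsat hwS))) hvT
  · rw [mul_assoc, ← map_mul, mul_inv_cancel_left]

end Saturated

/-- An isomorphism of quotients from `A = B N` and `B ∩ N = M`. -/
theorem exists_quotient_equiv {Γ : Type*} [Group Γ] {A N B M : Subgroup Γ} (hBA : B ≤ A)
    (hMN : M ≤ N) [(N.subgroupOf A).Normal] [(M.subgroupOf B).Normal]
    (hBN : ∀ x ∈ A, ∃ b ∈ B, ∃ z ∈ N, x = b * z) (hinf : B ⊓ N ≤ M) :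
    ∃ β : (B ⧸ M.subgroupOf B) ≃* (A ⧸ N.subgroupOf A),
      ∀ j : B, β (QuotientGroup.mk j) = QuotientGroup.mk (Subgroup.inclusion hBA j) := by
  let f := QuotientGroup.map (M.subgroupOf B) (N.subgroupOf A) (Subgroup.inclusion hBA)
    fun x hx => hMN hx
  refine ⟨MulEquiv.ofBijective f ⟨?_, ?_⟩, fun j => rfl⟩
  · rw [injective_iff_map_eq_one]
    intro x hx
    obtain ⟨b, rfl⟩ := QuotientGroup.mk_surjective x
    have h1 : (QuotientGroup.mk (Subgroup.inclusion hBA b) : A ⧸ N.subgroupOf A) = 1 := hx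
    rw [QuotientGroup.eq_one_iff] at h1 ⊢
    exact hinf ⟨b.2, h1⟩
  · intro x
    obtain ⟨a, rfl⟩ := QuotientGroup.mk_surjective x
    obtain ⟨b, hb, z, hz, hbz⟩ := hBN a a.2
    refine ⟨QuotientGroup.mk ⟨b, hb⟩, ?_⟩
    change QuotientGroup.mk (Subgroup.inclusion hBA ⟨b, hb⟩) = (QuotientGroup.mk a : A ⧸ _)
    rw [QuotientGroup.eq, Subgroup.mem_subgroupOf]
    change b⁻¹ * (a : Γ) ∈ N
    rwa [hbz, inv_mul_cancel_left]

theorem normal_subgroupOf_of_conj {Γ : Type*} [Group Γ] {A N : Subgroup Γ}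
    (h : ∀ x ∈ A, ∀ z ∈ N, x * z * x⁻¹ ∈ N) : (N.subgroupOf A).Normal :=
  ⟨fun z hz x => h x x.2 z hz⟩

end YuGroups

end

open YuGroups

theorem J_eq_JH_mul_Jplus
    {F : Type*} [Field F] [ValuativeRel F] [TopologicalSpace F] [IsNonarchimedeanLocalField F]
    {K : Type*} [Field K] [Algebra F K] [IsAlgClosure F K]
    -- `E` is a finite tamely ramified Galois extension of `F`
    (E : IntermediateField F K) [FiniteDimensional F E] [IsGalois F E]
    (hE : YuGroups.IsTamelyRamified E)
    {n : ℕ} (G H : Subgroup (GL (Fin n) K))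
    (hG : YuGroups.IsConnectedReductive F G)
    (hH : YuGroups.IsConnectedAlgGroup F H) (hHG : H ≤ G) (hder : ⁅G, G⁆ ≤ H)
    -- the twisted Levi sequence, and a maximal torus `T` of `G⁰` defined over `F`, split over `E`
    {d : ℕ} (Gs : Fin (d + 1) → Subgroup (GL (Fin n) K))
    (hGs : YuGroups.IsTwistedLeviSequence F E G Gs)
    (T : Subgroup (GL (Fin n) K)) (hT : YuGroups.IsMaximalTorus (Gs 0) T)
    (hTF : YuGroups.IsDefinedOver F (T : Set (GL (Fin n) K))) (hTE : YuGroups.IsSplitTorus E T)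
    -- parametrizations of the root subgroups, and a point `y` of the apartment of `T` over `E`
    -- which lies in the building of `G` over `F`
    (u : (T →* Kˣ) → K → GL (Fin n) K) (hu : YuGroups.IsRealization E G T u)
    (y : (T →* Kˣ) → GL (Fin n) K → WithTop ℝ) (hy : YuGroups.IsApartmentPoint E G T u y)
    (hyF : YuGroups.IsGaloisFixed E G T u y)
    (r : Fin (d + 1) → ℝ) (hr : YuGroups.IsDepthSequence r) :
    ∀ i : Fin d,
      -- `J^{i+1} = J_H^{i+1} J₊^{i+1}`
      (YuGroups.J E Gs u y r i : Set (GL (Fin n) K)) =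
        (YuGroups.JH E Gs H u y r i : Set (GL (Fin n) K)) *
          (YuGroups.Jplus E Gs u y r i : Set (GL (Fin n) K)) ∧
      -- the quotients are groups, and `j J_{H,+} ↦ j J₊` is a well defined group isomorphism
      (∃ (hle : YuGroups.JH E Gs H u y r i ≤ YuGroups.J E Gs u y r i)
        (_ : YuGroups.Jplus E Gs u y r i ≤ YuGroups.J E Gs u y r i)
        (_ : YuGroups.JHplus E Gs H u y r i ≤ YuGroups.JH E Gs H u y r i)
        (_ : ((YuGroups.Jplus E Gs u y r i).subgroupOf (YuGroups.J E Gs u y r i)).Normal)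
        (_ : ((YuGroups.JHplus E Gs H u y r i).subgroupOf (YuGroups.JH E Gs H u y r i)).Normal)
        (β : (YuGroups.JH E Gs H u y r i ⧸
              (YuGroups.JHplus E Gs H u y r i).subgroupOf (YuGroups.JH E Gs H u y r i)) ≃*
            (YuGroups.J E Gs u y r i ⧸
              (YuGroups.Jplus E Gs u y r i).subgroupOf (YuGroups.J E Gs u y r i))),
        ∀ j : YuGroups.JH E Gs H u y r i,
          β (QuotientGroup.mk j) = QuotientGroup.mk (Subgroup.inclusion hle j)) ∧
      -- `J^{i+1} = J₊^{i+1}` if and only if `J_H^{i+1} = J_{H,+}^{i+1}`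
      (YuGroups.J E Gs u y r i = YuGroups.Jplus E Gs u y r i ↔
        YuGroups.JH E Gs H u y r i = YuGroups.JHplus E Gs H u y r i) := by
  have hGc := hG.closed
  obtain ⟨g, hg, hgT⟩ := hTE.diagonalizable
  have hTr : T ≤ (diagHom g).range := fun t ht => exists_diagHom_eq (hgT t ht)
  have hT0 : T ≤ Gs 0 := hT.1.2
  have hTi : ∀ i, T ≤ Gs i := fun i => hT0.trans (hGs.mono (Fin.zero_le i))
  have hTG : T ≤ G := hGs.last ▸ hTi (Fin.last d)
  obtain ⟨C, hC⟩ := hy.exists_isCoordinatized hu hg hTr hTG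
  have : Algebra.IsAlgebraic F K := IsAlgClosure.isAlgebraic
  have hEinf := infinite_intermediateField E
  have hKinf : Infinite K := Infinite.of_injective _ (algebraMap E K).injective
  intro i
  have hr0 := hr.pos i
  have hL : IsLeviPair G T (Gs i.castSucc) (Gs i.succ) :=
    ⟨hGs.mono (Fin.castSucc_lt_succ).le, hGs.exists_eq_centralizer hGc hT _,
      hGs.exists_eq_centralizer hGc hT _⟩
  have hGσ : ∀ j, ∀ σ : K ≃ₐ[F] K, ∀ z ∈ Gs j, galMap σ z ∈ Gs j := fun j σ z hz =>
    galMap_mem ((hGs.levi j).isZariskiClosed hGc) (hGs.definedOver j) σ hz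
  have hTσ : ∀ σ : K ≃ₐ[F] K, ∀ z ∈ T, galMap σ z ∈ T := fun σ z hz =>
    galMap_mem hTE.closed hTF σ hz
  have hTHσ : ∀ σ : K ≃ₐ[F] K, ∀ z ∈ T ⊓ H, galMap σ z ∈ T ⊓ H := fun σ z hz =>
    ⟨hTσ σ z hz.1, galMap_mem hH.closed hH.definedOver σ hz.2⟩
  have hTHc : IsZariskiClosed ((T ⊓ H : Subgroup (GL (Fin n) K)) : Set (GL (Fin n) K)) :=
    hTE.closed.inter hH.closed
  have hcorT : ∀ a ∈ roots (Gs i.succ) T, a⁻¹ ∈ roots (Gs i.succ) T → ∀ c,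
      corootElt u a c ∈ T := fun a ha _ c => hC.corootElt_mem_torus (hL.roots_subset ha) c
  have hcorH : ∀ a ∈ roots (Gs i.succ) T, a⁻¹ ∈ roots (Gs i.succ) T → ∀ c,
      corootElt u a c ∈ T ⊓ H := fun a ha ha' c => ⟨hcorT a ha ha' c,
    hder (hC.corootElt_mem_commutator (hL.roots_subset ha) (hL.roots_subset ha') c)⟩
  -- the groups over `E` lie in `G^{i+1}` and in `H`
  have hJL : JE E (Gs i.castSucc) (Gs i.succ) T u y (r i.castSucc) ≤ Gs i.succ := by
    obtain ⟨S, hS, hLS⟩ := hL.exists_large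
    exact hC.JE_le hL (fun z hz => hTi _ hz.2.1) fun a ha c _ => hu.mem_centralizer hS hLS ha c
  have hJH : JE E (Gs i.castSucc) (Gs i.succ) (T ⊓ H) u y (r i.castSucc) ≤ H :=
    hC.JE_le hL (fun z hz => hz.2.1.2) fun a ha c _ =>
      hder (hu.mem_commutator hTG (hL.roots_subset ha) c)
  have hle : JH E Gs H u y r i ≤ J E Gs u y r i := fun x hx =>
    ⟨JE_mono hC inf_le_left le_rfl hr0 hx.1, hx.2.1.1, hx.2.2⟩
  have hplus : Jplus E Gs u y r i ≤ J E Gs u y r i := fun x hx => ⟨JEplus_le_JE hx.1, hx.2⟩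
  have hHplus : JHplus E Gs H u y r i ≤ JH E Gs H u y r i := fun x hx => ⟨JEplus_le_JE hx.1, hx.2⟩
  have hHplus' : JHplus E Gs H u y r i ≤ Jplus E Gs u y r i := fun x hx =>
    ⟨JEplus_mono hC inf_le_left le_rfl hr0 hx.1, hx.2.1.1, hx.2.2⟩
  have hinf : JH E Gs H u y r i ⊓ Jplus E Gs u y r i ≤ JHplus E Gs H u y r i := by
    rintro x ⟨hx, hx'⟩
    refine ⟨?_, hx.2⟩
    obtain ⟨b, hb, t, ht, rfl⟩ := hC.exists_mul_of_mem_JEplus hL (inf_le_left : T ⊓ H ≤ T) hr0 hx'.1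
    have htH : t ∈ H := by
      have h1 := mul_mem (inv_mem (hJH (JEplus_le_JE hb))) (hx.2.1.2 : b * t ∈ H)
      rwa [inv_mul_cancel_left] at h1
    refine mul_mem hb (Subgroup.subset_closure (Or.inl (Or.inl ?_)))
    obtain ⟨v, rfl, h1, h2, h3⟩ := (hC.mem_torusFiltration le_rfl hr0).1 ht
    exact (hC.mem_torusFiltration inf_le_left hr0).2 ⟨v, rfl, h1, ⟨h2, htH⟩, h3⟩
  have hmul : ∀ x ∈ J E Gs u y r i, ∃ b ∈ JH E Gs H u y r i, ∃ z ∈ Jplus E Gs u y r i,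
      x = b * z := by
    rintro x ⟨hx, hxL, hxF⟩
    obtain ⟨b, hb, t, ht, htF, rfl⟩ := hC.exists_rational_decomposition hE hyF hL (hGσ _) (hGσ _)
      hTσ inf_le_left hTHc hTHσ hcorH hr0 hx hxF
    have hbF : b ∈ ratPoints (K := K) (n := n) F := by
      have h1 := Subgroup.mul_mem _ hxF (Subgroup.inv_mem _ htF)
      rwa [mul_inv_cancel_right] at h1
    exact ⟨b, ⟨hb, ⟨hJL (JE_mono hC inf_le_left le_rfl hr0 hb), hJH hb⟩, hbF⟩, t,
      ⟨Subgroup.subset_closure (Or.inl (Or.inl ht)), hTi _ ht.2.1, htF⟩, rfl⟩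
  have hnormal : ((Jplus E Gs u y r i).subgroupOf (J E Gs u y r i)).Normal :=
    normal_subgroupOf_of_conj fun x hx z hz =>
      ⟨hC.conj_mem_JEplus hL le_rfl hcorT hr0 hx.1 hz.1,
        Subgroup.mul_mem _ (Subgroup.mul_mem _ hx.2 hz.2) (Subgroup.inv_mem _ hx.2)⟩
  have hHnormal : ((JHplus E Gs H u y r i).subgroupOf (JH E Gs H u y r i)).Normal :=
    normal_subgroupOf_of_conj fun x hx z hz =>
      ⟨hC.conj_mem_JEplus hL inf_le_left hcorH hr0 hx.1 hz.1,
        Subgroup.mul_mem _ (Subgroup.mul_mem _ hx.2 hz.2) (Subgroup.inv_mem _ hx.2)⟩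
  obtain ⟨β, hβ⟩ := exists_quotient_equiv hle hHplus' hmul hinf
  refine ⟨?_, ⟨hle, hplus, hHplus, hnormal, hHnormal, β, hβ⟩, fun h => ?_, fun h => ?_⟩
  · ext x
    constructor
    · intro hx
      obtain ⟨b, hb, z, hz, rfl⟩ := hmul x hx
      exact Set.mul_mem_mul hb hz
    · rintro ⟨b, hb, z, hz, rfl⟩
      exact mul_mem (hle hb) (hplus hz)
  · exact le_antisymm (fun x hx => hinf ⟨hx, h ▸ hle hx⟩) hHplus
  · refine le_antisymm (fun x hx => ?_) hplus
    obtain ⟨b, hb, z, hz, rfl⟩ := hmul x hx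
    exact mul_mem (hHplus' (h ▸ hb)) hz
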